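/- arXiv:0905.1047 — 3 statements merged into one kernel-verified Lean document; each statement's English description precedes it below -/
import Mathlib

section
/- Let A and B be unital complex Banach algebras and let 𝔄 and 𝔅 be open subgroups of A⁻¹ and B⁻¹ respectively. Suppose T : 𝔄 → 𝔅 is a group isomorphism which is also an isometry (‖T(a) − T(b)‖ = ‖a − b‖ for all a, b ∈ 𝔄). Then T extends to a surjective isometric real-algebra isomorphism T̃ : A → B (a bijective real-linear multiplicative isometry with T̃(a) = T(a) for all a ∈ 𝔄). In particular, A⁻¹ is isometrically isomorphic to B⁻¹ as a metrizable group. -/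
/-- An isometry of a bounded metric space carrying a point reflection fixes its centre. -/
theorem IsometryEquiv.apply_eq_of_reflection {M : Type*} [MetricSpace M] (σ : M ≃ᵢ M) (z : M)
    (hσ : ∀ w, dist (σ w) w = 2 * dist w z) {C : ℝ} (hC : ∀ w, dist w z ≤ C) (g : M ≃ᵢ M) :
    g z = z := by
  have hσz : σ z = z := by
    rw [← dist_eq_zero, hσ, dist_self, mul_zero]
  have key : ∀ (n : ℕ) (g : M ≃ᵢ M), 2 ^ n * dist (g z) z ≤ C := by
    intro n
    induction n with
    | zero => intro g; simpa using hC (g z)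
    | succ n ih =>
      intro g
      have h := ih (((g.trans σ).trans g.symm).trans σ)
      have h1 : dist ((((g.trans σ).trans g.symm).trans σ) z) z = 2 * dist (g z) z := by
        calc dist (σ (g.symm (σ (g z)))) z = dist (σ (g.symm (σ (g z)))) (σ z) := by rw [hσz]
          _ = dist (g (g.symm (σ (g z)))) (g z) := by rw [σ.dist_eq, g.dist_eq]
          _ = 2 * dist (g z) z := by rw [g.apply_symm_apply, hσ]
      rw [h1] at h
      rw [pow_succ]
      linarith
  by_contra hne
  have hpos : 0 < dist (g z) z := dist_pos.2 hne
  obtain ⟨n, hn⟩ := pow_unbounded_of_one_lt (C / dist (g z) z) (one_lt_two (α := ℝ))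
  rw [div_lt_iff₀ hpos] at hn
  exact absurd (key n g) (not_le.2 hn)

/-- Isometric equivalences between spaces with point reflections match the centres. -/
theorem IsometryEquiv.apply_center_eq {M N : Type*} [MetricSpace M] [MetricSpace N]
    (σ : M ≃ᵢ M) (z : M) (hσ : ∀ w, dist (σ w) w = 2 * dist w z) {C : ℝ}
    (hC : ∀ w, dist w z ≤ C) (τ : N ≃ᵢ N) (z' : N) (hτ : ∀ w, dist (τ w) w = 2 * dist w z')
    (e : M ≃ᵢ N) : e z = z' := by
  have h := IsometryEquiv.apply_eq_of_reflection σ z hσ hC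
    (((e.trans τ).trans e.symm).trans σ)
  have hσz : σ z = z := by
    rw [← dist_eq_zero, hσ, dist_self, mul_zero]
  have h1 : σ (e.symm (τ (e z))) = σ z := h.trans hσz.symm
  have h2 : τ (e z) = e z := by
    rw [← e.apply_symm_apply (τ (e z)), σ.injective h1]
  have h3 := hτ (e z)
  rw [h2, dist_self] at h3
  exact dist_eq_zero.1 (by linarith)

section LocalMazurUlam

variable {E F : Type*} [NormedAddCommGroup E] [NormedSpace ℝ E]
  [NormedAddCommGroup F] [NormedSpace ℝ F]

/-- The set of metric midpoints of `0` and `x`. -/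
def metricMidpoints (x : E) : Set E := {w | ‖w‖ = ‖x‖ / 2 ∧ ‖w - x‖ = ‖x‖ / 2}

theorem half_mem_metricMidpoints (x : E) : (2⁻¹ : ℝ) • x ∈ metricMidpoints x := by
  have h : (2⁻¹ : ℝ) • x - x = -((2⁻¹ : ℝ) • x) := by module
  have h2 : ‖(2⁻¹ : ℝ) • x‖ = ‖x‖ / 2 := by
    rw [norm_smul, Real.norm_of_nonneg (by norm_num)]; ring
  exact ⟨h2, by rw [h, norm_neg, h2]⟩

/-- The reflection of the metric midpoints of `0` and `x` in `x / 2`. -/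
def metricMidpointsReflection (x : E) : metricMidpoints x ≃ᵢ metricMidpoints x :=
  IsometryEquiv.mk'
    (fun w => ⟨x - w, by
      have := w.2
      exact ⟨by rw [norm_sub_rev]; exact this.2, by simpa using this.1⟩⟩)
    (fun w => ⟨x - w, by
      have := w.2
      exact ⟨by rw [norm_sub_rev]; exact this.2, by simpa using this.1⟩⟩)
    (fun w => Subtype.ext (by simp))
    (Isometry.of_dist_eq fun v w => by
      rw [Subtype.dist_eq, Subtype.dist_eq, dist_eq_norm, dist_eq_norm, sub_sub_sub_cancel_left,
        norm_sub_rev])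

theorem dist_metricMidpointsReflection (x : E) (w : metricMidpoints x) :
    dist (metricMidpointsReflection x w) w =
      2 * dist w ⟨(2⁻¹ : ℝ) • x, half_mem_metricMidpoints x⟩ := by
  change dist (x - (w : E)) w = 2 * dist (w : E) ((2⁻¹ : ℝ) • x)
  have h : x - (w : E) - w = (-2 : ℝ) • ((w : E) - (2⁻¹ : ℝ) • x) := by module
  rw [dist_eq_norm, dist_eq_norm, h, norm_smul]
  norm_num

variable {f : E → F} {r : ℝ}

/-- An isometry between balls centred at the origin commutes with halving. -/
theorem map_half_of_isometry_ball (hr : 0 < r) (h0 : f 0 = 0)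
    (hf : ∀ x y, ‖x‖ < r → ‖y‖ < r → ‖f x - f y‖ = ‖x - y‖)
    (hsurj : ∀ y, ‖y‖ < r → ∃ x, ‖x‖ < r ∧ f x = y) {x : E} (hx : ‖x‖ < r) :
    f ((2⁻¹ : ℝ) • x) = (2⁻¹ : ℝ) • f x := by
  have hnorm : ∀ y, ‖y‖ < r → ‖f y‖ = ‖y‖ := fun y hy => by
    simpa [h0] using hf y 0 hy (by simpa using hr)
  have hlt : ∀ w ∈ metricMidpoints x, ‖w‖ < r := fun w hw => by
    have := hw.1
    linarith [norm_nonneg x]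
  let φ : metricMidpoints x → metricMidpoints (f x) := fun w => ⟨f w, by
    have hw := hlt w w.2
    exact ⟨by rw [hnorm _ hw, hnorm x hx]; exact w.2.1,
      by rw [hf _ _ hw hx, hnorm x hx]; exact w.2.2⟩⟩
  have hφ : Isometry φ := Isometry.of_dist_eq fun v w => by
    change dist (f v) (f w) = dist (v : E) w
    rw [dist_eq_norm, dist_eq_norm, hf _ _ (hlt v v.2) (hlt w w.2)]
  have hφs : Function.Surjective φ := by
    rintro ⟨w, hw1, hw2⟩
    rw [hnorm x hx] at hw1 hw2
    obtain ⟨v, hv, rfl⟩ := hsurj w (by linarith [norm_nonneg x])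
    exact ⟨⟨v, by rw [← hnorm v hv]; exact hw1, by rw [← hf v x hv hx]; exact hw2⟩, rfl⟩
  let e : metricMidpoints x ≃ᵢ metricMidpoints (f x) :=
    ⟨Equiv.ofBijective φ ⟨hφ.injective, hφs⟩, hφ⟩
  have h := IsometryEquiv.apply_center_eq (metricMidpointsReflection x)
    ⟨_, half_mem_metricMidpoints x⟩ (dist_metricMidpointsReflection x) (C := ‖x‖)
    (fun w => by
      change dist (w : E) ((2⁻¹ : ℝ) • x) ≤ ‖x‖
      rw [dist_eq_norm]
      have h1 := w.2.1
      have h2 := (half_mem_metricMidpoints x).1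
      linarith [norm_sub_le (w : E) ((2⁻¹ : ℝ) • x)])
    (metricMidpointsReflection (f x)) ⟨_, half_mem_metricMidpoints (f x)⟩
    (dist_metricMidpointsReflection (f x)) e
  exact congrArg Subtype.val h

theorem exists_forall_ge_norm_inv_two_pow_smul_lt (hr : 0 < r) (x : E) :
    ∃ n : ℕ, ∀ m ≥ n, ‖((2⁻¹ : ℝ) ^ m) • x‖ < r := by
  have ht : Filter.Tendsto (fun m : ℕ => ((2⁻¹ : ℝ) ^ m) • x) Filter.atTop (nhds 0) := by
    simpa using (tendsto_pow_atTop_nhds_zero_of_lt_one (r := (2⁻¹ : ℝ)) (by norm_num)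
      (by norm_num)).smul_const x
  exact Filter.eventually_atTop.1 (ht.norm.eventually (gt_mem_nhds (by simpa using hr)))

/-- A surjective isometry between balls centred at the origin which fixes the origin is the
restriction of a linear isometric equivalence. -/
theorem exists_linearIsometryEquiv_of_isometry_ball (hr : 0 < r) (h0 : f 0 = 0)
    (hf : ∀ x y, ‖x‖ < r → ‖y‖ < r → ‖f x - f y‖ = ‖x - y‖)
    (hsurj : ∀ y, ‖y‖ < r → ∃ x, ‖x‖ < r ∧ f x = y) :
    ∃ L : E ≃ₗᵢ[ℝ] F, ∀ x, ‖x‖ < r → L x = f x := by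
  have hhalf : ∀ (n : ℕ) (x : E), ‖x‖ < r → ‖((2⁻¹ : ℝ) ^ n) • x‖ < r ∧
      (2 : ℝ) ^ n • f (((2⁻¹ : ℝ) ^ n) • x) = f x := by
    intro n x hx
    induction n with
    | zero => simpa using hx
    | succ n ih =>
      obtain ⟨h1, h2⟩ := ih
      have h3 : ((2⁻¹ : ℝ) ^ (n + 1)) • x = (2⁻¹ : ℝ) • (((2⁻¹ : ℝ) ^ n) • x) := by
        rw [smul_smul, pow_succ']
      refine ⟨?_, ?_⟩
      · rw [h3, norm_smul, Real.norm_of_nonneg (by norm_num)]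
        linarith [norm_nonneg (((2⁻¹ : ℝ) ^ n) • x)]
      · rw [h3, map_half_of_isometry_ball hr h0 hf hsurj h1, smul_smul, pow_succ, mul_assoc,
          mul_inv_cancel₀ two_ne_zero, mul_one, h2]
  have hL : ∀ x : E, ∃ l : F, ∃ n : ℕ, ∀ m ≥ n, ‖((2⁻¹ : ℝ) ^ m) • x‖ < r ∧
      (2 : ℝ) ^ m • f (((2⁻¹ : ℝ) ^ m) • x) = l := by
    intro x
    obtain ⟨n, hn⟩ := exists_forall_ge_norm_inv_two_pow_smul_lt hr x
    refine ⟨(2 : ℝ) ^ n • f (((2⁻¹ : ℝ) ^ n) • x), n, fun m hm => ⟨hn m hm, ?_⟩⟩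
    obtain ⟨k, rfl⟩ := Nat.exists_eq_add_of_le hm
    rw [← (hhalf k _ (hn n le_rfl)).2, smul_smul, smul_smul, ← pow_add, ← pow_add, add_comm k n]
  choose L N hN using hL
  have heq : ∀ x, ‖x‖ < r → L x = f x := fun x hx =>
    (hN x (N x) le_rfl).2.symm.trans (hhalf _ x hx).2
  have hiso : Isometry L := by
    refine Isometry.of_dist_eq fun x y => ?_
    obtain ⟨hx, hx'⟩ := hN x (max (N x) (N y)) (le_max_left _ _)
    obtain ⟨hy, hy'⟩ := hN y (max (N x) (N y)) (le_max_right _ _)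
    rw [dist_eq_norm, dist_eq_norm, ← hx', ← hy', ← smul_sub, norm_smul, hf _ _ hx hy, ← smul_sub,
      ← norm_smul, smul_smul, ← mul_pow, mul_inv_cancel₀ two_ne_zero, one_pow, one_smul]
  have hsur : Function.Surjective L := by
    intro y
    obtain ⟨n, hn⟩ := exists_forall_ge_norm_inv_two_pow_smul_lt hr y
    obtain ⟨x, hx, hxy⟩ := hsurj _ (hn n le_rfl)
    refine ⟨(2 : ℝ) ^ n • x, ?_⟩
    set m := max n (N ((2 : ℝ) ^ n • x))
    obtain ⟨k, hk⟩ := Nat.exists_eq_add_of_le (le_max_left n (N ((2 : ℝ) ^ n • x)))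
    have h1 := (hN _ (n + k) (hk ▸ le_max_right n (N ((2 : ℝ) ^ n • x)))).2
    have h2 : ((2⁻¹ : ℝ) ^ (n + k)) • (2 : ℝ) ^ n • x = ((2⁻¹ : ℝ) ^ k) • x := by
      rw [smul_smul, pow_add, mul_right_comm, ← mul_pow, inv_mul_cancel₀ two_ne_zero, one_pow,
        one_mul]
    rw [h2, pow_add, mul_smul, (hhalf k x hx).2, hxy, smul_smul, ← mul_pow,
      mul_inv_cancel₀ two_ne_zero, one_pow, one_smul] at h1
    exact h1.symm
  let e : E ≃ᵢ F := ⟨Equiv.ofBijective L ⟨hiso.injective, hsur⟩, hiso⟩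
  have he0 : e 0 = 0 := (heq 0 (by simpa using hr)).trans h0
  exact ⟨e.toRealLinearIsometryEquivOfMapZero he0, heq⟩

end LocalMazurUlam

section BanachAlgebra

variable {A : Type*} [NormedRing A] [NormedAlgebra ℂ A]

/-- If the powers of `1 - h • d` are uniformly bounded for all `h` on a circle about the origin,
then `d = 0`. -/
theorem eq_zero_of_forall_norm_one_sub_smul_pow_le {d : A} {δ C : ℝ} (hδ : 0 < δ)
    (h : ∀ (t : ℂ) (n : ℕ), ‖t‖ = δ → ‖(1 - t • d) ^ n‖ ≤ C) : d = 0 := by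
  have key : ∀ n : ℕ, n * ‖d‖ ≤ C / δ := by
    intro n
    have hlin : HasDerivAt (fun t : ℂ => 1 - t • d) (-d) 0 := by
      simpa using ((hasDerivAt_id (0 : ℂ)).smul_const d).const_sub 1
    have hd : HasDerivAt (fun t : ℂ => (1 - t • d) ^ n) (-((n : ℂ) • d)) 0 := by
      induction n with
      | zero => simpa using hasDerivAt_const (0 : ℂ) (1 : A)
      | succ n ih =>
        have := ih.mul hlin
        simp only [pow_succ]
        convert this using 1
        · rfl
        · simp [add_smul, add_comm]
    have hdiff : Differentiable ℂ fun t : ℂ => (1 - t • d) ^ n := by fun_prop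
    have hb := Complex.norm_deriv_le_of_forall_mem_sphere_norm_le (c := (0 : ℂ)) (C := C) hδ
      hdiff.diffContOnCl fun t ht => h t n (by simpa using ht)
    rw [hd.deriv, norm_neg, norm_smul] at hb
    simpa using hb
  by_contra hne
  obtain ⟨n, hn⟩ := exists_nat_gt (C / δ / ‖d‖)
  rw [div_lt_iff₀ (norm_pos_iff.2 hne)] at hn
  exact absurd (key n) (not_le.2 hn)

/-- A multiplicative isometry of a subsemigroup containing a ball about `1` is the identity as
soon as it is the identity on that ball. -/
theorem eq_self_of_multiplicative_isometry {U : Set A} {R : A → A} {ρ : ℝ} (hρ : 0 < ρ)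
    (hU : Metric.ball 1 ρ ⊆ U) (hUmul : ∀ a ∈ U, ∀ b ∈ U, a * b ∈ U)
    (hR : ∀ a ∈ U, ∀ b ∈ U, R (a * b) = R a * R b)
    (hiso : ∀ a ∈ U, ∀ b ∈ U, ‖R a - R b‖ = ‖a - b‖)
    (hid : ∀ a ∈ Metric.ball (1 : A) ρ, R a = a) {a : A} (ha : a ∈ U) : R a = a := by
  have hmul : ∀ g h : A, g ∈ U ∧ R g = g → h ∈ U ∧ R h = h → g * h ∈ U ∧ R (g * h) = g * h :=
    fun g h hg hh => ⟨hUmul g hg.1 h hh.1, by rw [hR g hg.1 h hh.1, hg.2, hh.2]⟩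
  have hball : ∀ g ∈ Metric.ball (1 : A) ρ, g ∈ U ∧ R g = g := fun g hg => ⟨hU hg, hid g hg⟩
  have hpow : ∀ g ∈ Metric.ball (1 : A) ρ, ∀ n : ℕ, g ^ n ∈ U ∧ R (g ^ n) = g ^ n := by
    intro g hg n
    induction n with
    | zero => simpa using hball 1 (Metric.mem_ball_self hρ)
    | succ n ih => rw [pow_succ]; exact hmul _ _ ih (hball g hg)
  have hscalar : ∀ t : ℂ, t ≠ 0 → t • (1 : A) ∈ U ∧ R (t • (1 : A)) = t • (1 : A) := by
    intro t ht
    have hlim : Filter.Tendsto (fun n : ℕ => Complex.exp (Complex.log t / n) • (1 : A))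
        Filter.atTop (nhds 1) := by
      have h1 : Filter.Tendsto (fun n : ℕ => Complex.log t / n) Filter.atTop (nhds 0) :=
        tendsto_const_div_atTop_nhds_zero_nat (Complex.log t)
      have h2 := (Complex.continuous_exp.tendsto 0).comp h1
      simpa using h2.smul_const (1 : A)
    obtain ⟨n, hn, hn0⟩ := ((hlim.eventually (Metric.ball_mem_nhds 1 hρ)).and
      (Filter.eventually_ne_atTop 0)).exists
    have h := hpow _ hn n
    rwa [smul_pow, one_pow, ← Complex.exp_nat_mul, mul_div_cancel₀ _ (Nat.cast_ne_zero.2 hn0),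
      Complex.exp_log ht] at h
  set d := R a - a with hd
  set δ := ρ / (‖a‖ + ‖d‖ + 1) with hδdef
  have hpos : 0 < ‖a‖ + ‖d‖ + 1 := by positivity
  have hδ : 0 < δ := by positivity
  have hδρ : δ * (‖a‖ + ‖d‖ + 1) = ρ := div_mul_cancel₀ _ hpos.ne'
  have hsmall : ∀ (t : ℂ) (b : A), ‖t‖ = δ → ‖b‖ ≤ ‖a‖ + ‖d‖ → ‖t • b‖ < ρ := by
    intro t b ht hb
    rw [norm_smul, ht, ← hδρ]
    exact mul_lt_mul_of_pos_left (by linarith) hδ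
  refine sub_eq_zero.1 (eq_zero_of_forall_norm_one_sub_smul_pow_le (d := d) (C := ‖(1 : A)‖)
    hδ fun t n ht => ?_)
  have ht0 : t ≠ 0 := norm_pos_iff.1 (ht ▸ hδ)
  have hda : 1 - t • d ∈ Metric.ball (1 : A) ρ := by
    rw [Metric.mem_ball, dist_eq_norm, sub_sub_cancel_left, norm_neg]
    exact hsmall t d ht (by linarith [norm_nonneg a])
  have h1a : 1 + t • a ∈ Metric.ball (1 : A) ρ := by
    rw [Metric.mem_ball, dist_eq_norm, add_sub_cancel_left]
    exact hsmall t a ht (by linarith [norm_nonneg d])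
  have hta : t • a ∈ U ∧ R (t • a) = t • R a := by
    obtain ⟨h1, h2⟩ := hscalar t ht0
    have h3 : t • a = (t • (1 : A)) * a := by simp
    rw [h3]
    exact ⟨hUmul _ h1 _ ha, by rw [hR _ h1 _ ha, h2]; simp⟩
  have hstep : ∀ g, g ∈ U ∧ R g = g → ‖(1 - t • d) * g‖ = ‖g‖ := by
    intro g hg
    obtain ⟨h1, h2⟩ := hmul _ g (hball _ h1a) hg
    have h3 := hiso _ h1 _ (hUmul _ hta.1 g hg.1)
    rw [h2, hR _ hta.1 g hg.1, hta.2, hg.2, ← sub_mul, ← sub_mul, add_sub_cancel_right,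
      one_mul] at h3
    rw [← h3, hd, smul_sub]
    congr 2
    abel
  induction n with
  | zero => simp
  | succ n ih =>
    rw [pow_succ', hstep _ (hpow _ hda n)]
    exact ih

end BanachAlgebra


/-- Corollary 4.1: an isometric group isomorphism `T` between open subgroups
`𝔄 ⊆ A⁻¹` and `𝔅 ⊆ B⁻¹` of unital complex Banach algebras extends to a
surjective isometric real-algebra isomorphism `S : A → B`; in particular `A⁻¹`
is isometrically isomorphic to `B⁻¹` as a metrizable group (`S` restricts to a
bijection between the unit sets). -/
theorem isometric_group_iso_extends_real_algebra_iso
    {A B : Type*} [NormedRing A] [NormedAlgebra ℂ A] [CompleteSpace A]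
    [NormedRing B] [NormedAlgebra ℂ B] [CompleteSpace B]
    (𝔄 : Set A) (𝔅 : Set B)
    (h𝔄unit : ∀ a ∈ 𝔄, IsUnit a) (h𝔄one : (1 : A) ∈ 𝔄)
    (h𝔄mul : ∀ a ∈ 𝔄, ∀ b ∈ 𝔄, a * b ∈ 𝔄)
    (h𝔄inv : ∀ a ∈ 𝔄, Ring.inverse a ∈ 𝔄) (h𝔄open : IsOpen 𝔄)
    (h𝔅unit : ∀ b ∈ 𝔅, IsUnit b) (h𝔅one : (1 : B) ∈ 𝔅)
    (h𝔅mul : ∀ a ∈ 𝔅, ∀ b ∈ 𝔅, a * b ∈ 𝔅)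
    (h𝔅inv : ∀ b ∈ 𝔅, Ring.inverse b ∈ 𝔅) (h𝔅open : IsOpen 𝔅)
    (T : A → B) (hbij : Set.BijOn T 𝔄 𝔅)
    (hmult : ∀ a ∈ 𝔄, ∀ b ∈ 𝔄, T (a * b) = T a * T b)
    (hiso : ∀ a ∈ 𝔄, ∀ b ∈ 𝔄, ‖T a - T b‖ = ‖a - b‖) :
    ∃ S : A → B,
      Function.Bijective S ∧
      (∀ x y : A, S (x + y) = S x + S y) ∧
      (∀ (r : ℝ) (x : A), S (r • x) = r • S x) ∧
      (∀ x y : A, S (x * y) = S x * S y) ∧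
      (∀ x y : A, dist (S x) (S y) = dist x y) ∧
      (∀ a ∈ 𝔄, S a = T a) ∧
      Set.BijOn S {x : A | IsUnit x} {y : B | IsUnit y} := by
  obtain ⟨r₁, hr₁, hball₁⟩ := Metric.isOpen_iff.1 h𝔄open 1 h𝔄one
  obtain ⟨r₂, hr₂, hball₂⟩ := Metric.isOpen_iff.1 h𝔅open 1 h𝔅one
  set r := min r₁ r₂
  have hr : 0 < r := lt_min hr₁ hr₂
  have hA : ∀ x : A, ‖x‖ < r → 1 + x ∈ 𝔄 := fun x hx =>
    hball₁ (by simpa using hx.trans_le (min_le_left r₁ r₂))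
  have hB : ∀ y : B, ‖y‖ < r → 1 + y ∈ 𝔅 := fun y hy =>
    hball₂ (by simpa using hy.trans_le (min_le_right r₁ r₂))
  have hT1 : T 1 = 1 := by
    have h := hmult 1 h𝔄one 1 h𝔄one
    rw [mul_one] at h
    exact (h𝔅unit _ (hbij.mapsTo h𝔄one)).mul_left_cancel (by rw [← h, mul_one])
  obtain ⟨L, hL⟩ := exists_linearIsometryEquiv_of_isometry_ball (f := fun x => T (1 + x) - 1) hr
    (by simp [hT1])
    (fun x y hx hy => by
      have := hiso _ (hA x hx) _ (hA y hy)
      simpa using this)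
    (fun y hy => by
      obtain ⟨a, ha, hay⟩ := hbij.surjOn (hB y hy)
      refine ⟨a - 1, ?_, by simp [hay]⟩
      have := hiso a ha 1 h𝔄one
      rw [hay, hT1, add_sub_cancel_left] at this
      rwa [← this])
  have hTL : ∀ x, ‖x‖ < r → T (1 + x) = 1 + L x := fun x hx => by rw [hL x hx]; abel
  have hLmul : ∀ x y, L (x * y) = L x * L y := by
    intro x y
    have hlim : ∀ z : A, Filter.Tendsto (fun t : ℝ => ‖t • z‖) (nhdsWithin 0 (Set.Ioi 0))
        (nhds 0) := fun z => by
      have : Continuous fun t : ℝ => ‖t • z‖ := by fun_prop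
      simpa using (this.tendsto 0).mono_left nhdsWithin_le_nhds
    have hlim' : Filter.Tendsto (fun t : ℝ => ‖t • x + t • y + (t • x) * (t • y)‖)
        (nhdsWithin 0 (Set.Ioi 0)) (nhds 0) := by
      have : Continuous fun t : ℝ => ‖t • x + t • y + (t • x) * (t • y)‖ := by fun_prop
      simpa using (this.tendsto 0).mono_left nhdsWithin_le_nhds
    obtain ⟨t, ⟨⟨hx, hy⟩, hxy⟩, ht⟩ := ((((hlim x).eventually (gt_mem_nhds hr)).and
      ((hlim y).eventually (gt_mem_nhds hr))).and (hlim'.eventually (gt_mem_nhds hr))).and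
      self_mem_nhdsWithin |>.exists
    have ht0 : t * t ≠ 0 := (mul_pos ht ht).ne'
    have h := hmult _ (hA _ hx) _ (hA _ hy)
    have hexp : (1 + t • x) * (1 + t • y) = 1 + (t • x + t • y + (t • x) * (t • y)) := by
      rw [mul_add, add_mul _ _ (t • y), one_mul, mul_one]
      abel
    rw [hexp, hTL _ hxy, hTL _ hx, hTL _ hy, map_add, map_add, smul_mul_smul_comm] at h
    simp only [map_smul] at h
    have h' : (t * t) • L (x * y) = (t * t) • (L x * L y) := by
      rw [mul_add, add_mul _ _ (t • L y), one_mul, mul_one, smul_mul_smul_comm, ← add_assoc, ← add_assoc,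
        ← add_assoc] at h
      exact add_left_cancel h
    exact smul_right_injective B ht0 h'
  have hL1 : L 1 = 1 := by
    obtain ⟨u, hu⟩ := L.surjective 1
    have := hLmul 1 u
    rw [one_mul, hu, mul_one] at this
    exact this.symm
  have hLT : ∀ a ∈ 𝔄, L a = T a := by
    intro a ha
    have h := eq_self_of_multiplicative_isometry (U := 𝔄) (R := fun x => L.symm (T x)) hr
      (fun x hx => by simpa using hA (x - 1) (by simpa [dist_eq_norm] using hx)) h𝔄mul
      (fun x hx y hy => L.injective (by simp [hLmul, hmult x hx y hy]))
      (fun x hx y hy => by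
        rw [← map_sub, L.symm.norm_map, hiso x hx y hy])
      (fun x hx => by
        have := hTL (x - 1) (by simpa [dist_eq_norm] using hx)
        rw [add_sub_cancel, map_sub, hL1, add_sub_cancel] at this
        simp [this]) ha
    exact (L.symm_apply_eq.1 h).symm
  let e : A ≃* B := { L.toEquiv with map_mul' := hLmul }
  refine ⟨L, L.bijective, map_add L, fun s x => map_smul L s x, hLmul, L.dist_map, hLT,
    fun x hx => (MulEquiv.isUnit_map e).2 hx, L.injective.injOn, fun y hy => ?_⟩
  exact ⟨e.symm y, (MulEquiv.isUnit_map e.symm).2 hy, e.apply_symm_apply y⟩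
end

section
/- Let 𝒳 and 𝒴 be complex Banach spaces, and let A (respectively B) be a unital closed subalgebra of ℬ(𝒳) (respectively ℬ(𝒴)), the Banach algebra of all bounded linear operators, which contains all finite-rank operators. Suppose T is a surjective isometry from an open subgroup 𝔄 of A⁻¹ onto an open subgroup 𝔅 of B⁻¹. Then either there exists an invertible bounded linear or conjugate-linear operator U : 𝒳 → 𝒴 such that T(a) = T(e_A) U a U⁻¹ for every a ∈ 𝔄, or there exists an invertible bounded linear or conjugate-linear operator V : 𝒳* → 𝒴 such that T(a) = T(e_A) V a* V⁻¹ for every a ∈ 𝔄, where a* : 𝒳* → 𝒳* denotes the Banach-space adjoint (dual map) of a. In particular, if T(e_A) = e_B then T is multiplicative or anti-multiplicative. -/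
section Auxiliary

open Set Metric Filter Topology

/-- In a bounded metric space with a point reflection `ψ` about `m`, every self-isometry
fixes `m`. -/
theorem IsometryEquiv.fixed_of_reflection {α : Type*} [MetricSpace α] {m : α} {C : ℝ}
    (hC : ∀ x, dist x m ≤ C) (ψ : α ≃ᵢ α)
    (hψ : ∀ x, dist (ψ x) x = 2 * dist x m) (g : α ≃ᵢ α) : g m = m := by
  have key : ∀ n : ℕ, ∀ g : α ≃ᵢ α, dist (g m) m ≤ C / 2 ^ n := by
    intro n
    induction n with
    | zero => intro g; simpa using hC (g m)
    | succ n ih =>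
      intro g
      have h1 := ih ((g.trans ψ).trans g.symm)
      have h2 : dist (((g.trans ψ).trans g.symm) m) m = 2 * dist (g m) m := by
        rw [← hψ, ← g.dist_eq]; simp
      rw [h2] at h1
      rw [pow_succ, ← div_div]
      linarith
  have hlim : Filter.Tendsto (fun n : ℕ => C / 2 ^ n) Filter.atTop (nhds 0) :=
     tendsto_const_nhds.div_atTop (tendsto_pow_atTop_atTop_of_one_lt one_lt_two)
  exact dist_le_zero.1 (ge_of_tendsto' hlim fun n => key n g)

section MazurUlam

variable {E F : Type*} [NormedAddCommGroup E] [NormedAddCommGroup F]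

/-- The intersection of the two closed balls of radius `‖x - y‖ / 2` about `x` and `y`. -/
def lens (x y : E) : Set E := {z | ‖z - x‖ ≤ ‖x - y‖ / 2 ∧ ‖z - y‖ ≤ ‖x - y‖ / 2}

theorem reflect_mem_lens {x y z : E} (hz : z ∈ lens x y) : x + y - z ∈ lens x y := by
  constructor
  · rw [show x + y - z - x = -(z - y) by abel, norm_neg]; exact hz.2
  · rw [show x + y - z - y = -(z - x) by abel, norm_neg]; exact hz.1

theorem lens_subset_ball {x y c : E} {ρ : ℝ} (hx : x ∈ ball c (ρ / 2)) (hy : y ∈ ball c (ρ / 2)) :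
    lens x y ⊆ ball c ρ := by
  intro z hz
  rw [mem_ball, dist_eq_norm] at *
  have h1 := hz.1
  have h2 := norm_add_le (z - x) (x - c)
  have h3 := norm_sub_le (x - c) (y - c)
  simp only [sub_add_sub_cancel, sub_sub_sub_cancel_right] at h2 h3
  linarith

variable [NormedSpace ℝ E] [NormedSpace ℝ F]

theorem midpoint_mem_lens (x y : E) : midpoint ℝ x y ∈ lens x y := by
  have h (u v : E) : ‖midpoint ℝ u v - u‖ = ‖u - v‖ / 2 := by
    rw [← dist_eq_norm, dist_midpoint_left, dist_eq_norm]; norm_num; ring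
  refine ⟨(h x y).le, ?_⟩
  rw [midpoint_comm, h y x, norm_sub_rev]

/-- The point reflection of the lens about its centre. -/
def lensReflection (x y : E) : lens x y ≃ᵢ lens x y where
  toFun z := ⟨x + y - z, reflect_mem_lens z.2⟩
  invFun z := ⟨x + y - z, reflect_mem_lens z.2⟩
  left_inv z := by ext; simp
  right_inv z := by ext; simp
  isometry_toFun := by
    refine Isometry.of_dist_eq fun a b => ?_
    simp [Subtype.dist_eq, dist_eq_norm, norm_sub_rev]

theorem dist_lensReflection (x y : E) (z : lens x y) :
    dist (lensReflection x y z) z = 2 * dist z ⟨midpoint ℝ x y, midpoint_mem_lens x y⟩ := by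
  have h : (x + y - z) - z = -((2 : ℝ) • ((z : E) - midpoint ℝ x y)) := by
    rw [smul_sub, two_smul, two_smul, midpoint_add_self]; abel
  change dist (x + y - (z : E)) z = 2 * dist (z : E) (midpoint ℝ x y)
  rw [dist_eq_norm, dist_eq_norm, h, norm_neg, norm_smul]; simp

theorem isometry_map_midpoint_of_lens_subset {U : Set E} {V : Set F} {T : E → F}
    (hsurj : SurjOn T U V)
    (hiso : ∀ a ∈ U, ∀ b ∈ U, ‖T a - T b‖ = ‖a - b‖) {x y : E} (hx : x ∈ U) (hy : y ∈ U)
    (hU : lens x y ⊆ U) (hV : lens (T x) (T y) ⊆ V) :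
    T (midpoint ℝ x y) = midpoint ℝ (T x) (T y) := by
  have hmem : ∀ z ∈ U, (T z ∈ lens (T x) (T y) ↔ z ∈ lens x y) := by
    intro z hz
    simp only [lens, mem_ofPred_eq, hiso z hz x hx, hiso z hz y hy, hiso x hx y hy]
  let f : lens x y → lens (T x) (T y) := fun z => ⟨T z, (hmem z (hU z.2)).2 z.2⟩
  have hf : Isometry f := Isometry.of_dist_eq fun a b => by
    simpa [f, Subtype.dist_eq, dist_eq_norm] using hiso a (hU a.2) b (hU b.2)
  have hfs : Function.Surjective f := by
    rintro ⟨w, hw⟩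
    obtain ⟨z, hz, rfl⟩ := hsurj (hV hw)
    exact ⟨⟨z, (hmem z hz).1 hw⟩, rfl⟩
  let e : lens x y ≃ᵢ lens (T x) (T y) :=
    ⟨Equiv.ofBijective f ⟨hf.injective, hfs⟩, hf⟩
  have hC : ∀ z : lens x y,
      dist z ⟨midpoint ℝ x y, midpoint_mem_lens x y⟩ ≤ ‖x - y‖ := by
    intro z
    have h := (midpoint_mem_lens x y).1
    have h' := z.2.1
    change dist (z : E) (midpoint ℝ x y) ≤ _
    rw [dist_eq_norm, show (z : E) - midpoint ℝ x y = (z - x) - (midpoint ℝ x y - x) by abel]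
    linarith [norm_sub_le ((z : E) - x) (midpoint ℝ x y - x)]
  have h1 := IsometryEquiv.fixed_of_reflection hC (lensReflection x y) (dist_lensReflection x y)
    ((e.trans (lensReflection (T x) (T y))).trans e.symm)
  have h2 : lensReflection (T x) (T y) (e ⟨midpoint ℝ x y, midpoint_mem_lens x y⟩)
      = e ⟨midpoint ℝ x y, midpoint_mem_lens x y⟩ := by
    simpa [IsometryEquiv.symm_apply_eq] using h1
  have h3 := dist_lensReflection (T x) (T y) (e ⟨midpoint ℝ x y, midpoint_mem_lens x y⟩)
  rw [h2, dist_self] at h3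
  have h4 : e ⟨midpoint ℝ x y, midpoint_mem_lens x y⟩ = ⟨_, midpoint_mem_lens (T x) (T y)⟩ :=
    dist_eq_zero.1 (by linarith)
  exact congrArg Subtype.val h4

/-- A surjective isometry between open sets preserves midpoints of segments contained in its
domain. -/
theorem isometry_map_midpoint_of_segment_subset {U : Set E} {V : Set F} {T : E → F}
    (hUo : IsOpen U) (hVo : IsOpen V) (hmaps : MapsTo T U V) (hsurj : SurjOn T U V)
    (hiso : ∀ a ∈ U, ∀ b ∈ U, ‖T a - T b‖ = ‖a - b‖) {x y : E}
    (hxy : segment ℝ x y ⊆ U) :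
    T (midpoint ℝ x y) = midpoint ℝ (T x) (T y) := by
  have hloc : ∀ p ∈ segment ℝ x y, ∃ ρ > 0, ∀ u ∈ ball p ρ, ∀ v ∈ ball p ρ,
      T (midpoint ℝ u v) = midpoint ℝ (T u) (T v) := by
    intro p hp
    obtain ⟨ε₁, h₁, hb₁⟩ := Metric.isOpen_iff.1 hUo p (hxy hp)
    obtain ⟨ε₂, h₂, hb₂⟩ := Metric.isOpen_iff.1 hVo (T p) (hmaps (hxy hp))
    refine ⟨min ε₁ ε₂ / 2, by positivity, fun u hu v hv => ?_⟩
    have hle₁ : min ε₁ ε₂ / 2 ≤ ε₁ / 2 := by gcongr; exact min_le_left _ _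
    have hle₂ : min ε₁ ε₂ / 2 ≤ ε₂ / 2 := by gcongr; exact min_le_right _ _
    have hle₃ : ε₁ / 2 ≤ ε₁ := by linarith
    have hsub {w : E} (hw : w ∈ ball p (min ε₁ ε₂ / 2)) : w ∈ U :=
      hb₁ (ball_subset_ball (hle₁.trans hle₃) hw)
    have hT {w : E} (hw : w ∈ ball p (min ε₁ ε₂ / 2)) : T w ∈ ball (T p) (ε₂ / 2) := by
      rw [mem_ball, dist_eq_norm, hiso _ (hsub hw) _ (hxy hp), ← dist_eq_norm]
      exact lt_of_lt_of_le hw hle₂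
    exact isometry_map_midpoint_of_lens_subset hsurj hiso (hsub hu) (hsub hv)
      ((lens_subset_ball (ball_subset_ball hle₁ hu) (ball_subset_ball hle₁ hv)).trans hb₁)
      ((lens_subset_ball (hT hu) (hT hv)).trans hb₂)
  choose! ρ hρ hmid using hloc
  have hcomp : IsCompact (segment ℝ x y) := by
    rw [segment_eq_image_lineMap]
    exact isCompact_Icc.image AffineMap.lineMap_continuous
  obtain ⟨δ, hδ, hδ'⟩ := lebesgue_number_lemma_of_metric hcomp
    (c := fun p : segment ℝ x y => ball (p : E) (ρ p)) (fun _ => isOpen_ball)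
    (fun p hp => mem_iUnion.2 ⟨⟨p, hp⟩, mem_ball_self (hρ p hp)⟩)
  obtain ⟨n, hn⟩ := exists_nat_gt (‖y - x‖ / δ)
  have hn0 : (0 : ℝ) < n := lt_of_le_of_lt (by positivity) hn
  have hnd : ‖y - x‖ < n * δ := (div_lt_iff₀ hδ).1 hn
  let q : ℕ → E := fun k => x + ((k : ℝ) / (2 * n)) • (y - x)
  have hq : ∀ k ≤ 2 * n, q k ∈ segment ℝ x y := by
    intro k hk
    rw [segment_eq_image']
    refine ⟨(k : ℝ) / (2 * n), ⟨by positivity, ?_⟩, rfl⟩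
    rw [div_le_one (by positivity)]
    exact_mod_cast hk
  have hqd : ∀ k, dist (q (k + 1)) (q k) < δ := by
    intro k
    have : q (k + 1) - q k = (1 / (2 * n : ℝ)) • (y - x) := by
      simp only [q, add_sub_add_left_eq_sub, ← sub_smul]
      congr 1; push_cast; field_simp; ring
    rw [dist_eq_norm, this, norm_smul, Real.norm_of_nonneg (by positivity)]
    rw [one_div, inv_mul_lt_iff₀ (by positivity)]
    nlinarith [norm_nonneg (y - x)]
  have hqm : ∀ k, midpoint ℝ (q k) (q (k + 2)) = q (k + 1) := by
    intro k
    rw [midpoint_eq_iff']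
    simp only [q, Equiv.pointReflection_apply, vsub_eq_sub, vadd_eq_add]
    push_cast
    module
  have hstep : ∀ k, k + 2 ≤ 2 * n → T (q (k + 2)) - T (q (k + 1)) = T (q (k + 1)) - T (q k) := by
    intro k hk
    obtain ⟨p, hp⟩ := hδ' (q (k + 1)) (hq _ (by omega))
    have h1 := hmid p p.2 (q k) (hp (by rw [mem_ball, dist_comm]; exact hqd k))
      (q (k + 2)) (hp (hqd (k + 1)))
    rw [hqm] at h1
    have h2 := midpoint_add_self ℝ (T (q k)) (T (q (k + 2)))
    rw [← h1] at h2
    rw [sub_eq_sub_iff_add_eq_add, h2, add_comm]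
  have harith : ∀ k, k + 1 ≤ 2 * n → T (q (k + 1)) - T (q k) = T (q 1) - T (q 0) := by
    intro k
    induction k with
    | zero => intro _; rfl
    | succ k ih => intro hk; rw [hstep k hk, ih (by omega)]
  have hlin : ∀ k, k ≤ 2 * n → T (q k) = T (q 0) + k • (T (q 1) - T (q 0)) := by
    intro k
    induction k with
    | zero => intro _; simp
    | succ k ih =>
      intro hk
      rw [succ_nsmul, ← add_assoc, ← ih (by omega), ← harith k hk]; abel
  have hq0 : q 0 = x := by simp [q]
  have hq2 : q (2 * n) = y := by
    simp only [q]; push_cast; rw [div_self (by positivity)]; simp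
  have hqn : q n = midpoint ℝ x y := by
    rw [eq_comm, midpoint_eq_iff']
    simp only [q, Equiv.pointReflection_apply, vsub_eq_sub, vadd_eq_add]
    rw [show (n : ℝ) / (2 * n) = 1 / 2 by field_simp]
    module
  have e1 := hlin n (by omega)
  have e2 := hlin (2 * n) le_rfl
  rw [hq0, hqn] at e1
  rw [hq0, hq2, two_mul, add_nsmul] at e2
  rw [e1, e2, eq_comm, midpoint_eq_iff']
  simp only [Equiv.pointReflection_apply, vsub_eq_sub, vadd_eq_add]
  abel

end MazurUlam

theorem LinearMap.eq_of_eqOn_open_add_const {E F : Type*} [NormedAddCommGroup E]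
    [NormedSpace ℝ E] [AddCommGroup F] [Module ℝ F] {K : Set E} (hK : IsOpen K)
    {p : E} (hp : p ∈ K) {L L' : E →ₗ[ℝ] F} {u u' : F}
    (h : ∀ x ∈ K, L x + u = L' x + u') : L = L' := by
  ext v
  have hc : Tendsto (fun t : ℝ => p + t • v) (𝓝[≠] 0) (𝓝 p) := by
    have : Continuous (fun t : ℝ => p + t • v) := by fun_prop
    simpa using (this.tendsto 0).mono_left nhdsWithin_le_nhds
  obtain ⟨t, ht, ht0⟩ := ((hc.eventually (hK.mem_nhds hp)).and self_mem_nhdsWithin).exists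
  have h1 := h _ ht
  have h2 := h _ hp
  simp only [map_add, map_smul] at h1
  have h3 : t • L v = t • L' v := by
    have e1 : t • L v = (L p + t • L v + u) - (L p + u) := by abel
    have e2 : t • L' v = (L' p + t • L' v + u') - (L' p + u') := by abel
    rw [e1, e2, h1, h2]
  exact smul_right_injective F ht0 h3

/-- An isometry preserving midpoints on a generating additive subsemigroup is the restriction of
an affine isometry. -/
theorem exists_linearIsometry_of_map_midpoint {E F : Type*} [NormedAddCommGroup E]
    [NormedSpace ℝ E] [NormedAddCommGroup F] [NormedSpace ℝ F] {K : Set E} {p : E} (hp : p ∈ K)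
    (hadd : ∀ x ∈ K, ∀ y ∈ K, x + y ∈ K) (hgen : ∀ z, ∃ x ∈ K, ∃ y ∈ K, z = x - y)
    {T : E → F} (hmid : ∀ x ∈ K, ∀ y ∈ K, T (midpoint ℝ x y) = midpoint ℝ (T x) (T y))
    (hiso : ∀ x ∈ K, ∀ y ∈ K, ‖T x - T y‖ = ‖x - y‖) :
    ∃ (L : E →ₗᵢ[ℝ] F) (u : F), ∀ x ∈ K, T x = L x + u := by
  have hsum : ∀ x ∈ K, ∀ y ∈ K, ∀ x' ∈ K, ∀ y' ∈ K, x + y = x' + y' →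
      T x + T y = T x' + T y' := by
    intro x hx y hy x' hx' y' hy' h
    rw [← midpoint_add_self ℝ (T x), ← midpoint_add_self ℝ (T x'), ← hmid x hx y hy,
      ← hmid x' hx' y' hy']
    have : midpoint ℝ x y = midpoint ℝ x' y' := by
      rw [midpoint_eq_smul_add, midpoint_eq_smul_add, h]
    rw [this]
  set u : F := T p + T p - T (p + p) with hu
  have hu' : ∀ x ∈ K, T (x + x) = T x + T x - u := by
    intro x hx
    have h1 := hsum (x + x) (hadd x hx x hx) p hp x hx (x + p) (hadd x hx p hp) (by abel)
    have h2 := hsum (p + p) (hadd p hp p hp) x hx p hp (x + p) (hadd x hx p hp) (by abel)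
    have e1 : T (x + x) = (T (x + x) + T p) - T p := by abel
    have e2 : T (x + p) = (T p + T (x + p)) - T p := by abel
    rw [e1, h1, e2, ← h2, hu]; abel
  have hTadd : ∀ x ∈ K, ∀ y ∈ K, T (x + y) = T x + T y - u := by
    intro x hx y hy
    have h1 := hsum (x + x) (hadd x hx x hx) y hy x hx (x + y) (hadd x hx y hy) (by abel)
    have e1 : T (x + y) = (T x + T (x + y)) - T x := by abel
    rw [e1, ← h1, hu' x hx]; abel
  choose P hP Q hQ hPQ using hgen
  have hL : ∀ z, ∀ x ∈ K, ∀ y ∈ K, z = x - y → T (P z) - T (Q z) = T x - T y := by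
    intro z x hx y hy h
    rw [sub_eq_sub_iff_add_eq_add]
    refine (hsum _ (hP z) _ hy _ hx _ (hQ z) ?_)
    rw [← sub_eq_sub_iff_add_eq_add, ← h, ← hPQ]
  let L₀ : E →+ F := AddMonoidHom.mk' (fun z => T (P z) - T (Q z)) (by
    intro z w
    rw [hL (z + w) (P z + P w) (hadd _ (hP z) _ (hP w)) (Q z + Q w) (hadd _ (hQ z) _ (hQ w))
      (by conv_lhs => rw [hPQ z, hPQ w]
          abel), hTadd _ (hP z) _ (hP w), hTadd _ (hQ z) _ (hQ w)]
    abel)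
  have hnorm : ∀ z, ‖L₀ z‖ = ‖z‖ := by
    intro z
    change ‖T (P z) - T (Q z)‖ = ‖z‖
    rw [hiso _ (hP z) _ (hQ z), ← hPQ]
  have hcont : Continuous L₀ := (AddMonoidHomClass.isometry_of_norm L₀ hnorm).continuous
  refine ⟨⟨(L₀.toRealLinearMap hcont : E →ₗ[ℝ] F), hnorm⟩, u, fun x hx => ?_⟩
  change T x = (T (P x) - T (Q x)) + u
  rw [hL x (x + x) (hadd x hx x hx) x hx (by abel), hu' x hx]; abel

/-- If `1 + tD` is a contraction for all small complex `t`, then `D = 0`. -/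
theorem eq_zero_of_norm_one_add_smul_le_one {A : Type*} [NormedRing A] [NormedAlgebra ℂ A]
    [NormOneClass A] {D : A} {δ : ℝ} (hδ : 0 < δ)
    (h : ∀ t : ℂ, ‖t‖ ≤ δ → ‖1 + t • D‖ ≤ 1) : D = 0 := by
  have key : ∀ n : ℕ, (n : ℝ) * ‖D‖ ≤ 1 / δ := by
    intro n
    have hlin : HasDerivAt (fun t : ℂ => 1 + t • D) D 0 := by
      simpa using ((hasDerivAt_id (0 : ℂ)).smul_const D).const_add 1
    have hd : ∀ n : ℕ, HasDerivAt (fun t : ℂ => (1 + t • D) ^ n) (n • D) 0 := by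
      intro n
      induction n with
      | zero => simpa using hasDerivAt_const (0 : ℂ) (1 : A)
      | succ n ih =>
        have := ih.mul hlin
        simp only [zero_smul, add_zero, one_pow, mul_one, one_mul] at this
        simp only [pow_succ, succ_nsmul]
        exact this
    have hdiff : Differentiable ℂ (fun t : ℂ => (1 + t • D) ^ n) := by fun_prop
    have h1 := Complex.norm_deriv_le_of_forall_mem_sphere_norm_le (C := 1) hδ
      (hdiff.diffContOnCl (s := ball 0 δ)) (fun z hz => by
        refine (norm_pow_le _ _).trans (pow_le_one₀ (norm_nonneg _) (h z ?_))
        simpa using (mem_sphere_zero_iff_norm.1 hz).le)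
    rw [(hd n).deriv, ← Nat.cast_smul_eq_nsmul ℝ, norm_smul] at h1
    simpa using h1
  by_contra hD
  have hD' : 0 < ‖D‖ := norm_pos_iff.2 hD
  obtain ⟨n, hn⟩ := exists_nat_gt (1 / δ / ‖D‖)
  rw [div_lt_iff₀ hD'] at hn
  exact absurd (key n) (not_le.2 hn)

/-- `S` is an open subgroup of the group of invertible elements of `A`. -/
structure IsOpenUnitGroup {A : Type*} [NormedRing A] (S : Set A) : Prop where
  isOpen : IsOpen S
  one_mem : (1 : A) ∈ S
  mul_mem : ∀ a ∈ S, ∀ b ∈ S, a * b ∈ S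
  exists_inv : ∀ a ∈ S, ∃ b ∈ S, a * b = 1 ∧ b * a = 1

namespace IsOpenUnitGroup

variable {A : Type*} [NormedRing A] {S : Set A}

theorem pow_mem (hS : IsOpenUnitGroup S) {a : A} (ha : a ∈ S) (n : ℕ) : a ^ n ∈ S := by
  induction n with
  | zero => simpa using hS.one_mem
  | succ n ih => rw [pow_succ]; exact hS.mul_mem _ ih _ ha

theorem mem_of_roots (hS : IsOpenUnitGroup S) {a : A} {h : ℕ → A} (hlim : Tendsto h atTop (𝓝 1))
    (hpow : ∀ n, n ≠ 0 → h n ^ n = a) : a ∈ S := by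
  obtain ⟨n, hn, hn0⟩ := ((hlim.eventually (hS.isOpen.mem_nhds hS.one_mem)).and
    (eventually_ne_atTop 0)).exists
  rw [← hpow n hn0]
  exact hS.pow_mem hn n

theorem mul_mem_iff (hS : IsOpenUnitGroup S) {a b : A} (ha : a ∈ S) : a * b ∈ S ↔ b ∈ S := by
  refine ⟨fun h => ?_, hS.mul_mem a ha b⟩
  obtain ⟨c, hc, -, hca⟩ := hS.exists_inv a ha
  have := hS.mul_mem c hc _ h
  rwa [← mul_assoc, hca, one_mul] at this

theorem exists_ball_subset (hS : IsOpenUnitGroup S) : ∃ r > 0, ball (1 : A) r ⊆ S :=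
  Metric.isOpen_iff.1 hS.isOpen 1 hS.one_mem

end IsOpenUnitGroup

theorem tendsto_exp_div_nat (w : ℂ) :
    Tendsto (fun n : ℕ => Complex.exp (w / n)) atTop (𝓝 1) := by
  have h : Tendsto (fun n : ℕ => w / n) atTop (𝓝 0) := tendsto_const_div_atTop_nhds_zero_nat w
  simpa [Function.comp_def] using (Complex.continuous_exp.tendsto 0).comp h

theorem exp_div_nat_pow (w : ℂ) {n : ℕ} (hn : n ≠ 0) : Complex.exp (w / n) ^ n = Complex.exp w := by
  rw [← Complex.exp_nat_mul, mul_div_cancel₀ _ (Nat.cast_ne_zero.2 hn)]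

namespace IsOpenUnitGroup

variable {A : Type*} [NormedRing A] [NormedAlgebra ℂ A] {S : Set A}

theorem smul_one_mem (hS : IsOpenUnitGroup S) {z : ℂ} (hz : z ≠ 0) : z • (1 : A) ∈ S := by
  refine hS.mem_of_roots (h := fun n => Complex.exp (Complex.log z / n) • (1 : A)) ?_ ?_
  · simpa using (tendsto_exp_div_nat (Complex.log z)).smul_const (1 : A)
  · intro n hn
    rw [smul_pow, one_pow, exp_div_nat_pow _ hn, Complex.exp_log hz]

theorem smul_mem (hS : IsOpenUnitGroup S) {z : ℂ} (hz : z ≠ 0) {a : A} (ha : a ∈ S) :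
    z • a ∈ S := by
  simpa using hS.mul_mem _ (hS.smul_one_mem hz) a ha

theorem smul_mem_iff (hS : IsOpenUnitGroup S) {z : ℂ} (hz : z ≠ 0) {a : A} :
    z • a ∈ S ↔ a ∈ S :=
  ⟨fun h => by simpa [smul_smul, inv_mul_cancel₀ hz] using hS.smul_mem (inv_ne_zero hz) h,
    hS.smul_mem hz⟩

end IsOpenUnitGroup

section Cone

variable {A : Type*} [NormedRing A] [NormedAlgebra ℂ A]

/-- The open convex cone spanned by the ball of radius `r` about `1`. -/
def unitCone (A : Type*) [NormedRing A] [NormedAlgebra ℂ A] (r : ℝ) : Set A :=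
  {x | ∃ s : ℝ, 0 < s ∧ ‖x - s • (1 : A)‖ < s * r}

theorem isOpen_unitCone (r : ℝ) : IsOpen (unitCone A r) := by
  have : unitCone A r = ⋃ s : ℝ, ⋃ _ : 0 < s, {x : A | ‖x - s • (1 : A)‖ < s * r} := by
    ext x; simp [unitCone]
  rw [this]
  exact isOpen_iUnion fun s => isOpen_iUnion fun _ => isOpen_lt (by fun_prop) continuous_const

theorem mem_unitCone_of_mem_ball {r : ℝ} {x : A} (hx : ‖x - 1‖ < r) : x ∈ unitCone A r :=
  ⟨1, one_pos, by simpa using hx⟩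

theorem add_mem_unitCone {r : ℝ} {x y : A} (hx : x ∈ unitCone A r) (hy : y ∈ unitCone A r) :
    x + y ∈ unitCone A r := by
  obtain ⟨s, hs, hx⟩ := hx
  obtain ⟨t, ht, hy⟩ := hy
  refine ⟨s + t, add_pos hs ht, ?_⟩
  rw [show x + y - (s + t) • (1 : A) = (x - s • (1 : A)) + (y - t • (1 : A)) by module]
  linarith [norm_add_le (x - s • (1 : A)) (y - t • (1 : A))]

theorem smul_mem_unitCone {r c : ℝ} (hc : 0 < c) {x : A} (hx : x ∈ unitCone A r) :
    c • x ∈ unitCone A r := by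
  obtain ⟨s, hs, hx⟩ := hx
  refine ⟨c * s, mul_pos hc hs, ?_⟩
  rw [mul_smul, ← smul_sub, norm_smul, Real.norm_of_nonneg hc.le, mul_assoc]
  exact mul_lt_mul_of_pos_left hx hc

theorem convex_unitCone (r : ℝ) : Convex ℝ (unitCone A r) := by
  rw [convex_iff_forall_pos]
  intro x hx y hy a b ha hb _
  exact add_mem_unitCone (smul_mem_unitCone ha hx) (smul_mem_unitCone hb hy)

theorem exists_sub_unitCone {r : ℝ} (hr : 0 < r) (z : A) :
    ∃ x ∈ unitCone A r, ∃ y ∈ unitCone A r, z = x - y := by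
  have hs : 0 < (‖z‖ + 1) / r := by positivity
  refine ⟨z + ((‖z‖ + 1) / r) • (1 : A), ⟨_, hs, ?_⟩, ((‖z‖ + 1) / r) • (1 : A), ⟨_, hs, ?_⟩, ?_⟩
  · rw [add_sub_cancel_right, div_mul_cancel₀ _ hr.ne']; linarith
  · rw [sub_self, norm_zero]; positivity
  · rw [add_sub_cancel_right]

theorem IsOpenUnitGroup.unitCone_subset {S : Set A} (hS : IsOpenUnitGroup S) {r : ℝ}
    (hr : ball (1 : A) r ⊆ S) : unitCone A r ⊆ S := by
  rintro x ⟨s, hs, hx⟩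
  have hs' : (s : ℂ) ≠ 0 := by exact_mod_cast hs.ne'
  have h1 : (s : ℂ)⁻¹ • x ∈ S := by
    apply hr
    have : (s : ℂ)⁻¹ • x - 1 = (s : ℂ)⁻¹ • (x - s • (1 : A)) := by
      rw [smul_sub, ← Complex.coe_smul, smul_smul, inv_mul_cancel₀ hs', one_smul]
    rw [mem_ball, dist_eq_norm, this, norm_smul, norm_inv, Complex.norm_real,
      Real.norm_of_nonneg hs.le, inv_mul_lt_iff₀ hs]
    exact hx
  exact (hS.smul_mem_iff (inv_ne_zero hs')).1 h1

end Cone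

section Affine

variable {A B : Type*} [NormedRing A] [NormedAlgebra ℂ A] [NormedRing B] [NormedAlgebra ℂ B]
  {S : Set A} {S' : Set B} {T : A → B}

theorem exists_affine_on_translated_unitCone (hS : IsOpenUnitGroup S) (hS' : IsOpenUnitGroup S')
    (hmaps : MapsTo T S S') (hsurj : SurjOn T S S')
    (hiso : ∀ a ∈ S, ∀ b ∈ S, ‖T a - T b‖ = ‖a - b‖) {r : ℝ} (hr0 : 0 < r)
    (hr : ball (1 : A) r ⊆ S) {a b : A} (ha : a ∈ S) (hab : a * b = 1) (hba : b * a = 1) :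
    ∃ (L : A →ₗᵢ[ℝ] B) (u : B), ∀ x, b * x ∈ unitCone A r → T x = L x + u := by
  have hsub : {x | b * x ∈ unitCone A r} ⊆ S := by
    intro x hx
    have := hS.mul_mem a ha _ (hS.unitCone_subset hr hx)
    rwa [← mul_assoc, hab, one_mul] at this
  have hconv : Convex ℝ {x | b * x ∈ unitCone A r} :=
    (convex_unitCone r).linear_preimage (LinearMap.mulLeft ℝ b)
  refine exists_linearIsometry_of_map_midpoint (p := a) (K := {x | b * x ∈ unitCone A r})
    ?_ ?_ ?_ ?_ ?_
  · change b * a ∈ unitCone A r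
    rw [hba]
    exact mem_unitCone_of_mem_ball (by simpa using hr0)
  · intro x hx y hy
    change b * (x + y) ∈ unitCone A r
    rw [mul_add]
    exact add_mem_unitCone hx hy
  · intro z
    obtain ⟨x, hx, y, hy, h⟩ := exists_sub_unitCone hr0 (b * z)
    have hm : ∀ w, b * (a * w) = w := fun w => by rw [← mul_assoc, hba, one_mul]
    refine ⟨a * x, ?_, a * y, ?_, ?_⟩
    · change b * (a * x) ∈ unitCone A r; rwa [hm]
    · change b * (a * y) ∈ unitCone A r; rwa [hm]
    · rw [← mul_sub, ← h, ← mul_assoc, hab, one_mul]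
  · intro x hx y hy
    exact isometry_map_midpoint_of_segment_subset hS.isOpen hS'.isOpen hmaps hsurj hiso
      ((hconv.segment_subset hx hy).trans hsub)
  · intro x hx y hy
    exact hiso x (hsub hx) y (hsub hy)

/-- A surjective isometry between open subgroups of unit groups is affine. -/
theorem IsOpenUnitGroup.exists_affine [NormOneClass A] (hS : IsOpenUnitGroup S)
    (hS' : IsOpenUnitGroup S') (hmaps : MapsTo T S S') (hsurj : SurjOn T S S')
    (hiso : ∀ a ∈ S, ∀ b ∈ S, ‖T a - T b‖ = ‖a - b‖) :
    ∃ (L : A →ₗᵢ[ℝ] B) (u : B), Function.Surjective L ∧ ∀ a ∈ S, T a = L a + u := by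
  obtain ⟨r, hr0, hr⟩ := hS.exists_ball_subset
  obtain ⟨L, u, hL⟩ := exists_affine_on_translated_unitCone hS hS' hmaps hsurj hiso hr0 hr
    hS.one_mem (one_mul 1) (one_mul 1)
  simp only [one_mul] at hL
  have hone : (1 : A) ∈ unitCone A r := mem_unitCone_of_mem_ball (by simpa using hr0)
  -- the same constant `u` works on every translated cone
  have hpiece : ∀ a ∈ S, ∀ b, a * b = 1 → b * a = 1 →
      ∃ L' : A →ₗᵢ[ℝ] B, ∀ x, b * x ∈ unitCone A r → T x = L' x + u := by
    intro a ha b hab hba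
    obtain ⟨L', u', hL'⟩ := exists_affine_on_translated_unitCone hS hS' hmaps hsurj hiso hr0 hr
      ha hab hba
    suffices u' = u by subst this; exact ⟨L', hL'⟩
    have hbound : ∀ t : ℝ, 0 < t → ‖u' - u‖ ≤ t * (‖a - 1‖ + ‖a‖ + ‖(1 : A)‖) := by
      intro t ht
      have hc : t • (1 : A) ∈ unitCone A r := smul_mem_unitCone ht hone
      have e1 := hL' (t • a) (by rwa [mul_smul_comm, hba])
      have e2 := hL (t • 1) hc
      have ht' : (t : ℂ) ≠ 0 := by exact_mod_cast ht.ne'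
      have e3 := hiso (t • a) (by simpa using hS.smul_mem ht' ha) (t • 1)
        (by simpa using hS.smul_mem ht' hS.one_mem)
      have e4 : u' - u = (T (t • a) - T (t • 1)) - L' (t • a) + L (t • 1) := by
        rw [e1, e2]; abel
      rw [e4]
      refine (norm_add_le _ _).trans ((add_le_add_left (norm_sub_le _ _) _).trans ?_)
      rw [e3, L'.norm_map, L.norm_map, ← smul_sub, norm_smul, norm_smul, norm_smul,
        Real.norm_of_nonneg ht.le]
      apply le_of_eq; ring
    have hlim : Tendsto (fun t : ℝ => t * (‖a - 1‖ + ‖a‖ + ‖(1 : A)‖)) (𝓝[>] 0) (𝓝 0) := by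
      have : Continuous (fun t : ℝ => t * (‖a - 1‖ + ‖a‖ + ‖(1 : A)‖)) := by fun_prop
      simpa using (this.tendsto 0).mono_left nhdsWithin_le_nhds
    have := ge_of_tendsto hlim (eventually_mem_nhdsWithin.mono fun t ht => hbound t ht)
    exact sub_eq_zero.1 (norm_le_zero_iff.1 this)
  -- rotating the cone
  have hrot : ∀ η : ℂ, η ≠ 0 → ‖η • (1 : A) - 1‖ < r → ∀ n : ℕ,
      ∀ x ∈ unitCone A r, T (η ^ n • x) = L (η ^ n • x) + u := by
    intro η hη hηr n
    induction n with
    | zero => simpa using hL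
    | succ n ih =>
      have hn : η ^ n ≠ 0 := pow_ne_zero _ hη
      have hn' : η ^ (n + 1) ≠ 0 := pow_ne_zero _ hη
      obtain ⟨L', hL'⟩ := hpiece (η ^ (n + 1) • 1) (hS.smul_one_mem hn')
        ((η ^ (n + 1))⁻¹ • 1) (by simp [smul_smul, hη]) (by simp [smul_smul, hη])
      have hL'eq : (L' : A →ₗᵢ[ℝ] B).toLinearMap = L.toLinearMap := by
        refine LinearMap.eq_of_eqOn_open_add_const (u := u) (u' := u) (p := η ^ (n + 1) • (1 : A))
          (K := {x | (η ^ n)⁻¹ • x ∈ unitCone A r} ∩ {x | (η ^ (n + 1))⁻¹ • x ∈ unitCone A r})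
          ?_ ⟨?_, ?_⟩ ?_
        · exact ((isOpen_unitCone r).preimage (continuous_const_smul _)).inter
            ((isOpen_unitCone r).preimage (continuous_const_smul _))
        · change (η ^ n)⁻¹ • η ^ (n + 1) • (1 : A) ∈ unitCone A r
          rw [smul_smul, pow_succ, ← mul_assoc, inv_mul_cancel₀ hn, one_mul]
          exact mem_unitCone_of_mem_ball hηr
        · change (η ^ (n + 1))⁻¹ • η ^ (n + 1) • (1 : A) ∈ unitCone A r
          rwa [smul_smul, inv_mul_cancel₀ hn', one_smul]
        · rintro x ⟨hx1, hx2⟩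
          have h1 := ih _ hx1
          rw [smul_smul, mul_inv_cancel₀ hn, one_smul] at h1
          have h2 := hL' x (by simpa using hx2)
          exact h2.symm.trans h1
      intro x hx
      rw [hL' _ (by rwa [smul_mul_assoc, one_mul, smul_smul, inv_mul_cancel₀ hn', one_smul])]
      have := LinearMap.congr_fun hL'eq (η ^ (n + 1) • x)
      simp only [LinearIsometry.coe_toLinearMap] at this
      rw [this]
  have hall : ∀ z : ℂ, z ≠ 0 → ∀ x ∈ unitCone A r, T (z • x) = L (z • x) + u := by
    intro z hz
    have hlim : Tendsto (fun n : ℕ => ‖Complex.exp (Complex.log z / n) • (1 : A) - 1‖) atTop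
        (𝓝 0) := by
      simpa using (((tendsto_exp_div_nat (Complex.log z)).smul_const (1 : A)).sub_const 1).norm
    obtain ⟨n, hn, hn0⟩ := ((hlim.eventually (gt_mem_nhds hr0)).and (eventually_ne_atTop 0)).exists
    have := hrot _ (Complex.exp_ne_zero _) hn n
    rwa [exp_div_nat_pow _ hn0, Complex.exp_log hz] at this
  have hLsurj : Function.Surjective L := by
    intro v
    obtain ⟨ρ, hρ0, hρ⟩ := Metric.isOpen_iff.1 hS'.isOpen (T 1) (hmaps hS.one_mem)
    have ht : 0 < min ρ r / (‖v‖ + 1) := by positivity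
    set t := min ρ r / (‖v‖ + 1) with ht_def
    have htv : ‖t • v‖ < min ρ r := by
      rw [norm_smul, Real.norm_of_nonneg ht.le, ht_def, div_mul_eq_mul_div,
        div_lt_iff₀ (by positivity)]
      have : 0 < min ρ r := lt_min hρ0 hr0
      nlinarith
    obtain ⟨x, hx, hxT⟩ := hsurj (hρ (show T 1 + t • v ∈ ball (T 1) ρ by
      simpa [mem_ball, dist_eq_norm] using htv.trans_le (min_le_left _ _)))
    have hx1 : ‖x - 1‖ < r := by
      rw [← hiso x hx 1 hS.one_mem, hxT, add_sub_cancel_left]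
      exact htv.trans_le (min_le_right _ _)
    rw [hL x (mem_unitCone_of_mem_ball hx1), hL 1 hone] at hxT
    refine ⟨t⁻¹ • (x - 1), ?_⟩
    have : L (x - 1) = t • v := by
      rw [map_sub, sub_eq_iff_eq_add]
      have : L x = (L x + u) - u := by abel
      rw [this, hxT]; abel
    rw [map_smul, this, smul_smul, inv_mul_cancel₀ ht.ne', one_smul]
  refine ⟨L, u, hLsurj, fun a ha => ?_⟩
  obtain ⟨D, hD⟩ := hLsurj (T a - u - L a)
  suffices D = 0 by
    rw [this, map_zero, eq_comm, sub_eq_zero, sub_eq_iff_eq_add] at hD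
    exact hD
  have hR : 0 < ‖D + a‖ + 1 := by positivity
  refine eq_zero_of_norm_one_add_smul_le_one (δ := r / (‖D + a‖ + 1)) (by positivity) ?_
  intro t ht
  rcases eq_or_ne t 0 with rfl | ht0
  · simp
  have hx : t • (t⁻¹ • (1 : A) + D + a) ∈ unitCone A r := by
    apply mem_unitCone_of_mem_ball
    rw [add_assoc, smul_add, smul_smul, mul_inv_cancel₀ ht0, one_smul, add_sub_cancel_left,
      norm_smul]
    rw [le_div_iff₀ hR] at ht
    have : 0 < ‖t‖ := norm_pos_iff.2 ht0
    nlinarith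
  have hTx := hall t⁻¹ (inv_ne_zero ht0) _ hx
  have hxS : t⁻¹ • t • (t⁻¹ • (1 : A) + D + a) ∈ S :=
    hS.smul_mem (inv_ne_zero ht0) (hS.unitCone_subset hr hx)
  rw [smul_smul, inv_mul_cancel₀ ht0, one_smul] at hTx hxS
  have h1 := hiso _ hxS a ha
  have h2 : T (t⁻¹ • (1 : A) + D + a) - T a = L (t⁻¹ • (1 : A)) := by
    rw [hTx, map_add, map_add, hD]; abel
  rw [h2, L.norm_map, norm_smul, norm_one, mul_one, add_sub_cancel_right] at h1
  have h3 : 1 + t • D = t • (t⁻¹ • (1 : A) + D) := by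
    rw [smul_add, smul_smul, mul_inv_cancel₀ ht0, one_smul]
  rw [h3, norm_smul, ← h1, norm_inv, mul_inv_cancel₀ (norm_ne_zero_iff.2 ht0)]

/-- The constant term `u` of the affine map is absorbed by the group, and so is every multiple. -/
theorem IsOpenUnitGroup.one_add_mul_mem (hS : IsOpenUnitGroup S) (hS' : IsOpenUnitGroup S')
    (hmaps : MapsTo T S S') (hsurj : SurjOn T S S') {L : A →ₗᵢ[ℝ] B} {u : B}
    (hT : ∀ a ∈ S, T a = L a + u) (c : B) : 1 + c * u ∈ S' := by
  have hsub : ∀ b ∈ S', b - u ∈ S' := by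
    intro b hb
    obtain ⟨a, ha, hab⟩ := hsurj (hS'.smul_mem (z := 2⁻¹) (by norm_num) hb)
    have h2 : (2 : ℝ) • a ∈ S := by
      have := hS.smul_mem (z := ((2 : ℝ) : ℂ)) (by norm_num) ha
      rwa [Complex.coe_smul] at this
    have h3 := hmaps h2
    rw [hT _ h2, map_smul] at h3
    rw [hT _ ha] at hab
    have h4 : b = (2 : ℝ) • (L a + u) := by
      rw [hab, ← Complex.coe_smul, smul_smul]; norm_num
    rw [h4]
    convert h3 using 1
    module
  have hmul : ∀ d ∈ S', ∀ b ∈ S', b + d * u ∈ S' := by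
    intro d hd b hb
    have hd' : (-1 : ℂ) • d ∈ S' := hS'.smul_mem (by norm_num) hd
    obtain ⟨e, he, h1, -⟩ := hS'.exists_inv _ hd'
    have := hS'.mul_mem _ hd' _ (hsub _ (hS'.mul_mem e he b hb))
    rw [mul_sub, ← mul_assoc, h1, one_mul] at this
    simpa using this
  obtain ⟨r, hr0, hr⟩ := hS'.exists_ball_subset
  obtain ⟨x, hx, y, hy, rfl⟩ := exists_sub_unitCone hr0 c
  have hy' : (-1 : ℂ) • y ∈ S' := hS'.smul_mem (by norm_num) (hS'.unitCone_subset hr hy)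
  have := hmul x (hS'.unitCone_subset hr hx) _ (hmul _ hy' 1 hS'.one_mem)
  convert this using 1
  rw [neg_one_smul, sub_mul, neg_mul]; abel

end Affine

section Functionals

variable {X : Type*} [NormedAddCommGroup X] [NormedSpace ℂ X]

theorem exists_dual_eq_one {x : X} (hx : x ≠ 0) : ∃ f : X →L[ℂ] ℂ, f x = 1 :=
  SeparatingDual.exists_eq_one hx

theorem exists_dual_eq_zero_eq_one {x y : X} (hx : x ≠ 0) (hy : ∀ c : ℂ, y ≠ c • x) :
    ∃ f : X →L[ℂ] ℂ, f x = 0 ∧ f y = 1 := by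
  obtain ⟨f, hf⟩ := exists_dual_eq_one hx
  obtain ⟨g, hg⟩ := exists_dual_eq_one (sub_ne_zero.2 (hy (f y)))
  refine ⟨g - g x • f, by simp [hf], ?_⟩
  simp only [map_sub, map_smul, smul_eq_mul] at hg
  simp only [sub_apply, smul_apply, smul_eq_mul]
  linear_combination hg

theorem exists_dual_eq_one_ne_zero {x y : X} (hx : x ≠ 0) (hy : y ≠ 0) :
    ∃ f : X →L[ℂ] ℂ, f x = 1 ∧ f y ≠ 0 := by
  obtain ⟨f, hf⟩ := exists_dual_eq_one hx
  by_cases h : f y = 0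
  · obtain ⟨g, hgx, hgy⟩ := exists_dual_eq_zero_eq_one hy (y := x) (fun c hc => by
      rw [hc, map_smul, h] at hf; simp at hf)
    obtain ⟨k, hk⟩ := exists_dual_eq_one hy
    by_cases hkx : k x = 0
    · exact ⟨f + k, by simp [hf, hkx], by simp [h, hk]⟩
    · exact ⟨(k x)⁻¹ • k, by simp [hkx], by simp [hk, hkx]⟩
  · exact ⟨f, hf, h⟩

theorem exists_dual_eq_zero_eq_one_ne_zero {x y z : X} (hx : x ≠ 0) (hy : ∀ c : ℂ, y ≠ c • x)
    (hz : ∀ c : ℂ, z ≠ c • x) : ∃ f : X →L[ℂ] ℂ, f x = 0 ∧ f y = 1 ∧ f z ≠ 0 := by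
  obtain ⟨f, hfx, hfy⟩ := exists_dual_eq_zero_eq_one hx hy
  obtain ⟨g, hgx, hgz⟩ := exists_dual_eq_zero_eq_one hx hz
  by_cases h : f z = 0
  · by_cases hgy : g y = 0
    · exact ⟨f + g, by simp [hfx, hgx], by simp [hfy, hgy], by simp [h, hgz]⟩
    · exact ⟨(g y)⁻¹ • g, by simp [hgx], by simp [hgy], by simp [hgz, hgy]⟩
  · exact ⟨f, hfx, hfy, h⟩

end Functionals

/-- A subalgebra of operators containing all operators of finite rank. -/
def ContainsFiniteRank {X : Type*} [NormedAddCommGroup X] [NormedSpace ℂ X]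
    (A : Subalgebra ℂ (X →L[ℂ] X)) : Prop :=
  ∀ f : X →L[ℂ] X, FiniteDimensional ℂ (LinearMap.range (f : X →ₗ[ℂ] X)) → f ∈ A

namespace ContainsFiniteRank

variable {X : Type*} [NormedAddCommGroup X] [NormedSpace ℂ X] {A : Subalgebra ℂ (X →L[ℂ] X)}

theorem smulRight_mem (hA : ContainsFiniteRank A) (f : X →L[ℂ] ℂ) (x : X) :
    f.smulRight x ∈ A := by
  apply hA
  have : LinearMap.range ((f.smulRight x : X →L[ℂ] X) : X →ₗ[ℂ] X) ≤ Submodule.span ℂ {x} := by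
    rintro _ ⟨y, rfl⟩
    exact Submodule.mem_span_singleton.2 ⟨f y, rfl⟩
  exact Submodule.finiteDimensional_of_le this

/-- The rank one operator `y ↦ f y • x`, as an element of `A`. -/
noncomputable def rankOne (hA : ContainsFiniteRank A) : X →ₗ[ℂ] (X →L[ℂ] ℂ) →ₗ[ℂ] A :=
  LinearMap.mk₂ ℂ (fun x f => ⟨f.smulRight x, hA.smulRight_mem f x⟩)
    (fun x y f => by ext; simp) (fun c x f => by ext; simp [smul_comm c])
    (fun x f g => by ext; simp [add_smul]) (fun c x f => by ext; simp [mul_smul])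

variable (hA : ContainsFiniteRank A)

@[simp]
theorem rankOne_apply (x : X) (f : X →L[ℂ] ℂ) (y : X) :
    (hA.rankOne x f : X →L[ℂ] X) y = f y • x := rfl

theorem norm_rankOne (x : X) (f : X →L[ℂ] ℂ) : ‖hA.rankOne x f‖ = ‖x‖ * ‖f‖ := by
  change ‖f.smulRight x‖ = _
  rw [ContinuousLinearMap.norm_smulRight_apply, mul_comm]

theorem mul_rankOne (a : A) (x : X) (f : X →L[ℂ] ℂ) :
    a * hA.rankOne x f = hA.rankOne ((a : X →L[ℂ] X) x) f := by
  ext y; simp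

theorem rankOne_mul_rankOne (x y : X) (f g : X →L[ℂ] ℂ) :
    hA.rankOne x f * hA.rankOne y g = f y • hA.rankOne x g := by
  ext z; simp [smul_comm (f y)]

variable {S : Set A}

theorem one_add_rankOne_mem_of_eq_zero (hS : IsOpenUnitGroup S) {x : X} {f : X →L[ℂ] ℂ}
    (h : f x = 0) : 1 + hA.rankOne x f ∈ S := by
  refine hS.mem_of_roots (h := fun n => 1 + (n : ℂ)⁻¹ • hA.rankOne x f) ?_ ?_
  · have := ((tendsto_inv_atTop_nhds_zero_nat (𝕜 := ℂ)).smul_const (hA.rankOne x f)).const_add 1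
    simpa using this
  · intro n hn
    have : ∀ k : ℕ, (1 + (n : ℂ)⁻¹ • hA.rankOne x f) ^ k = 1 + (k * (n : ℂ)⁻¹) • hA.rankOne x f := by
      intro k
      induction k with
      | zero => simp
      | succ k ih =>
        rw [pow_succ, ih, mul_add, mul_one, add_mul, one_mul, smul_mul_smul_comm,
          rankOne_mul_rankOne, h, zero_smul, smul_zero]
        push_cast
        module
    rw [this, mul_inv_cancel₀ (Nat.cast_ne_zero.2 hn), one_smul]

theorem one_add_rankOne_mem (hS : IsOpenUnitGroup S) {x : X} {f : X →L[ℂ] ℂ}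
    (h : f x ≠ -1) : 1 + hA.rankOne x f ∈ S := by
  by_cases h0 : f x = 0
  · exact hA.one_add_rankOne_mem_of_eq_zero hS h0
  have h1 : 1 + f x ≠ 0 := fun h' => h (by linear_combination h')
  set w := Complex.log (1 + f x) with hw
  refine hS.mem_of_roots
    (h := fun n => 1 + ((Complex.exp (w / n) - 1) / f x) • hA.rankOne x f) ?_ ?_
  · have := (((((tendsto_exp_div_nat w).sub_const 1).div_const (f x)).smul_const
      (hA.rankOne x f)).const_add 1)
    simpa using this
  · intro n hn
    have : ∀ (z : ℂ) (k : ℕ), (1 + ((z - 1) / f x) • hA.rankOne x f) ^ k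
        = 1 + ((z ^ k - 1) / f x) • hA.rankOne x f := by
      intro z k
      induction k with
      | zero => simp
      | succ k ih =>
        rw [pow_succ, ih, mul_add, mul_one, add_mul, one_mul, smul_mul_smul_comm,
          rankOne_mul_rankOne, smul_smul, add_assoc, ← add_smul, ← add_smul]
        congr 2
        field_simp
        ring
    rw [this, exp_div_nat_pow _ hn, Complex.exp_log h1, add_sub_cancel_left, div_self h0, one_smul]

theorem injective_of_mem (hS : IsOpenUnitGroup S) {a : A} (ha : a ∈ S) {x : X}
    (h : (a : X →L[ℂ] X) x = 0) : x = 0 := by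
  obtain ⟨b, -, -, hba⟩ := hS.exists_inv a ha
  have : ((b * a : A) : X →L[ℂ] X) x = 0 := by simp [h]
  rw [hba] at this
  simpa using this

theorem one_add_rankOne_mem_iff (hS : IsOpenUnitGroup S) {x : X} {f : X →L[ℂ] ℂ} :
    1 + hA.rankOne x f ∈ S ↔ f x ≠ -1 := by
  refine ⟨fun h hfx => ?_, hA.one_add_rankOne_mem hS⟩
  have : x = 0 := injective_of_mem hS h (by simp [hfx])
  simp [this] at hfx

theorem add_rankOne_mem_iff (hS : IsOpenUnitGroup S) {a b : A} (ha : a ∈ S) (hab : a * b = 1)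
    {x : X} {f : X →L[ℂ] ℂ} :
    a + hA.rankOne x f ∈ S ↔ f ((b : X →L[ℂ] X) x) ≠ -1 := by
  rw [← hA.one_add_rankOne_mem_iff hS, ← hA.mul_rankOne b, ← hS.mul_mem_iff ha (b := 1 + _),
    mul_add, mul_one, ← mul_assoc, hab, one_mul]

theorem exists_mem_apply_eq (hA : ContainsFiniteRank A) (hS : IsOpenUnitGroup S) {x y : X} (hx : x ≠ 0) (hy : y ≠ 0) :
    ∃ a ∈ S, (a : X →L[ℂ] X) x = y := by
  obtain ⟨f, hfx, hfy⟩ := exists_dual_eq_one_ne_zero hx hy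
  refine ⟨1 + hA.rankOne (y - x) f, hA.one_add_rankOne_mem hS ?_, by simp [hfx]⟩
  rw [map_sub, hfx]
  exact fun h => hfy (by linear_combination h)

theorem exists_mem_apply_eq_apply_eq (hA : ContainsFiniteRank A)
    (hS : IsOpenUnitGroup S) {x x' y y' : X} (hx : x ≠ 0)
    (hx' : ∀ c : ℂ, x' ≠ c • x) (hy : y ≠ 0) (hy' : ∀ c : ℂ, y' ≠ c • y) :
    ∃ a ∈ S, (a : X →L[ℂ] X) x = y ∧ (a : X →L[ℂ] X) x' = y' := by
  obtain ⟨a, ha, hax⟩ := hA.exists_mem_apply_eq hS hx hy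
  have hax' : ∀ c : ℂ, (a : X →L[ℂ] X) x' ≠ c • y := by
    intro c hc
    refine hx' c (sub_eq_zero.1 (injective_of_mem hS ha ?_))
    rw [map_sub, map_smul, hax, hc, sub_self]
  obtain ⟨f, hf1, hf2, hf3⟩ := exists_dual_eq_zero_eq_one_ne_zero hy hax' hy'
  refine ⟨(1 + hA.rankOne (y' - (a : X →L[ℂ] X) x') f) * a,
    hS.mul_mem _ (hA.one_add_rankOne_mem hS ?_) _ ha, by simp [hax, hf1], by simp [hf2]⟩
  rw [map_sub, hf2]
  exact fun h => hf3 (by linear_combination h)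

/-- Rank one operators, characterised through membership of real lines in the group `S`. -/
theorem exists_eq_rankOne_iff (hS : IsOpenUnitGroup S) (r : A) :
    (∃ x f, r = hA.rankOne x f) ↔
      ∀ a ∈ S, ∀ s t : ℝ, a + s • r ∉ S → a + t • r ∉ S → s = t := by
  constructor
  · rintro ⟨x, f, rfl⟩ a ha s t hs ht
    obtain ⟨b, -, hab, -⟩ := hS.exists_inv a ha
    have key : ∀ s : ℝ, a + s • hA.rankOne x f ∉ S →
        (s : ℂ) * f ((b : X →L[ℂ] X) x) = -1 := by
      intro s hs
      rw [← Complex.coe_smul, ← map_smul, hA.add_rankOne_mem_iff hS ha hab] at hs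
      simpa using hs
    have h1 := key s hs
    have h2 := key t ht
    have h3 : f ((b : X →L[ℂ] X) x) ≠ 0 := fun h => by rw [h] at h1; simp at h1
    exact_mod_cast mul_right_cancel₀ h3 (h1.trans h2.symm)
  · intro h
    by_cases h0 : ∀ x, (r : X →L[ℂ] X) x = 0
    · exact ⟨0, 0, by ext x; simp [h0]⟩
    push Not at h0
    obtain ⟨x, hx⟩ := h0
    by_cases h1 : ∃ x', ∀ c : ℂ, (r : X →L[ℂ] X) x' ≠ c • (r : X →L[ℂ] X) x
    · exfalso
      obtain ⟨x', hx'⟩ := h1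
      have hx0 : x ≠ 0 := fun h => hx (by simp [h])
      have hxx' : ∀ c : ℂ, x' ≠ c • x := fun c hc => hx' c (by rw [hc, map_smul])
      obtain ⟨a, ha, ha1, ha2⟩ := hA.exists_mem_apply_eq_apply_eq hS hx0 hxx'
        (y := -(r : X →L[ℂ] X) x) (y' := -((2 : ℂ) • (r : X →L[ℂ] X) x')) (neg_ne_zero.2 hx) (by
          intro c hc
          apply hx' (2⁻¹ * c)
          rw [mul_smul, ← neg_inj, ← smul_neg, ← smul_neg, ← hc, smul_neg, smul_smul]
          simp)
      have e1 : a + (1 : ℝ) • r ∉ S := fun hm =>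
        hx0 (injective_of_mem hS hm (by simp [ha1]))
      have e2 : a + (2 : ℝ) • r ∉ S := fun hm => by
        have : x' = 0 := injective_of_mem hS hm (by
          rw [← Complex.coe_smul]
          simp [ha2])
        exact hxx' 0 (by simp [this])
      have := h a ha 1 2 e1 e2
      norm_num at this
    · push Not at h1
      obtain ⟨g, hg⟩ := exists_dual_eq_one hx
      refine ⟨(r : X →L[ℂ] X) x, g.comp (r : X →L[ℂ] X), ?_⟩
      ext x'
      obtain ⟨c, hc⟩ := h1 x'
      simp [hc, hg]

end ContainsFiniteRank

section Combinatorics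

variable {α β P Q γ δ : Type*} {p : α → P} {q : β → Q} {y : α → β → γ} {g : α → β → δ}

theorem forall_eq_of_eq_of_adjacency (hp : ∀ x, ∃ x', p x' ≠ p x) (hq : ∀ f, ∃ f', q f' ≠ q f)
    (h₁ : ∀ x f f', y x f = y x f' ∨ g x f = g x f')
    (h₂ : ∀ x x' f, y x f = y x' f ∨ g x f = g x' f)
    (h₃ : ∀ x x' f f', p x ≠ p x' → q f ≠ q f' → y x f ≠ y x' f' ∧ g x f ≠ g x' f')
    {x₀ : α} {f₀ f₁ : β} (hf : q f₁ ≠ q f₀) (h : y x₀ f₀ = y x₀ f₁) :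
    (∀ x f f', y x f = y x f') ∧ ∀ x x' f, g x f = g x' f := by
  have k₁ : ∀ x x' f f', p x ≠ p x' → q f ≠ q f' → y x f = y x f' → g x f = g x' f := by grind
  have k₂ : ∀ x x' f f', p x ≠ p x' → q f ≠ q f' → g x f = g x' f → y x f = y x f' := by grind
  let St : α → β → Prop := fun x f =>
    (∀ f', q f' ≠ q f → y x f = y x f') ∧ ∀ x', p x' ≠ p x → g x f = g x' f
  have s₁ : ∀ x f f', q f' ≠ q f → y x f = y x f' → St x f := by
    intro x f f' hff hy
    have hg : ∀ x', p x' ≠ p x → g x f = g x' f := fun x' hx =>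
      k₁ x x' f f' hx.symm hff.symm hy
    refine ⟨fun f'' hf'' => ?_, hg⟩
    obtain ⟨x', hx'⟩ := hp x
    exact k₂ x x' f f'' hx'.symm hf''.symm (hg x' hx')
  have s₂ : ∀ x f f', q f' ≠ q f → St x f → St x f' := fun x f f' hff hs =>
    s₁ x f' f hff.symm (hs.1 f' hff).symm
  have s₃ : ∀ x f f', St x f → St x f' := by
    intro x f f' hs
    by_cases hff : q f' = q f
    · obtain ⟨f'', hf''⟩ := hq f
      exact s₂ x f'' f' (by rw [hff]; exact hf''.symm) (s₂ x f f'' hf'' hs)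
    · exact s₂ x f f' hff hs
  have s₄ : ∀ x x' f, p x' ≠ p x → St x f → St x' f := by
    intro x x' f hx hs
    obtain ⟨f', hf'⟩ := hq f
    exact s₁ x' f f' hf' (k₂ x' x f f' hx hf'.symm (hs.2 x' hx).symm)
  have s₅ : ∀ x x' f, St x f → St x' f := by
    intro x x' f hs
    by_cases hxx : p x' = p x
    · obtain ⟨x'', hx''⟩ := hp x
      exact s₄ x'' x' f (by rw [hxx]; exact hx''.symm) (s₄ x x'' f hx'' hs)
    · exact s₄ x x' f hxx hs
  have s : ∀ x f, St x f := fun x f => s₅ x₀ x f (s₃ x₀ f₀ f (s₁ x₀ f₀ f₁ hf h))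
  constructor
  · intro x f f'
    by_cases hff : q f' = q f
    · obtain ⟨f'', hf''⟩ := hq f
      rw [(s x f).1 f'' hf'', (s x f').1 f'' (by rwa [hff])]
    · exact (s x f).1 f' hff
  · intro x x' f
    by_cases hxx : p x' = p x
    · obtain ⟨x'', hx''⟩ := hp x
      rw [(s x f).2 x'' hx'', (s x' f).2 x'' (by rwa [hxx])]
    · exact (s x f).2 x' hxx

/-- An adjacency preserving map between grids either preserves or exchanges the two families of
lines. -/
theorem straight_or_flipped_of_adjacency (hp : ∀ x, ∃ x', p x' ≠ p x)
    (hq : ∀ f, ∃ f', q f' ≠ q f)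
    (h₁ : ∀ x f f', y x f = y x f' ∨ g x f = g x f')
    (h₂ : ∀ x x' f, y x f = y x' f ∨ g x f = g x' f)
    (h₃ : ∀ x x' f f', p x ≠ p x' → q f ≠ q f' → y x f ≠ y x' f' ∧ g x f ≠ g x' f') :
    ((∀ x f f', y x f = y x f') ∧ ∀ x x' f, g x f = g x' f) ∨
      ((∀ x f f', g x f = g x f') ∧ ∀ x x' f, y x f = y x' f) := by
  by_cases hne : Nonempty α ∧ Nonempty β
  · obtain ⟨⟨x₀⟩, ⟨f₀⟩⟩ := hne
    obtain ⟨f₁, hf⟩ := hq f₀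
    rcases h₁ x₀ f₀ f₁ with h | h
    · exact .inl (forall_eq_of_eq_of_adjacency hp hq h₁ h₂ h₃ hf h)
    · exact .inr (forall_eq_of_eq_of_adjacency hp hq (fun x f f' => (h₁ x f f').symm)
        (fun x x' f => (h₂ x x' f).symm) (fun x x' f f' hx hf => (h₃ x x' f f' hx hf).symm) hf h)
  · left
    exact ⟨fun x f => (hne ⟨⟨x⟩, ⟨f⟩⟩).elim, fun x _ f => (hne ⟨⟨x⟩, ⟨f⟩⟩).elim⟩

end Combinatorics

section Parallel

variable (E : Type*) [AddCommGroup E] [Module ℂ E]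

/-- Two vectors are parallel if they are nonzero multiples of each other. -/
def parallelSetoid : Setoid E where
  r x y := ∃ c : ℂ, c ≠ 0 ∧ y = c • x
  iseqv :=
    { refl := fun x => ⟨1, one_ne_zero, (one_smul _ _).symm⟩
      symm := by
        rintro x y ⟨c, hc, rfl⟩
        exact ⟨c⁻¹, inv_ne_zero hc, by rw [smul_smul, inv_mul_cancel₀ hc, one_smul]⟩
      trans := by
        rintro x y z ⟨c, hc, rfl⟩ ⟨d, hd, rfl⟩
        exact ⟨d * c, mul_ne_zero hd hc, by rw [smul_smul]⟩ }

variable {E}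

/-- The line through a vector. -/
def lineThrough (x : E) : Quotient (parallelSetoid E) := Quotient.mk _ x

theorem lineThrough_eq_iff {x y : E} :
    lineThrough x = lineThrough y ↔ ∃ c : ℂ, c ≠ 0 ∧ y = c • x := Quotient.eq

end Parallel

/-- A nondegenerate bilinear map whose values are adjacent (i.e. their sum is again a value) only
if they share one of their two arguments up to a factor. -/
structure IsRankOnePairing {E F R : Type*} [AddCommGroup E] [Module ℂ E] [AddCommGroup F]
    [Module ℂ F] [AddCommGroup R] [Module ℂ R] (ρ : E →ₗ[ℂ] F →ₗ[ℂ] R) : Prop where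
  ne_zero : ∀ {x f}, x ≠ 0 → f ≠ 0 → ρ x f ≠ 0
  adjacent : ∀ {x x' f f'}, x ≠ 0 → x' ≠ 0 → f ≠ 0 → f' ≠ 0 →
    (∃ x'' f'', ρ x f + ρ x' f' = ρ x'' f'') →
    lineThrough x = lineThrough x' ∨ lineThrough f = lineThrough f'

namespace IsRankOnePairing

variable {E F R G H R' : Type*} [AddCommGroup E] [Module ℂ E] [AddCommGroup F] [Module ℂ F]
  [AddCommGroup R] [Module ℂ R] [AddCommGroup G] [Module ℂ G] [AddCommGroup H] [Module ℂ H]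
  [AddCommGroup R'] [Module ℂ R'] {ρ : E →ₗ[ℂ] F →ₗ[ℂ] R} {σ : G →ₗ[ℂ] H →ₗ[ℂ] R'}

theorem flip (hρ : IsRankOnePairing ρ) : IsRankOnePairing ρ.flip where
  ne_zero hf hx := hρ.ne_zero hx hf
  adjacent hf hf' hx hx' h := by
    obtain ⟨f'', x'', h⟩ := h
    exact (hρ.adjacent hx hx' hf hf' ⟨x'', f'', h⟩).symm

theorem left_cancel (hρ : IsRankOnePairing ρ) {x x' : E} {f : F} (hf : f ≠ 0)
    (h : ρ x f = ρ x' f) : x = x' := by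
  by_contra hne
  exact hρ.ne_zero (sub_ne_zero.2 hne) hf (by simp [h])

theorem right_cancel (hρ : IsRankOnePairing ρ) {x : E} {f f' : F} (hx : x ≠ 0)
    (h : ρ x f = ρ x f') : f = f' := by
  by_contra hne
  exact hρ.ne_zero hx (sub_ne_zero.2 hne) (by simp [h])

/-- If the two vectors on the left are not parallel, two terms cannot cancel. -/
theorem lineThrough_eq_of_eq (hρ : IsRankOnePairing ρ) {x x' : E} {f f' : F} (hx : x ≠ 0)
    (hf : f ≠ 0) (h : ρ x f = ρ x' f') : lineThrough x = lineThrough x' := by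
  have h0 := hρ.ne_zero hx hf
  have hx' : x' ≠ 0 := by rintro rfl; exact h0 (by rw [h]; simp)
  have hf' : f' ≠ 0 := by rintro rfl; exact h0 (by rw [h]; simp)
  rcases hρ.adjacent hx hx' hf (neg_ne_zero.2 hf') ⟨0, 0, by simp [h]⟩ with h1 | h1
  · exact h1
  · obtain ⟨c, hc, h2⟩ := lineThrough_eq_iff.1 h1
    rw [lineThrough_eq_iff]
    have h3 : ρ x f = ρ (-c • x') f := by
      rw [h, ← neg_neg f', h2]; simp
    have := hρ.left_cancel hf h3
    exact ⟨(-c)⁻¹, inv_ne_zero (neg_ne_zero.2 hc), by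
      rw [this, smul_smul, inv_mul_cancel₀ (neg_ne_zero.2 hc), one_smul]⟩

/-- An additive injection preserving rank one elements in both directions maps the two rulings
to the two rulings. -/
theorem straight_or_flipped (hρ : IsRankOnePairing ρ) (hσ : IsRankOnePairing σ)
    (hE : ∀ x : E, x ≠ 0 → ∃ x' ≠ 0, lineThrough x' ≠ lineThrough x)
    (hF : ∀ f : F, f ≠ 0 → ∃ f' ≠ 0, lineThrough f' ≠ lineThrough f)
    {L : R →+ R'} (hLi : Function.Injective L)
    (hL : ∀ r, (∃ x f, r = ρ x f) ↔ ∃ y g, L r = σ y g) :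
    ∃ (y : E → F → G) (g : E → F → H), (∀ x f, L (ρ x f) = σ (y x f) (g x f)) ∧
      (((∀ x f f', x ≠ 0 → f ≠ 0 → f' ≠ 0 → lineThrough (y x f) = lineThrough (y x f')) ∧
        ∀ x x' f, x ≠ 0 → x' ≠ 0 → f ≠ 0 → lineThrough (g x f) = lineThrough (g x' f)) ∨
       ((∀ x f f', x ≠ 0 → f ≠ 0 → f' ≠ 0 → lineThrough (g x f) = lineThrough (g x f')) ∧
        ∀ x x' f, x ≠ 0 → x' ≠ 0 → f ≠ 0 → lineThrough (y x f) = lineThrough (y x' f))) := by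
  have hex : ∀ x f, ∃ y g, L (ρ x f) = σ y g := fun x f => (hL _).1 ⟨x, f, rfl⟩
  choose y g hyg using hex
  refine ⟨y, g, hyg, ?_⟩
  have hne : ∀ {x f}, x ≠ 0 → f ≠ 0 → y x f ≠ 0 ∧ g x f ≠ 0 := by
    intro x f hx hf
    have h0 : L (ρ x f) ≠ 0 := fun h => hρ.ne_zero hx hf (hLi (h.trans (map_zero L).symm))
    rw [hyg] at h0
    exact ⟨fun h => h0 (by simp [h]), fun h => h0 (by simp [h])⟩
  have key := straight_or_flipped_of_adjacency (α := {x : E // x ≠ 0}) (β := {f : F // f ≠ 0})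
    (p := fun x => lineThrough x.1) (q := fun f => lineThrough f.1)
    (y := fun x f => lineThrough (y x.1 f.1)) (g := fun x f => lineThrough (g x.1 f.1))
    (fun x => by obtain ⟨x', h, h'⟩ := hE x.1 x.2; exact ⟨⟨x', h⟩, h'⟩)
    (fun f => by obtain ⟨f', h, h'⟩ := hF f.1 f.2; exact ⟨⟨f', h⟩, h'⟩)
    (fun x f f' => hσ.adjacent (hne x.2 f.2).1 (hne x.2 f'.2).1 (hne x.2 f.2).2 (hne x.2 f'.2).2
      ⟨y x (f + f'), g x (f + f'), by rw [← hyg, ← hyg, ← hyg, map_add, map_add]⟩)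
    (fun x x' f => hσ.adjacent (hne x.2 f.2).1 (hne x'.2 f.2).1 (hne x.2 f.2).2 (hne x'.2 f.2).2
      ⟨y (x + x') f, g (x + x') f, by
        rw [← hyg, ← hyg, ← hyg, map_add, LinearMap.add_apply, map_add]⟩)
    (fun x x' f f' hx hf => by
      have hnot : ¬ ∃ a b, ρ x.1 f.1 + ρ x'.1 f'.1 = ρ a b := fun h =>
        (hρ.adjacent x.2 x'.2 f.2 f'.2 h).elim hx hf
      rw [hL, map_add, hyg, hyg] at hnot
      constructor
      · intro h
        obtain ⟨c, -, hc⟩ := lineThrough_eq_iff.1 h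
        exact hnot ⟨y x f, g x f + c • g x' f', by rw [hc]; simp⟩
      · intro h
        obtain ⟨c, -, hc⟩ := lineThrough_eq_iff.1 h
        exact hnot ⟨y x f + c • y x' f', g x f, by rw [hc]; simp⟩)
  refine key.imp (fun h => ⟨?_, ?_⟩) (fun h => ⟨?_, ?_⟩)
  · exact fun x f f' hx hf hf' => h.1 ⟨x, hx⟩ ⟨f, hf⟩ ⟨f', hf'⟩
  · exact fun x x' f hx hx' hf => h.2 ⟨x, hx⟩ ⟨x', hx'⟩ ⟨f, hf⟩
  · exact fun x f f' hx hf hf' => h.1 ⟨x, hx⟩ ⟨f, hf⟩ ⟨f', hf'⟩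
  · exact fun x x' f hx hx' hf => h.2 ⟨x, hx⟩ ⟨x', hx'⟩ ⟨f, hf⟩

/-- An additive injection preserving rank one elements and the two rulings is of product form. -/
theorem exists_product_form (hρ : IsRankOnePairing ρ) (hσ : IsRankOnePairing σ)
    (hE : ∀ x : E, x ≠ 0 → ∃ x' ≠ 0, lineThrough x' ≠ lineThrough x)
    (hF : ∀ f : F, f ≠ 0 → ∃ f' ≠ 0, lineThrough f' ≠ lineThrough f)
    {L : R →+ R'} (hLi : Function.Injective L)
    (hL : ∀ r, (∃ x f, r = ρ x f) ↔ ∃ y g, L r = σ y g)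
    {y : E → F → G} {g : E → F → H} (hyg : ∀ x f, L (ρ x f) = σ (y x f) (g x f))
    (hy : ∀ x f f', x ≠ 0 → f ≠ 0 → f' ≠ 0 → lineThrough (y x f) = lineThrough (y x f'))
    (hg : ∀ x x' f, x ≠ 0 → x' ≠ 0 → f ≠ 0 → lineThrough (g x f) = lineThrough (g x' f))
    {x₀ : E} (hx₀ : x₀ ≠ 0) {f₀ : F} (hf₀ : f₀ ≠ 0) :
    ∃ (U : E → G) (V : F → H), ∀ x f, L (ρ x f) = σ (U x) (V f) := by
  have h0 : ∀ {x f}, x ≠ 0 → f ≠ 0 → L (ρ x f) ≠ 0 := fun hx hf h =>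
    hρ.ne_zero hx hf (hLi (h.trans (map_zero L).symm))
  have hU : ∀ x, ∃ u, L (ρ x f₀) = σ u (g x₀ f₀) ∧
      (x ≠ 0 → lineThrough u = lineThrough (y x f₀)) := by
    intro x
    rcases eq_or_ne x 0 with rfl | hx
    · exact ⟨0, by simp, fun h => (h rfl).elim⟩
    obtain ⟨c, hc, h⟩ := lineThrough_eq_iff.1 (hg x₀ x f₀ hx₀ hx hf₀)
    exact ⟨c • y x f₀, by rw [hyg, h]; simp, fun _ => (lineThrough_eq_iff.2 ⟨c, hc, rfl⟩).symm⟩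
  choose U hU hUl using hU
  have hV : ∀ f, ∃ v, L (ρ x₀ f) = σ (U x₀) v ∧
      (f ≠ 0 → lineThrough v = lineThrough (g x₀ f)) := by
    intro f
    rcases eq_or_ne f 0 with rfl | hf
    · exact ⟨0, by simp, fun h => (h rfl).elim⟩
    obtain ⟨c, hc, h⟩ := lineThrough_eq_iff.1 ((hUl x₀ hx₀).trans (hy x₀ f₀ f hx₀ hf₀ hf))
    exact ⟨c • g x₀ f, by rw [hyg, h]; simp, fun _ => (lineThrough_eq_iff.2 ⟨c, hc, rfl⟩).symm⟩
  choose V hV hVl using hV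
  have hU0 : ∀ {x}, x ≠ 0 → U x ≠ 0 := fun hx h => h0 hx hf₀ (by rw [hU, h]; simp)
  have hV0 : ∀ {f}, f ≠ 0 → V f ≠ 0 := fun hf h => h0 hx₀ hf (by rw [hV, h]; simp)
  have hg0 : g x₀ f₀ ≠ 0 := fun h => h0 hx₀ hf₀ (by rw [hyg, h]; simp)
  have hUadd : ∀ x x', U (x + x') = U x + U x' := by
    intro x x'
    apply hσ.left_cancel hg0
    rw [← hU, map_add, LinearMap.add_apply, map_add, hU, hU, map_add, LinearMap.add_apply]
  -- up to a scalar the formula holds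
  have hc : ∀ x f, x ≠ 0 → f ≠ 0 → ∃ c : ℂ, L (ρ x f) = c • σ (U x) (V f) := by
    intro x f hx hf
    obtain ⟨c, -, h⟩ := lineThrough_eq_iff.1 ((hUl x hx).trans (hy x f₀ f hx hf₀ hf))
    obtain ⟨d, -, h'⟩ := lineThrough_eq_iff.1 ((hVl f hf).trans (hg x₀ x f hx₀ hx hf))
    exact ⟨d * c, by rw [hyg, h, h']; simp [mul_smul]⟩
  -- nonparallel vectors have nonparallel images
  have hUne : ∀ x x', x ≠ 0 → x' ≠ 0 → lineThrough x ≠ lineThrough x' →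
      lineThrough (U x) ≠ lineThrough (U x') := by
    intro x x' hx hx' hne hUU
    obtain ⟨f₁, hf₁, hff⟩ := hF f₀ hf₀
    obtain ⟨c, -, h⟩ := lineThrough_eq_iff.1 hUU
    obtain ⟨d, hd⟩ := hc x' f₁ hx' hf₁
    have : ∃ a b, ρ x f₀ + ρ x' f₁ = ρ a b := by
      rw [hL, map_add, hU, hd, h]
      exact ⟨U x, g x₀ f₀ + (d * c) • V f₁, by simp [mul_smul]⟩
    exact (hρ.adjacent hx hx' hf₀ hf₁ this).elim hne hff.symm
  -- the scalar is the same for nonparallel vectors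
  have hstep : ∀ x x' f, x ≠ 0 → x' ≠ 0 → f ≠ 0 → lineThrough x ≠ lineThrough x' →
      L (ρ x' f) = σ (U x') (V f) → L (ρ x f) = σ (U x) (V f) := by
    intro x x' f hx hx' hf hne hx'f
    obtain ⟨c, hcx⟩ := hc x f hx hf
    have hxx' : x + x' ≠ 0 := by
      intro h
      apply hne
      rw [lineThrough_eq_iff]
      exact ⟨-1, by norm_num, by rw [neg_one_smul]; exact (neg_eq_of_add_eq_zero_right h).symm⟩
    obtain ⟨d, hd⟩ := hc (x + x') f hxx' hf
    have h1 : L (ρ (x + x') f) = c • σ (U x) (V f) + σ (U x') (V f) := by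
      rw [map_add, LinearMap.add_apply, map_add, hcx, hx'f]
    rw [hd, hUadd] at h1
    have h2 : σ (d • (U x + U x')) (V f) = σ (c • U x + U x') (V f) := by
      simpa using h1
    have h3 := hσ.left_cancel (hV0 hf) h2
    have h4 : (d - c) • U x = (1 - d) • U x' := by
      rw [sub_smul, sub_smul, one_smul, sub_eq_sub_iff_add_eq_add, add_comm (U x'), ← h3,
        smul_add]
    have hd1 : d = 1 := by
      by_contra hd1
      have hd1' : 1 - d ≠ 0 := sub_ne_zero.2 (Ne.symm hd1)
      have h5 : U x' = ((1 - d)⁻¹ * (d - c)) • U x := by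
        rw [mul_smul, h4, smul_smul, inv_mul_cancel₀ hd1', one_smul]
      refine hUne x x' hx hx' hne (lineThrough_eq_iff.2 ⟨_, fun h6 => ?_, h5⟩)
      rw [h6, zero_smul] at h5
      exact hU0 hx' h5
    have hc1 : c = 1 := by
      rw [hd1, sub_self, zero_smul] at h4
      rcases smul_eq_zero.1 h4 with h | h
      · exact (sub_eq_zero.1 h).symm
      · exact (hU0 hx h).elim
    rw [hcx, hc1, one_smul]
  refine ⟨U, V, fun x f => ?_⟩
  rcases eq_or_ne f 0 with rfl | hf
  · have : V 0 = 0 := hσ.right_cancel (hU0 hx₀) (by rw [← hV]; simp)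
    simp [this]
  rcases eq_or_ne x 0 with rfl | hx
  · have : U 0 = 0 := hσ.left_cancel hg0 (by rw [← hU]; simp)
    simp [this]
  by_cases hxx : lineThrough x = lineThrough x₀
  · obtain ⟨x₁, hx₁, hne⟩ := hE x₀ hx₀
    exact hstep x x₁ f hx hx₁ hf (by rw [hxx]; exact hne.symm)
      (hstep x₁ x₀ f hx₁ hx₀ hf hne (hV f))
  · exact hstep x x₀ f hx hx₀ hf hxx (hV f)

section ProductForm

variable {L : R →+ R'} {U : E → G} {V : F → H}

theorem product_form_ne_zero (hρ : IsRankOnePairing ρ) (hLi : Function.Injective L)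
    (hUV : ∀ x f, L (ρ x f) = σ (U x) (V f)) {x : E} {f : F} (hx : x ≠ 0) (hf : f ≠ 0) :
    U x ≠ 0 ∧ V f ≠ 0 := by
  have h0 : L (ρ x f) ≠ 0 := fun h => hρ.ne_zero hx hf (hLi (h.trans (map_zero L).symm))
  rw [hUV] at h0
  exact ⟨fun h => h0 (by simp [h]), fun h => h0 (by simp [h])⟩

theorem product_form_map_add (hρ : IsRankOnePairing ρ) (hσ : IsRankOnePairing σ)
    (hLi : Function.Injective L) (hUV : ∀ x f, L (ρ x f) = σ (U x) (V f)) [Nontrivial E]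
    [Nontrivial F] (x x' : E) : U (x + x') = U x + U x' := by
  obtain ⟨x₀, hx₀⟩ := exists_ne (0 : E)
  obtain ⟨f₀, hf₀⟩ := exists_ne (0 : F)
  apply hσ.left_cancel (hρ.product_form_ne_zero hLi hUV hx₀ hf₀).2
  rw [← hUV, map_add, LinearMap.add_apply, map_add, hUV, hUV, map_add, LinearMap.add_apply]

theorem product_form_surjective (hρ : IsRankOnePairing ρ) (hσ : IsRankOnePairing σ)
    (hLi : Function.Injective L) (hLs : Function.Surjective L)
    (hL : ∀ r, (∃ x f, r = ρ x f) ↔ ∃ y g, L r = σ y g)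
    (hUV : ∀ x f, L (ρ x f) = σ (U x) (V f)) [Nontrivial E] [Nontrivial F]
    (hE : ∀ x : E, x ≠ 0 → ∃ x' ≠ 0, lineThrough x' ≠ lineThrough x) :
    Function.Surjective U := by
  intro w
  obtain ⟨x₀, hx₀⟩ := exists_ne (0 : E)
  obtain ⟨f₀, hf₀⟩ := exists_ne (0 : F)
  have hV0 := (hρ.product_form_ne_zero hLi hUV hx₀ hf₀).2
  rcases eq_or_ne w 0 with rfl | hw
  · refine ⟨0, hσ.left_cancel hV0 ?_⟩
    rw [← hUV]; simp
  obtain ⟨r, hr⟩ := hLs (σ w (V f₀))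
  obtain ⟨x, f, rfl⟩ := (hL r).2 ⟨_, _, hr⟩
  have hr0 : σ w (V f₀) ≠ 0 := hσ.ne_zero hw hV0
  have hx : x ≠ 0 := by rintro rfl; exact hr0 (by rw [← hr]; simp)
  have hf : f ≠ 0 := by rintro rfl; exact hr0 (by rw [← hr]; simp)
  -- `V f` is parallel to `V f₀`, hence `f` is parallel to `f₀`
  rw [hUV] at hr
  have hVV : lineThrough (V f₀) = lineThrough (V f) :=
    hσ.flip.lineThrough_eq_of_eq hV0 hw hr.symm
  have hff : lineThrough f₀ = lineThrough f := by
    by_contra hne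
    obtain ⟨x', hx', hxx'⟩ := hE x hx
    obtain ⟨c, -, hc⟩ := lineThrough_eq_iff.1 hVV
    have : ∃ a b, ρ x' f₀ + ρ x f = ρ a b := by
      rw [hL, map_add, hUV, hUV, hc]
      exact ⟨U x' + c • U x, V f₀, by simp⟩
    exact (hρ.adjacent hx' hx hf₀ hf this).elim hxx' hne
  obtain ⟨c, hc, rfl⟩ := lineThrough_eq_iff.1 hff
  refine ⟨c • x, hσ.left_cancel hV0 ?_⟩
  rw [← hr, ← hUV, ← hUV]
  simp

/-- The two factors of a map of product form are both complex linear or both conjugate-linear,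
as far as multiplication by `I` is concerned. -/
theorem product_form_map_I_smul (hρ : IsRankOnePairing ρ) (hσ : IsRankOnePairing σ)
    (hLi : Function.Injective L) (hUV : ∀ x f, L (ρ x f) = σ (U x) (V f)) [Nontrivial E]
    [Nontrivial F] : ∃ τ : ℂ, (τ = Complex.I ∨ τ = -Complex.I) ∧
      (∀ x, U (Complex.I • x) = τ • U x) ∧ ∀ f, V (Complex.I • f) = τ • V f := by
  obtain ⟨x₀, hx₀⟩ := exists_ne (0 : E)
  obtain ⟨f₀, hf₀⟩ := exists_ne (0 : F)
  have hU0 := (hρ.product_form_ne_zero hLi hUV hx₀ hf₀).1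
  have hV0 := (hρ.product_form_ne_zero hLi hUV hx₀ hf₀).2
  have hsw : ∀ x f, σ (U (Complex.I • x)) (V f) = σ (U x) (V (Complex.I • f)) := by
    intro x f
    rw [← hUV, ← hUV]; simp
  have hIx₀ : Complex.I • x₀ ≠ 0 := smul_ne_zero Complex.I_ne_zero hx₀
  obtain ⟨τ, -, hτ⟩ := lineThrough_eq_iff.1 (hσ.lineThrough_eq_of_eq
    hU0 ((hρ.product_form_ne_zero hLi hUV hx₀ (smul_ne_zero Complex.I_ne_zero hf₀)).2)
    (hsw x₀ f₀).symm)
  have hVI : ∀ f, V (Complex.I • f) = τ • V f := by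
    intro f
    apply hσ.right_cancel hU0
    rw [← hsw, hτ]; simp
  have hUI : ∀ x, U (Complex.I • x) = τ • U x := by
    intro x
    apply hσ.left_cancel hV0
    rw [hsw, hVI]; simp
  refine ⟨τ, ?_, hUI, hVI⟩
  have hneg : U (-x₀) = -U x₀ := by
    apply hσ.left_cancel hV0
    rw [← hUV, map_neg, LinearMap.neg_apply, map_neg, hUV, map_neg, LinearMap.neg_apply]
  have h2 : (τ * τ) • U x₀ = (-1 : ℂ) • U x₀ := by
    rw [mul_smul, ← hUI, ← hUI, smul_smul, Complex.I_mul_I, neg_one_smul, neg_one_smul, hneg]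
  have h3 := smul_left_injective ℂ hU0 h2
  have h4 : (τ - Complex.I) * (τ + Complex.I) = 0 := by
    linear_combination h3 - Complex.I_mul_I
  rcases mul_eq_zero.1 h4 with h | h
  · exact .inl (sub_eq_zero.1 h)
  · exact .inr (eq_neg_of_add_eq_zero_left h)

end ProductForm

end IsRankOnePairing

section RankOne

variable {X : Type*} [NormedAddCommGroup X] [NormedSpace ℂ X] {A : Subalgebra ℂ (X →L[ℂ] X)}

theorem lineThrough_eq_of_eq_smul {E : Type*} [AddCommGroup E] [Module ℂ E] {x y : E}
    (hy : y ≠ 0) {c : ℂ} (h : y = c • x) : lineThrough x = lineThrough y :=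
  lineThrough_eq_iff.2 ⟨c, by rintro rfl; exact hy (by simpa using h), h⟩

theorem exists_eq_smul_of_forall_eq_zero {f g : X →L[ℂ] ℂ} (h : ∀ x, f x = 0 → g x = 0)
    (hf : f ≠ 0) : ∃ c : ℂ, g = c • f := by
  obtain ⟨v, hv⟩ : ∃ v, f v ≠ 0 := by
    by_contra! h'
    exact hf (by ext v; simp [h'])
  refine ⟨g v / f v, ?_⟩
  ext x
  have := h (x - (f x / f v) • v) (by simp [hv])
  simp only [map_sub, map_smul, smul_eq_mul] at this
  simp only [smul_apply, smul_eq_mul]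
  linear_combination this

theorem ContainsFiniteRank.isRankOnePairing (hA : ContainsFiniteRank A) :
    IsRankOnePairing hA.rankOne where
  ne_zero {x f} hx hf h := by
    refine hf (ContinuousLinearMap.ext fun v => ?_)
    have : f v • x = 0 := by
      rw [← hA.rankOne_apply, h, ZeroMemClass.coe_zero, zero_apply]
    exact (smul_eq_zero.1 this).resolve_right hx
  adjacent {x x' f f'} hx hx' hf hf' h := by
    obtain ⟨x'', f'', h⟩ := h
    have key : ∀ v, f v • x + f' v • x' = f'' v • x'' := fun v => by
      simpa using congrArg (fun r : A => (r : X →L[ℂ] X) v) h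
    by_cases h1 : ∀ v, f v = 0 → f' v = 0
    · obtain ⟨c, hc⟩ := exists_eq_smul_of_forall_eq_zero h1 hf
      exact .inr (lineThrough_eq_of_eq_smul hf' hc)
    by_cases h2 : ∀ v, f' v = 0 → f v = 0
    · obtain ⟨c, hc⟩ := exists_eq_smul_of_forall_eq_zero h2 hf'
      exact .inr (lineThrough_eq_of_eq_smul hf hc).symm
    push Not at h1 h2
    obtain ⟨v, hv, hv'⟩ := h1
    obtain ⟨w, hw, hw'⟩ := h2
    have e1 : x' = ((f' v)⁻¹ * f'' v) • x'' := by
      rw [mul_smul, ← key v, hv, zero_smul, zero_add, smul_smul, inv_mul_cancel₀ hv', one_smul]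
    have e2 : x = ((f w)⁻¹ * f'' w) • x'' := by
      rw [mul_smul, ← key w, hw, zero_smul, add_zero, smul_smul, inv_mul_cancel₀ hw', one_smul]
    exact .inl ((lineThrough_eq_of_eq_smul hx e2).symm.trans (lineThrough_eq_of_eq_smul hx' e1))

end RankOne

section Semilinear

variable {E G : Type*} [NormedAddCommGroup E] [NormedSpace ℂ E] [NormedAddCommGroup G]
  [NormedSpace ℂ G]

/-- An additive map which scales all norms by a constant is real homogeneous. -/
theorem map_real_smul_of_norm_eq {U : E → G} (hadd : ∀ x y, U (x + y) = U x + U y) {k : ℝ}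
    (hk : ∀ x, ‖U x‖ = k * ‖x‖) (t : ℝ) (x : E) : U (t • x) = t • U x := by
  let U' : E →+ G := AddMonoidHom.mk' U hadd
  have hcont : Continuous U' :=
    AddMonoidHomClass.continuous_of_bound U' k fun x => (hk x).le
  exact map_real_smul U' hcont t x

theorem map_complex_smul_of_norm_eq {s : ℂ →+* ℂ} (hs : ∀ r : ℝ, s r = r) {U : E → G}
    (hadd : ∀ x y, U (x + y) = U x + U y) {k : ℝ} (hk : ∀ x, ‖U x‖ = k * ‖x‖)
    (hI : ∀ x, U (Complex.I • x) = s Complex.I • U x) (z : ℂ) (x : E) : U (z • x) = s z • U x := by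
  conv_lhs => rw [← Complex.re_add_im z, add_smul, hadd, mul_smul, Complex.coe_smul,
    Complex.coe_smul, map_real_smul_of_norm_eq hadd hk, map_real_smul_of_norm_eq hadd hk, hI]
  conv_rhs => rw [← Complex.re_add_im z, map_add, map_mul, hs, hs, add_smul, mul_smul,
    Complex.coe_smul, Complex.coe_smul]

variable {s : ℂ →+* ℂ}

theorem bijective_of_norm_eq (U : E →ₛₗ[s] G) {k : ℝ} (hk0 : 0 < k)
    (hk : ∀ x, ‖U x‖ = k * ‖x‖) (hU : Function.Surjective U) : Function.Bijective U := by
  refine ⟨?_, hU⟩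
  rw [injective_iff_map_eq_zero]
  intro x hx
  have := hk x
  rw [hx, norm_zero, eq_comm, mul_eq_zero, norm_eq_zero] at this
  exact this.resolve_left hk0.ne'

variable [RingHomInvPair s s]

/-- A surjective semilinear map scaling all norms by a positive constant, as an equivalence. -/
noncomputable def ContinuousLinearEquiv.ofNormEq (U : E →ₛₗ[s] G) {k : ℝ} (hk0 : 0 < k)
    (hk : ∀ x, ‖U x‖ = k * ‖x‖) (hU : Function.Surjective U) : E ≃SL[s] G :=
  LinearEquiv.toContinuousLinearEquivOfBounds
    (LinearEquiv.ofBijective U (bijective_of_norm_eq U hk0 hk hU)) k k⁻¹ (fun x => (hk x).le) (fun y => by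
      obtain ⟨x, rfl⟩ := hU y
      rw [LinearEquiv.ofBijective_symm_apply_apply, hk, inv_mul_cancel_left₀ hk0.ne'])

end Semilinear

section ProductForm

variable {E F Y : Type*} [NormedAddCommGroup E] [NormedSpace ℂ E] [NormedAddCommGroup F]
  [NormedSpace ℂ F] [NormedAddCommGroup Y] [NormedSpace ℂ Y]
  {B : Subalgebra ℂ (Y →L[ℂ] Y)}

theorem eq_of_forall_mul_eq_neg_one_iff {s : ℂ →+* ℂ} [RingHomInvPair s s] {p q : ℂ}
    (h : ∀ z, z * p = -1 ↔ s z * q = -1) : q = s p := by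
  by_cases hp : p = 0
  · by_contra hq
    have hq0 : q ≠ 0 := by rintro rfl; exact hq (by simp [hp])
    have := (h (s (-q⁻¹))).2 (by
      rw [RingHomInvPair.comp_apply_eq₂ (σ := s) (σ' := s), neg_mul, inv_mul_cancel₀ hq0])
    simp [hp] at this
  · have h1 := (h (-p⁻¹)).1 (by rw [neg_mul, inv_mul_cancel₀ hp])
    rw [map_neg, map_inv₀, neg_mul, neg_inj] at h1
    have : s p ≠ 0 := (map_ne_zero s).2 hp
    field_simp at h1
    exact h1

/-- A group isomorphism in product form is implemented by a semilinear equivalence. -/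
theorem exists_equiv_of_product_form {A : Type*} [NormedRing A] [NormedAlgebra ℂ A]
    {S : Set A} {S' : Set B} (hB : ContainsFiniteRank B) (hS : IsOpenUnitGroup S)
    (hS' : IsOpenUnitGroup S') {ρ : E →ₗ[ℂ] F →ₗ[ℂ] A} {β : E →ₗ[ℂ] F →ₗ[ℂ] ℂ}
    {act : A → E → E} (hactone : ∀ x, act 1 x = x)
    (hact : ∀ a b, a * b = 1 → b * a = 1 → ∀ x, act a (act b x) = x)
    (hmem : ∀ a ∈ S, ∀ b, a * b = 1 → b * a = 1 → ∀ x f, a + ρ x f ∈ S ↔ β (act b x) f ≠ -1)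
    {L : A → B} (hLadd : ∀ a b, L (a + b) = L a + L b) (hLS : ∀ a, L a ∈ S' ↔ a ∈ S)
    {s : ℂ →+* ℂ} [RingHomInvPair s s]
    {U : E →ₛₗ[s] Y} {V : F →ₛₗ[s] (Y →L[ℂ] ℂ)} {k : ℝ} (hk0 : 0 < k)
    (hk : ∀ x, ‖U x‖ = k * ‖x‖) (hU : Function.Surjective U) (hV : Function.Surjective V)
    (hUV : ∀ x f, L (ρ x f) = hB.rankOne (U x) (V f)) :
    ∃ W : E ≃SL[s] Y, ∀ a ∈ S, ∀ y, (L a : Y →L[ℂ] Y) y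
      = (L 1 : Y →L[ℂ] Y) (W (act a (W.symm y))) := by
  have key : ∀ a ∈ S, ∀ b, a * b = 1 → b * a = 1 → ∀ b' : B, L a * b' = 1 → ∀ x f,
      V f ((b' : Y →L[ℂ] Y) (U x)) = s (β (act b x) f) := by
    intro a ha b hab hba b' hb' x f
    refine eq_of_forall_mul_eq_neg_one_iff fun z => not_iff_not.1 ?_
    have h1 := hmem a ha b hab hba x (z • f)
    rw [← hLS, hLadd, hUV, hB.add_rankOne_mem_iff hS' ((hLS a).2 ha) hb'] at h1
    simpa using h1.symm
  obtain ⟨d, -, hd1, hd2⟩ := hS'.exists_inv _ ((hLS 1).2 hS.one_mem)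
  have hd1' : ∀ y, (L 1 : Y →L[ℂ] Y) ((d : Y →L[ℂ] Y) y) = y := fun y => by
    simpa using congrArg (fun r : B => (r : Y →L[ℂ] Y) y) hd1
  have hd2' : ∀ y, (d : Y →L[ℂ] Y) ((L 1 : Y →L[ℂ] Y) y) = y := fun y => by
    simpa using congrArg (fun r : B => (r : Y →L[ℂ] Y) y) hd2
  have hfun : ∀ a ∈ S, ∀ x, (L a : Y →L[ℂ] Y) ((d : Y →L[ℂ] Y) (U x)) = U (act a x) := by
    intro a ha x
    obtain ⟨b, -, hab, hba⟩ := hS.exists_inv a ha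
    obtain ⟨b', -, hb'1, hb'2⟩ := hS'.exists_inv _ ((hLS a).2 ha)
    have h1 : (b' : Y →L[ℂ] Y) (U (act a x)) = (d : Y →L[ℂ] Y) (U x) := by
      by_contra hne
      obtain ⟨g, hg⟩ := exists_dual_eq_one (sub_ne_zero.2 hne)
      obtain ⟨f, rfl⟩ := hV g
      rw [map_sub, key a ha b hab hba b' hb'1,
        key 1 hS.one_mem 1 (one_mul 1) (one_mul 1) d hd1, hact b a hba hab, hactone, sub_self] at hg
      exact zero_ne_one hg
    rw [← h1]
    simpa using congrArg (fun r : B => (r : Y →L[ℂ] Y) (U (act a x))) hb'1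
  let D : Y ≃L[ℂ] Y := ContinuousLinearEquiv.equivOfInverse (d : Y →L[ℂ] Y) (L 1 : Y →L[ℂ] Y)
    hd1' hd2'
  let W : E ≃SL[s] Y := (ContinuousLinearEquiv.ofNormEq U hk0 hk hU).trans D
  have hW : ∀ x, W x = (d : Y →L[ℂ] Y) (U x) := fun x => rfl
  refine ⟨W, fun a ha y => ?_⟩
  rw [hW, hd1', ← hfun a ha, ← hW, W.apply_symm_apply]

end ProductForm

section ProductForm

variable {E F Y A : Type*} [NormedAddCommGroup E] [NormedSpace ℂ E] [NormedAddCommGroup F]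
  [NormedSpace ℂ F] [NormedAddCommGroup Y] [NormedSpace ℂ Y] [NormedRing A] [NormedAlgebra ℂ A]
  {B : Subalgebra ℂ (Y →L[ℂ] Y)} {S : Set A} {S' : Set B} (hB : ContainsFiniteRank B)
  {ρ : E →ₗ[ℂ] F →ₗ[ℂ] A}

theorem exists_norm_eq_of_product_form [Nontrivial E] [Nontrivial F] (hρ : IsRankOnePairing ρ)
    (hρn : ∀ x f, ‖ρ x f‖ = ‖x‖ * ‖f‖) {L : A →+ B} (hLn : ∀ a, ‖(L a : Y →L[ℂ] Y)‖ = ‖a‖)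
    (hLi : Function.Injective L)
    {U : E → Y} {V : F → (Y →L[ℂ] ℂ)} (hUV : ∀ x f, L (ρ x f) = hB.rankOne (U x) (V f)) :
    (∃ k > 0, ∀ x, ‖U x‖ = k * ‖x‖) ∧ ∃ k > 0, ∀ f, ‖V f‖ = k * ‖f‖ := by
  obtain ⟨x₀, hx₀⟩ := exists_ne (0 : E)
  obtain ⟨f₀, hf₀⟩ := exists_ne (0 : F)
  obtain ⟨hU0, hV0⟩ := hρ.product_form_ne_zero hLi hUV hx₀ hf₀
  have h : ∀ x f, ‖U x‖ * ‖V f‖ = ‖x‖ * ‖f‖ := by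
    intro x f
    rw [← hρn, ← hLn, hUV]
    exact (hB.norm_rankOne _ _).symm
  rw [← norm_pos_iff] at hx₀ hf₀ hU0 hV0
  refine ⟨⟨‖f₀‖ / ‖V f₀‖, div_pos hf₀ hV0, fun x => ?_⟩,
    ⟨‖x₀‖ / ‖U x₀‖, div_pos hx₀ hU0, fun f => ?_⟩⟩
  · have := h x f₀
    field_simp
    linarith
  · have := h x₀ f
    field_simp
    linarith

variable {β : E →ₗ[ℂ] F →ₗ[ℂ] ℂ} {act : A → E → E}

theorem exists_equiv_of_straight [Nontrivial E] [Nontrivial F]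
    (hS : IsOpenUnitGroup S) (hS' : IsOpenUnitGroup S')
    (hρ : IsRankOnePairing ρ) (hρn : ∀ x f, ‖ρ x f‖ = ‖x‖ * ‖f‖)
    (hE : ∀ x : E, x ≠ 0 → ∃ x' ≠ 0, lineThrough x' ≠ lineThrough x)
    (hF : ∀ f : F, f ≠ 0 → ∃ f' ≠ 0, lineThrough f' ≠ lineThrough f)
    (hactone : ∀ x, act 1 x = x)
    (hact : ∀ a b, a * b = 1 → b * a = 1 → ∀ x, act a (act b x) = x)
    (hmem : ∀ a ∈ S, ∀ b, a * b = 1 → b * a = 1 → ∀ x f, a + ρ x f ∈ S ↔ β (act b x) f ≠ -1)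
    {L : A →+ B} (hLi : Function.Injective L) (hLs : Function.Surjective L)
    (hLn : ∀ a, ‖(L a : Y →L[ℂ] Y)‖ = ‖a‖) (hLS : ∀ a, L a ∈ S' ↔ a ∈ S)
    (hL : ∀ r, (∃ x f, r = ρ x f) ↔ ∃ y g, L r = hB.rankOne y g)
    {y : E → F → Y} {g : E → F → (Y →L[ℂ] ℂ)}
    (hyg : ∀ x f, L (ρ x f) = hB.rankOne (y x f) (g x f))
    (hy : ∀ x f f', x ≠ 0 → f ≠ 0 → f' ≠ 0 → lineThrough (y x f) = lineThrough (y x f'))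
    (hg : ∀ x x' f, x ≠ 0 → x' ≠ 0 → f ≠ 0 → lineThrough (g x f) = lineThrough (g x' f)) :
    (∃ W : E ≃L[ℂ] Y, ∀ a ∈ S, ∀ y, (L a : Y →L[ℂ] Y) y
      = (L 1 : Y →L[ℂ] Y) (W (act a (W.symm y)))) ∨
    ∃ W : E ≃SL[starRingEnd ℂ] Y, ∀ a ∈ S, ∀ y, (L a : Y →L[ℂ] Y) y
      = (L 1 : Y →L[ℂ] Y) (W (act a (W.symm y))) := by
  obtain ⟨x₀, hx₀⟩ := exists_ne (0 : E)
  obtain ⟨f₀, hf₀⟩ := exists_ne (0 : F)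
  have hσ := hB.isRankOnePairing
  obtain ⟨U, V, hUV⟩ := hρ.exists_product_form hσ hE hF hLi hL hyg hy hg hx₀ hf₀
  have hVU : ∀ f x, L (ρ.flip f x) = hB.rankOne.flip (V f) (U x) := fun f x => hUV x f
  have hLflip : ∀ r, (∃ f x, r = ρ.flip f x) ↔ ∃ g y, L r = hB.rankOne.flip g y := fun r => by
    simp only [LinearMap.flip_apply]
    rw [exists_comm, hL, exists_comm]
  obtain ⟨⟨k, hk0, hk⟩, ⟨l, -, hl⟩⟩ := exists_norm_eq_of_product_form hB hρ hρn hLn hLi hUV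
  have hUadd := hρ.product_form_map_add hσ hLi hUV
  have hVadd := hρ.flip.product_form_map_add hσ.flip hLi hVU
  have hU := hρ.product_form_surjective hσ hLi hLs hL hUV hE
  have hV := hρ.flip.product_form_surjective hσ.flip hLi hLs hLflip hVU hF
  have main : ∀ (s : ℂ →+* ℂ) [RingHomInvPair s s], (∀ r : ℝ, s r = r) →
      (∀ x, U (Complex.I • x) = s Complex.I • U x) →
      (∀ f, V (Complex.I • f) = s Complex.I • V f) →
      ∃ W : E ≃SL[s] Y, ∀ a ∈ S, ∀ y, (L a : Y →L[ℂ] Y) y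
        = (L 1 : Y →L[ℂ] Y) (W (act a (W.symm y))) := by
    intro s _ hs hUI hVI
    exact exists_equiv_of_product_form hB hS hS' hactone hact hmem (map_add L) hLS
      (U := { toFun := U
              map_add' := hUadd
              map_smul' := map_complex_smul_of_norm_eq hs hUadd hk hUI })
      (V := { toFun := V
              map_add' := hVadd
              map_smul' := map_complex_smul_of_norm_eq hs hVadd hl hVI }) hk0 hk hU hV hUV
  obtain ⟨τ, hτ, hUτ, hVτ⟩ := hρ.product_form_map_I_smul hσ hLi hUV
  rcases hτ with rfl | rfl
  · exact .inl (main (RingHom.id ℂ) (fun r => rfl) hUτ hVτ)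
  · exact .inr (main (starRingEnd ℂ) Complex.conj_ofReal (by rwa [Complex.conj_I])
      (by rwa [Complex.conj_I]))

end ProductForm

section Groups

variable {X Y : Type*} [NormedAddCommGroup X] [NormedSpace ℂ X] [NormedAddCommGroup Y]
  [NormedSpace ℂ Y] {A : Subalgebra ℂ (X →L[ℂ] X)} {B : Subalgebra ℂ (Y →L[ℂ] Y)}
  {S : Set A} {S' : Set B}

theorem exists_dual_lineThrough_ne (hX : ∀ x : X, x ≠ 0 → ∃ x' ≠ 0, lineThrough x' ≠ lineThrough x)
    (f : X →L[ℂ] ℂ) (hf : f ≠ 0) : ∃ f' ≠ 0, lineThrough f' ≠ lineThrough f := by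
  obtain ⟨v, hv⟩ : ∃ v, f v ≠ 0 := by
    by_contra! h
    exact hf (by ext v; simp [h])
  have hv0 : v ≠ 0 := by rintro rfl; simp at hv
  obtain ⟨w, hw, hwv⟩ := hX v hv0
  obtain ⟨g, hgv, hgw⟩ := exists_dual_eq_zero_eq_one hv0 (y := w) fun c hc =>
    hwv (lineThrough_eq_of_eq_smul hw hc).symm
  refine ⟨g, by rintro rfl; simp at hgw, fun h => ?_⟩
  obtain ⟨c, -, rfl⟩ := lineThrough_eq_iff.1 h
  simp [hgv] at hv

theorem eq_zero_of_forall_one_add_mul_mem (hB : ContainsFiniteRank B) (hS' : IsOpenUnitGroup S')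
    {u : B} (hu : ∀ c : B, 1 + c * u ∈ S') : u = 0 := by
  ext z
  by_contra hz
  change (u : Y →L[ℂ] Y) z ≠ 0 at hz
  obtain ⟨g, hg⟩ := exists_dual_eq_one hz
  have : z = 0 := ContainsFiniteRank.injective_of_mem hS' (hu (hB.rankOne (-z) g)) (by simp [hg])
  exact hz (by simp [this])

/-- Rank one operators are preserved by real linear bijections preserving the groups. -/
theorem exists_eq_rankOne_iff_map (hA : ContainsFiniteRank A) (hB : ContainsFiniteRank B)
    (hS : IsOpenUnitGroup S) (hS' : IsOpenUnitGroup S') {L : A →ₗ[ℝ] B}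
    (hLs : Function.Surjective L) (hLS : ∀ a, L a ∈ S' ↔ a ∈ S) (r : A) :
    (∃ x f, r = hA.rankOne x f) ↔ ∃ y g, L r = hB.rankOne y g := by
  rw [hA.exists_eq_rankOne_iff hS, hB.exists_eq_rankOne_iff hS']
  constructor
  · intro h b hb s t hs ht
    obtain ⟨a, rfl⟩ := hLs b
    refine h a ((hLS a).1 hb) s t ?_ ?_
    · rwa [← hLS, map_add, map_smul]
    · rwa [← hLS, map_add, map_smul]
  · intro h a ha s t hs ht
    refine h (L a) ((hLS a).2 ha) s t ?_ ?_
    · rwa [← map_smul, ← map_add, hLS]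
    · rwa [← map_smul, ← map_add, hLS]

theorem exists_equiv_of_two_le [Nontrivial X] (hA : ContainsFiniteRank A)
    (hB : ContainsFiniteRank B) (hS : IsOpenUnitGroup S) (hS' : IsOpenUnitGroup S')
    {L : A →ₗᵢ[ℝ] B} (hLs : Function.Surjective L) (hLS : ∀ a, L a ∈ S' ↔ a ∈ S)
    (hX : ∀ x : X, x ≠ 0 → ∃ x' ≠ 0, lineThrough x' ≠ lineThrough x) :
    (∃ U : X ≃L[ℂ] Y, ∀ a ∈ S, ∀ y, (L a : Y →L[ℂ] Y) y
      = (L 1 : Y →L[ℂ] Y) (U ((a : X →L[ℂ] X) (U.symm y)))) ∨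
    (∃ U : X ≃SL[starRingEnd ℂ] Y, ∀ a ∈ S, ∀ y, (L a : Y →L[ℂ] Y) y
      = (L 1 : Y →L[ℂ] Y) (U ((a : X →L[ℂ] X) (U.symm y)))) ∨
    (∃ V : (X →L[ℂ] ℂ) ≃L[ℂ] Y, ∀ a ∈ S, ∀ y, (L a : Y →L[ℂ] Y) y
      = (L 1 : Y →L[ℂ] Y) (V ((V.symm y).comp (a : X →L[ℂ] X)))) ∨
    (∃ V : (X →L[ℂ] ℂ) ≃SL[starRingEnd ℂ] Y, ∀ a ∈ S, ∀ y, (L a : Y →L[ℂ] Y) y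
      = (L 1 : Y →L[ℂ] Y) (V ((V.symm y).comp (a : X →L[ℂ] X)))) := by
  have hX' := exists_dual_lineThrough_ne hX
  have hρ := hA.isRankOnePairing
  have hL := exists_eq_rankOne_iff_map hA hB hS hS' (L := L.toLinearMap) hLs hLS
  let M : A →+ B := L.toLinearMap.toAddMonoidHom
  have hmem : ∀ a ∈ S, ∀ b, a * b = 1 → ∀ x f,
      a + hA.rankOne x f ∈ S ↔ f ((b : X →L[ℂ] X) x) ≠ -1 :=
    fun a ha b hab x f => hA.add_rankOne_mem_iff hS ha hab
  have hLn : ∀ a, ‖(M a : Y →L[ℂ] Y)‖ = ‖a‖ := fun a => L.norm_map a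
  have hmul : ∀ (a b : A), a * b = 1 → ∀ x, (a : X →L[ℂ] X) ((b : X →L[ℂ] X) x) = x :=
    fun a b hab x => by simpa using congrArg (fun r : A => (r : X →L[ℂ] X) x) hab
  have hLflip : ∀ r, (∃ f x, r = hA.rankOne.flip f x) ↔ ∃ y g, M r = hB.rankOne y g := fun r => by
    simp only [LinearMap.flip_apply]
    rw [exists_comm]
    exact hL r
  have : Nontrivial (X →L[ℂ] ℂ) := by
    obtain ⟨x, hx⟩ := exists_ne (0 : X)
    obtain ⟨f, hf⟩ := exists_dual_eq_one hx
    exact nontrivial_of_ne f 0 (by rintro rfl; simp at hf)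
  obtain ⟨y, g, hyg, ⟨hy, hg⟩ | ⟨hg, hy⟩⟩ :=
    hρ.straight_or_flipped hB.isRankOnePairing hX hX' (L := M) L.injective hL
  · rw [← or_assoc]
    refine .inl ?_
    exact exists_equiv_of_straight hB (ρ := hA.rankOne) (L := M) hS hS' hρ hA.norm_rankOne hX hX'
      (β := (ContinuousLinearMap.coeLM ℂ).flip) (act := fun a x => (a : X →L[ℂ] X) x)
      (fun x => rfl) (fun a b hab _ => hmul a b hab)
      (fun a ha b hab _ => hmem a ha b hab) L.injective hLs hLn hLS hL
      hyg hy hg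
  · rw [← or_assoc]
    refine .inr ?_
    exact exists_equiv_of_straight hB (ρ := hA.rankOne.flip) (L := M) hS hS' hρ.flip
      (fun f x => (hA.norm_rankOne x f).trans (mul_comm _ _)) hX' hX
      (β := ContinuousLinearMap.coeLM ℂ) (act := fun a f => f.comp (a : X →L[ℂ] X))
      (fun x => rfl) (fun a b _ hba f => by ext x; simp [hmul b a hba])
      (fun a ha b hab _ f x => hmem a ha b hab x f) L.injective hLs hLn hLS hLflip
      (fun f x => hyg x f) (fun f x x' hf hx hx' => hy x x' f hx hx' hf)
      (fun f f' x hf hf' hx => hg x f f' hx hf hf')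

end Groups

section Line

variable {X Y : Type*} [NormedAddCommGroup X] [NormedSpace ℂ X] [NormedAddCommGroup Y]
  [NormedSpace ℂ Y]

/-- Two one-dimensional spaces are semilinearly equivalent. -/
theorem nonempty_equiv_of_forall_eq_smul {s : ℂ →+* ℂ} [RingHomInvPair s s]
    (hs : ∀ z, ‖s z‖ = ‖z‖) {x : X} (hx : x ≠ 0) (hX : ∀ x', ∃ c : ℂ, x' = c • x) {y : Y}
    (hy : y ≠ 0) (hY : ∀ y', ∃ c : ℂ, y' = c • y) : Nonempty (X ≃SL[s] Y) := by
  obtain ⟨f, hf⟩ := exists_dual_eq_one hx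
  refine ⟨ContinuousLinearEquiv.ofNormEq (k := ‖y‖ / ‖x‖)
    { toFun := fun x' => s (f x') • y
      map_add' := fun a b => by simp [add_smul]
      map_smul' := fun c a => by simp [mul_smul] }
    (div_pos (norm_pos_iff.2 hy) (norm_pos_iff.2 hx)) (fun x' => ?_) (fun y' => ?_)⟩
  · obtain ⟨c, rfl⟩ := hX x'
    have := norm_pos_iff.2 hx
    simp only [LinearMap.coe_mk, AddHom.coe_mk, map_smul, hf, smul_eq_mul, mul_one, norm_smul, hs]
    field_simp
  · obtain ⟨c, rfl⟩ := hY y'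
    exact ⟨s c • x, by simp [hf, RingHomInvPair.comp_apply_eq₂ (σ := s) (σ' := s)]⟩

variable {A : Subalgebra ℂ (X →L[ℂ] X)} {B : Subalgebra ℂ (Y →L[ℂ] Y)}

theorem exists_equiv_of_one_dim [Nontrivial X] [Nontrivial Y]
    {L : A →ₗᵢ[ℝ] B} {x : X} (hx : x ≠ 0) (hX : ∀ x', ∃ c : ℂ, x' = c • x) {y : Y}
    (hy : y ≠ 0) (hY : ∀ y', ∃ c : ℂ, y' = c • y) :
    (∃ U : X ≃L[ℂ] Y, ∀ a, ∀ y, (L a : Y →L[ℂ] Y) y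
      = (L 1 : Y →L[ℂ] Y) (U ((a : X →L[ℂ] X) (U.symm y)))) ∨
    (∃ U : X ≃SL[starRingEnd ℂ] Y, ∀ a, ∀ y, (L a : Y →L[ℂ] Y) y
      = (L 1 : Y →L[ℂ] Y) (U ((a : X →L[ℂ] X) (U.symm y)))) := by
  have hscalX : ∀ a : X →L[ℂ] X, ∃ c : ℂ, ∀ v, a v = c • v := fun a => by
    obtain ⟨c, hc⟩ := hX (a x)
    refine ⟨c, fun v => ?_⟩
    obtain ⟨d, rfl⟩ := hX v
    rw [map_smul, hc, smul_comm]
  obtain ⟨g, hg⟩ := exists_dual_eq_one hy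
  let ℓ : ℂ →ₗ[ℝ] ℂ :=
    { toFun := fun z => g ((L (z • 1) : Y →L[ℂ] Y) y)
      map_add' := fun a b => by simp [add_smul]
      map_smul' := fun t z => by
        rw [smul_assoc, map_smul]
        exact ContinuousLinearMap.map_smul_of_tower g t _ }
  have hℓ : ∀ z w, (L (z • 1) : Y →L[ℂ] Y) w = ℓ z • w := fun z w => by
    obtain ⟨c, hc⟩ := hY ((L (z • 1) : Y →L[ℂ] Y) y)
    obtain ⟨d, rfl⟩ := hY w
    change _ = g ((L (z • 1) : Y →L[ℂ] Y) y) • d • y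
    rw [map_smul, hc, map_smul, hg, smul_comm, smul_eq_mul, mul_one]
  have hnorm : ∀ z, ‖ℓ z‖ = ‖z‖ := fun z => by
    have h1 : (L (z • 1) : Y →L[ℂ] Y) = ℓ z • 1 := by ext w; simp [hℓ]
    have h2 : ‖(L (z • 1) : Y →L[ℂ] Y)‖ = ‖(z • 1 : X →L[ℂ] X)‖ := L.norm_map _
    rwa [h1, norm_smul, norm_smul, norm_one, norm_one, mul_one, mul_one] at h2
  have main : ∀ (s : ℂ →+* ℂ) [RingHomInvPair s s], (∀ z, ‖s z‖ = ‖z‖) →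
      (∀ z, ℓ z = ℓ 1 * s z) → ∃ U : X ≃SL[s] Y, ∀ a, ∀ y, (L a : Y →L[ℂ] Y) y
      = (L 1 : Y →L[ℂ] Y) (U ((a : X →L[ℂ] X) (U.symm y))) := by
    intro s _ hs h
    obtain ⟨U⟩ := nonempty_equiv_of_forall_eq_smul hs hx hX hy hY
    refine ⟨U, fun a w => ?_⟩
    obtain ⟨c, hc⟩ := hscalX a
    have ha : a = c • 1 := by ext v; simp [hc]
    have h1 := hℓ 1 (s c • w)
    rw [one_smul] at h1
    rw [hc, map_smulₛₗ, U.apply_symm_apply, h1, ha, hℓ, h, mul_smul]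
  let ℓ' : ℂ ≃ₗᵢ[ℝ] ℂ := LinearIsometry.toLinearIsometryEquiv ⟨ℓ, hnorm⟩ rfl
  have hℓ' : ∀ z, ℓ' z = ℓ z := fun z => rfl
  obtain ⟨c, h | h⟩ := linear_isometry_complex ℓ'
  · refine .inl (main (RingHom.id ℂ) (fun z => rfl) fun z => ?_)
    rw [← hℓ', ← hℓ', h]
    simp
  · refine .inr (main (starRingEnd ℂ) Complex.norm_conj fun z => ?_)
    rw [← hℓ', ← hℓ', h]
    simp

end Line

section Groups

variable {X Y : Type*} [NormedAddCommGroup X] [NormedSpace ℂ X] [NormedAddCommGroup Y]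
  [NormedSpace ℂ Y] {A : Subalgebra ℂ (X →L[ℂ] X)} {B : Subalgebra ℂ (Y →L[ℂ] Y)}
  {S : Set A} {S' : Set B}

theorem exists_equiv_of_isometry [Nontrivial X] (hA : ContainsFiniteRank A)
    (hB : ContainsFiniteRank B) (hS : IsOpenUnitGroup S) (hS' : IsOpenUnitGroup S') {T : A → B}
    (hmaps : MapsTo T S S') (hsurj : SurjOn T S S')
    (hiso : ∀ a ∈ S, ∀ b ∈ S, ‖T a - T b‖ = ‖a - b‖) :
    (∃ U : X ≃L[ℂ] Y, ∀ a ∈ S, ∀ y, (T a : Y →L[ℂ] Y) y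
      = (T 1 : Y →L[ℂ] Y) (U ((a : X →L[ℂ] X) (U.symm y)))) ∨
    (∃ U : X ≃SL[starRingEnd ℂ] Y, ∀ a ∈ S, ∀ y, (T a : Y →L[ℂ] Y) y
      = (T 1 : Y →L[ℂ] Y) (U ((a : X →L[ℂ] X) (U.symm y)))) ∨
    (∃ V : (X →L[ℂ] ℂ) ≃L[ℂ] Y, ∀ a ∈ S, ∀ y, (T a : Y →L[ℂ] Y) y
      = (T 1 : Y →L[ℂ] Y) (V ((V.symm y).comp (a : X →L[ℂ] X)))) ∨
    (∃ V : (X →L[ℂ] ℂ) ≃SL[starRingEnd ℂ] Y, ∀ a ∈ S, ∀ y, (T a : Y →L[ℂ] Y) y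
      = (T 1 : Y →L[ℂ] Y) (V ((V.symm y).comp (a : X →L[ℂ] X)))) := by
  have : NormOneClass A := ⟨norm_one (α := X →L[ℂ] X)⟩
  obtain ⟨L, u, hLs, hT⟩ := hS.exists_affine hS' hmaps hsurj hiso
  obtain rfl : u = 0 := eq_zero_of_forall_one_add_mul_mem hB hS'
    (hS.one_add_mul_mem hS' hmaps hsurj hT)
  simp only [add_zero] at hT
  have hLS : ∀ a, L a ∈ S' ↔ a ∈ S := fun a => by
    refine ⟨fun h => ?_, fun h => hT a h ▸ hmaps h⟩
    obtain ⟨b, hb, hab⟩ := hsurj h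
    rw [hT b hb] at hab
    rwa [← L.injective hab]
  suffices h : (∃ U : X ≃L[ℂ] Y, ∀ a ∈ S, ∀ y, (L a : Y →L[ℂ] Y) y
      = (L 1 : Y →L[ℂ] Y) (U ((a : X →L[ℂ] X) (U.symm y)))) ∨
    (∃ U : X ≃SL[starRingEnd ℂ] Y, ∀ a ∈ S, ∀ y, (L a : Y →L[ℂ] Y) y
      = (L 1 : Y →L[ℂ] Y) (U ((a : X →L[ℂ] X) (U.symm y)))) ∨
    (∃ V : (X →L[ℂ] ℂ) ≃L[ℂ] Y, ∀ a ∈ S, ∀ y, (L a : Y →L[ℂ] Y) y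
      = (L 1 : Y →L[ℂ] Y) (V ((V.symm y).comp (a : X →L[ℂ] X)))) ∨
    (∃ V : (X →L[ℂ] ℂ) ≃SL[starRingEnd ℂ] Y, ∀ a ∈ S, ∀ y, (L a : Y →L[ℂ] Y) y
      = (L 1 : Y →L[ℂ] Y) (V ((V.symm y).comp (a : X →L[ℂ] X)))) by
    have h1 := hT 1 hS.one_mem
    refine h.imp ?_ (Or.imp ?_ (Or.imp ?_ ?_)) <;>
    · rintro ⟨W, hW⟩
      exact ⟨W, fun a ha y => by rw [hT a ha, h1, hW a ha]⟩
  by_cases hX : ∀ x : X, x ≠ 0 → ∃ x' ≠ 0, lineThrough x' ≠ lineThrough x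
  · exact exists_equiv_of_two_le hA hB hS hS' hLs hLS hX
  push Not at hX
  obtain ⟨x, hx, hX⟩ := hX
  have hX' : ∀ x', ∃ c : ℂ, x' = c • x := fun x' => by
    rcases eq_or_ne x' 0 with rfl | h
    · exact ⟨0, by simp⟩
    · obtain ⟨c, -, hc⟩ := lineThrough_eq_iff.1 (hX x' h).symm
      exact ⟨c, hc⟩
  obtain ⟨f, hf⟩ := exists_dual_eq_one hx
  obtain ⟨r, hr⟩ := hLs 1
  obtain ⟨y, g, hyg⟩ := (exists_eq_rankOne_iff_map hA hB hS hS' (L := L.toLinearMap) hLs hLS r).1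
    ⟨(r : X →L[ℂ] X) x, f, by
      ext v
      obtain ⟨c, rfl⟩ := hX' v
      simp [hf]⟩
  have hY : ∀ y', ∃ c : ℂ, y' = c • y := fun y' => by
    refine ⟨g y', ?_⟩
    have := congrArg (fun b : B => (b : Y →L[ℂ] Y) y') (hr.symm.trans hyg)
    simpa using this
  have hy : y ≠ 0 := by
    rintro rfl
    have h0 : L r = 0 := hyg.trans (by simp)
    have h1 : (0 : B) = 1 := h0.symm.trans hr
    have h2 : L 1 = 0 := by rw [← mul_one (L 1), ← h1, mul_zero]
    have := L.injective (h2.trans L.map_zero.symm)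
    exact one_ne_zero this
  have : Nontrivial Y := nontrivial_of_ne y 0 hy
  rcases exists_equiv_of_one_dim (L := L) hx hX' hy hY with ⟨U, hU⟩ | ⟨U, hU⟩
  · exact .inl ⟨U, fun a _ => hU a⟩
  · exact .inr (.inl ⟨U, fun a _ => hU a⟩)

theorem IsOpenUnitGroup.preimage_val {S : Set (X →L[ℂ] X)}
    (hSA : S ⊆ (A : Set (X →L[ℂ] X))) (hone : (1 : X →L[ℂ] X) ∈ S)
    (hmul : ∀ a ∈ S, ∀ b ∈ S, a * b ∈ S) (hinv : ∀ a ∈ S, ∃ b ∈ S, a * b = 1 ∧ b * a = 1)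
    (hopen : ∃ V : Set (X →L[ℂ] X), IsOpen V ∧ S = V ∩ (A : Set (X →L[ℂ] X))) :
    IsOpenUnitGroup {a : A | (a : X →L[ℂ] X) ∈ S} where
  isOpen := by
    obtain ⟨V, hV, rfl⟩ := hopen
    have h : {a : A | (a : X →L[ℂ] X) ∈ V ∩ A} = Subtype.val ⁻¹' V :=
      Set.ext fun a => and_iff_left a.2
    rw [h]
    exact hV.preimage continuous_subtype_val
  one_mem := hone
  mul_mem a ha b hb := hmul a ha b hb
  exists_inv a ha := by
    obtain ⟨b, hb, hab, hba⟩ := hinv a ha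
    exact ⟨⟨b, hSA hb⟩, hb, Subtype.ext hab, Subtype.ext hba⟩

end Groups

end Auxiliary


/-- Corollary 5.4 (standard operator algebras): let `A ⊆ ℬ(𝒳)` and `B ⊆ ℬ(𝒴)`
be unital closed subalgebras containing all finite-rank operators, and let `T`
be a surjective isometry from an open subgroup `𝔄` of `A⁻¹` onto an open
subgroup `𝔅` of `B⁻¹`.  Then `T a = T(1) ∘ U ∘ a ∘ U⁻¹` for an invertible
bounded linear or conjugate-linear `U : 𝒳 → 𝒴`, or
`T a = T(1) ∘ V ∘ a* ∘ V⁻¹` for an invertible bounded linear or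
conjugate-linear `V : 𝒳* → 𝒴`, where `a*` is the Banach-space adjoint.  In
particular, if `T 1 = 1` then `T` is multiplicative or anti-multiplicative. -/
theorem isometry_standard_operator_algebras
    {X Y : Type*} [NormedAddCommGroup X] [NormedSpace ℂ X] [CompleteSpace X]
    [NormedAddCommGroup Y] [NormedSpace ℂ Y] [CompleteSpace Y]
    (A : Subalgebra ℂ (X →L[ℂ] X)) (B : Subalgebra ℂ (Y →L[ℂ] Y))
    (hAclosed : IsClosed (A : Set (X →L[ℂ] X)))
    (hBclosed : IsClosed (B : Set (Y →L[ℂ] Y)))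
    (hAfin : ∀ f : X →L[ℂ] X,
      FiniteDimensional ℂ (LinearMap.range (f : X →ₗ[ℂ] X)) → f ∈ A)
    (hBfin : ∀ g : Y →L[ℂ] Y,
      FiniteDimensional ℂ (LinearMap.range (g : Y →ₗ[ℂ] Y)) → g ∈ B)
    (𝔄 : Set (X →L[ℂ] X)) (𝔅 : Set (Y →L[ℂ] Y))
    (h𝔄A : 𝔄 ⊆ (A : Set (X →L[ℂ] X))) (h𝔅B : 𝔅 ⊆ (B : Set (Y →L[ℂ] Y)))
    (h𝔄one : (1 : X →L[ℂ] X) ∈ 𝔄) (h𝔅one : (1 : Y →L[ℂ] Y) ∈ 𝔅)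
    (h𝔄mul : ∀ a ∈ 𝔄, ∀ b ∈ 𝔄, a * b ∈ 𝔄)
    (h𝔅mul : ∀ a ∈ 𝔅, ∀ b ∈ 𝔅, a * b ∈ 𝔅)
    (h𝔄inv : ∀ a ∈ 𝔄, ∃ b ∈ 𝔄, a * b = 1 ∧ b * a = 1)
    (h𝔅inv : ∀ b ∈ 𝔅, ∃ c ∈ 𝔅, b * c = 1 ∧ c * b = 1)
    (h𝔄open : ∃ V : Set (X →L[ℂ] X), IsOpen V ∧ 𝔄 = V ∩ (A : Set (X →L[ℂ] X)))
    (h𝔅open : ∃ W : Set (Y →L[ℂ] Y), IsOpen W ∧ 𝔅 = W ∩ (B : Set (Y →L[ℂ] Y)))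
    (T : (X →L[ℂ] X) → (Y →L[ℂ] Y))
    (hmaps : Set.MapsTo T 𝔄 𝔅) (hsurj : Set.SurjOn T 𝔄 𝔅)
    (hiso : ∀ a ∈ 𝔄, ∀ b ∈ 𝔄, ‖T a - T b‖ = ‖a - b‖) :
    ((∃ U : X ≃L[ℂ] Y, ∀ a ∈ 𝔄, ∀ y : Y, T a y = T 1 (U (a (U.symm y)))) ∨
     (∃ U : X ≃SL[starRingEnd ℂ] Y,
        ∀ a ∈ 𝔄, ∀ y : Y, T a y = T 1 (U (a (U.symm y)))) ∨
     (∃ V : (X →L[ℂ] ℂ) ≃L[ℂ] Y,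
        ∀ a ∈ 𝔄, ∀ y : Y, T a y = T 1 (V ((V.symm y).comp a))) ∨
     (∃ V : (X →L[ℂ] ℂ) ≃SL[starRingEnd ℂ] Y,
        ∀ a ∈ 𝔄, ∀ y : Y, T a y = T 1 (V ((V.symm y).comp a)))) ∧
    (T 1 = 1 →
      (∀ a ∈ 𝔄, ∀ b ∈ 𝔄, T (a * b) = T a * T b) ∨
      (∀ a ∈ 𝔄, ∀ b ∈ 𝔄, T (a * b) = T b * T a)) := by
  classical
  have hS := IsOpenUnitGroup.preimage_val h𝔄A h𝔄one h𝔄mul h𝔄inv h𝔄open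
  have hS' := IsOpenUnitGroup.preimage_val h𝔅B h𝔅one h𝔅mul h𝔅inv h𝔅open
  refine (and_iff_left_of_imp fun h hT1 => ?_).2 ?_
  · rcases h with ⟨U, hU⟩ | ⟨U, hU⟩ | ⟨V, hV⟩ | ⟨V, hV⟩
    · refine .inl fun a ha b hb => ContinuousLinearMap.ext fun y => ?_
      simp [hU _ ha, hU _ hb, hU _ (h𝔄mul a ha b hb), hT1]
    · refine .inl fun a ha b hb => ContinuousLinearMap.ext fun y => ?_
      simp [hU _ ha, hU _ hb, hU _ (h𝔄mul a ha b hb), hT1]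
    · refine .inr fun a ha b hb => ContinuousLinearMap.ext fun y => ?_
      simp [hV _ ha, hV _ hb, hV _ (h𝔄mul a ha b hb), hT1]
      rfl
    · refine .inr fun a ha b hb => ContinuousLinearMap.ext fun y => ?_
      simp [hV _ ha, hV _ hb, hV _ (h𝔄mul a ha b hb), hT1]
      rfl
  rcases subsingleton_or_nontrivial X with hX | hX
  · have hY : Subsingleton Y := by
      have h2 := hS'.smul_mem (z := 2) two_ne_zero hS'.one_mem
      obtain ⟨a, -, ha⟩ := hsurj h2
      obtain ⟨b, -, hb⟩ := hsurj h𝔅one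
      refine subsingleton_of_forall_eq 0 fun y => ?_
      have h : (2 : ℂ) • y = y := by
        have h3 : T a y = T b y := by rw [Subsingleton.elim a b]
        rw [ha, hb] at h3
        simpa using h3
      rw [two_smul] at h
      simpa using h
    let U : X ≃L[ℂ] Y := ContinuousLinearEquiv.equivOfInverse 0 0
      (fun _ => Subsingleton.elim _ _) (fun _ => Subsingleton.elim _ _)
    exact .inl ⟨U, fun a _ y => Subsingleton.elim _ _⟩
  let T' : A → B := fun a => if h : T a ∈ B then ⟨T a, h⟩ else 0
  have hT' : ∀ a : A, (a : X →L[ℂ] X) ∈ 𝔄 → (T' a : Y →L[ℂ] Y) = T a := fun a ha => by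
    simp only [T', dif_pos (show T a ∈ B from h𝔅B (hmaps ha))]
  have h1 := hT' 1 h𝔄one
  rw [OneMemClass.coe_one] at h1
  refine (exists_equiv_of_isometry (T := T') hAfin hBfin hS hS' (fun a ha => ?_) ?_ ?_).imp ?_
    (Or.imp ?_ (Or.imp ?_ ?_))
  · change (T' a : Y →L[ℂ] Y) ∈ 𝔅
    rw [hT' a ha]
    exact hmaps ha
  · intro b hb
    obtain ⟨a, ha, hab⟩ := hsurj hb
    exact ⟨⟨a, h𝔄A ha⟩, ha, Subtype.ext ((hT' ⟨a, h𝔄A ha⟩ ha).trans hab)⟩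
  · intro a ha b hb
    change ‖(T' a : Y →L[ℂ] Y) - T' b‖ = ‖(a : X →L[ℂ] X) - b‖
    rw [hT' a ha, hT' b hb]
    exact hiso a ha b hb
  all_goals
    rintro ⟨W, hW⟩
    refine ⟨W, fun a ha y => ?_⟩
    have := hW ⟨a, h𝔄A ha⟩ ha y
    rwa [hT' _ ha, h1] at this
end

section
/- Let n be a positive integer and let ‖·‖ and ‖·‖′ be any two matrix norms (submultiplicative norms) on Mₙ(ℂ). Let S be a surjection from an open subgroup 𝔄 of the group GLₙ(ℂ) of invertible n × n complex matrices onto an open subgroup 𝔅 of GLₙ(ℂ) such that ‖S(M) − S(N)‖′ = ‖M − N‖ for all M, N ∈ 𝔄. Then there exists an invertible matrix U ∈ Mₙ(ℂ) such that one of the following holds for all M ∈ 𝔄: S(M) = S(E)·U M U⁻¹, or S(M) = S(E)·U Mᵗ U⁻¹, or S(M) = S(E)·U M̄ U⁻¹, or S(M) = S(E)·U M̄ᵗ U⁻¹, where E is the identity matrix, Mᵗ the transpose, and M̄ the entrywise complex conjugate. In particular, if S(E) = E then S is multiplicative or anti-multiplicative. -/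
open Matrix

/-- A surjective isometry between dense subsets of complete real normed spaces is the restriction
of an affine bijection, by completion and the Mazur-Ulam theorem. -/
theorem exists_linearEquiv_of_isometry_on_dense {V W : Type*} [NormedAddCommGroup V]
    [NormedSpace ℝ V] [CompleteSpace V] [NormedAddCommGroup W] [NormedSpace ℝ W] [CompleteSpace W]
    {s : Set V} {t : Set W} (hs : Dense s) (ht : Dense t) (f : V → W)
    (hsurj : Set.SurjOn f s t) (hf : ∀ x ∈ s, ∀ y ∈ s, ‖f x - f y‖ = ‖x - y‖) :
    ∃ (T : V ≃ₗ[ℝ] W) (c : W), (∀ x, ‖T x‖ = ‖x‖) ∧ ∀ x ∈ s, f x = T x + c := by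
  have hiso : Isometry (fun x : s => f x) := Isometry.of_dist_eq fun x y => by
    simpa [dist_eq_norm, Subtype.dist_eq] using hf x x.2 y y.2
  set g := hs.extend (fun x : s => f x)
  have hgc : Continuous g := (hs.uniformContinuous_extend hiso.uniformContinuous).continuous
  have hgs : ∀ x : s, g x = f x := hs.extend_of_ind hiso.uniformContinuous
  have hgiso : Isometry g := by
    refine Isometry.of_dist_eq fun x y => ?_
    refine isClosed_property2 (p := fun x y => dist (g x) (g y) = dist x y)
      hs.denseRange_val ?_ ?_ x y
    · exact isClosed_eq (by fun_prop) (by fun_prop)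
    · intro a b
      rw [hgs, hgs]
      exact hiso.dist_eq a b
  have hgsurj : Function.Surjective g := by
    rw [← Set.range_eq_univ, ← hgiso.isClosedEmbedding.isClosed_range.closure_eq]
    refine Dense.closure_eq (ht.mono fun y hy => ?_)
    obtain ⟨x, hx, rfl⟩ := hsurj hy
    exact ⟨x, hgs ⟨x, hx⟩⟩
  let A := (IsometryEquiv.mk' g (Function.surjInv hgsurj) (Function.surjInv_eq hgsurj)
    hgiso).toRealAffineIsometryEquiv
  have hA : ∀ x, A x = g x := fun x => rfl
  refine ⟨A.linearIsometryEquiv.toLinearEquiv, g 0, A.linearIsometryEquiv.norm_map, ?_⟩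
  intro x hx
  have := A.map_vadd 0 x
  simp only [vadd_eq_add, add_zero, hA] at this
  rw [← hgs ⟨x, hx⟩]
  exact this

theorem Matrix.finite_setOf_not_isUnit_add_smul {n : Type*} [Fintype n] [DecidableEq n]
    (A : Matrix n n ℂ) : {z : ℂ | ¬ IsUnit (A + z • (1 : Matrix n n ℂ))}.Finite := by
  refine ((Matrix.finite_spectrum A).image Neg.neg).subset fun z hz => ⟨-z, ?_, neg_neg z⟩
  rw [spectrum.mem_iff, ← IsUnit.neg_iff]
  convert! hz using 2
  simp [Algebra.algebraMap_eq_smul_one]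

theorem Matrix.countable_setOf_not_isUnit_one_add_smul {n : Type*} [Fintype n] [DecidableEq n]
    (A : Matrix n n ℂ) : {z : ℂ | ¬ IsUnit (1 + z • A)}.Countable := by
  refine ((A.finite_setOf_not_isUnit_add_smul).image Inv.inv).countable.mono fun z hz => ?_
  refine ⟨z⁻¹, fun h => hz ?_, inv_inv z⟩
  rcases eq_or_ne z 0 with rfl | h0
  · simp
  · convert! (isUnit_smul_iff (Units.mk0 z h0) _).2 h using 1
    simp [Units.smul_def, smul_smul, h0, add_comm]

/-- `GLₙ(ℂ)` is connected, hence has no proper open subgroup. -/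
theorem Matrix.mem_of_isOpen_of_isUnit {n : Type*} [Fintype n] [DecidableEq n]
    {G : Set (Matrix n n ℂ)} (hunit : ∀ M ∈ G, IsUnit M) (hone : 1 ∈ G)
    (hmul : ∀ M ∈ G, ∀ P ∈ G, M * P ∈ G) (hinv : ∀ M ∈ G, M⁻¹ ∈ G) (hopen : IsOpen G)
    {M : Matrix n n ℂ} (hM : IsUnit M) : M ∈ G := by
  set p : ℂ → Matrix n n ℂ := fun z => 1 + z • (M - 1) with hp
  have hpc : Continuous p := by fun_prop
  have hconn : IsPreconnected {z : ℂ | ¬ IsUnit (p z)}ᶜ :=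
    ((countable_setOf_not_isUnit_one_add_smul (M - 1)).isPathConnected_compl_of_one_lt_rank
      (by simp)).isConnected.isPreconnected
  have hH : IsOpen {P : Matrix n n ℂ | IsUnit P ∧ P ∉ G} := by
    have : {P : Matrix n n ℂ | IsUnit P ∧ P ∉ G} =
        ⋃ Q ∈ {P : Matrix n n ℂ | IsUnit P ∧ P ∉ G}, {P | Q⁻¹ * P ∈ G} := by
      ext P
      simp only [Set.mem_ofPred_eq, Set.mem_iUnion, exists_prop]
      constructor
      · intro h
        refine ⟨P, h, ?_⟩
        rwa [nonsing_inv_mul _ ((isUnit_iff_isUnit_det _).1 h.1)]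
      · rintro ⟨Q, ⟨hQ, hQG⟩, hP⟩
        have hPQ : P = Q * (Q⁻¹ * P) := by
          rw [mul_nonsing_inv_cancel_left _ _ ((isUnit_iff_isUnit_det _).1 hQ)]
        refine ⟨hPQ ▸ hQ.mul (hunit _ hP), fun h => hQG ?_⟩
        have : Q = P * (Q⁻¹ * P)⁻¹ := by
          rw [Matrix.mul_inv_rev, nonsing_inv_nonsing_inv _ ((isUnit_iff_isUnit_det _).1 hQ),
            mul_nonsing_inv_cancel_left _ _ ((isUnit_iff_isUnit_det _).1 (hunit _ h))]
        rw [this]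
        exact hmul _ h _ (hinv _ hP)
    rw [this]
    exact isOpen_biUnion fun Q _ => hopen.preimage (by fun_prop)
  have hsub := IsPreconnected.subset_left_of_subset_union (hopen.preimage hpc)
    (hH.preimage hpc) (Set.disjoint_left.2 fun z h1 h2 => h2.2 h1)
    (fun z hz => by
      by_cases h : p z ∈ G
      · exact Or.inl h
      · exact Or.inr ⟨by simpa using hz, h⟩)
    ⟨0, by simp [hp], by simpa [hp] using hone⟩ hconn
  have := @hsub 1 (by simpa [hp] using hM)
  simpa [hp] using this

theorem Matrix.exists_eq_mul_diagonal_mul {n K : Type*} [Fintype n] [DecidableEq n] [Field K]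
    (A : Matrix n n K) : ∃ (P Q : Matrix n n K) (d : n → K), IsUnit P ∧ IsUnit Q ∧
      A = P * diagonal d * Q := by
  obtain ⟨L, L', d, h⟩ := Pivot.exists_list_transvec_mul_diagonal_mul_list_transvec A
  refine ⟨_, _, d, ?_, ?_, h⟩ <;>
  simp [isUnit_iff_isUnit_det, TransvectionStruct.det_toMatrix_prod]

theorem Matrix.isUnit_mul_diagonal_mul {n K : Type*} [Fintype n] [DecidableEq n] [Field K]
    {P Q : Matrix n n K} (hP : IsUnit P) (hQ : IsUnit Q) (d : n → K) :
    IsUnit (P * diagonal d * Q) ↔ ∀ i, d i ≠ 0 := by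
  rw [hQ.mul_right_iff, hP.mul_left_iff, isUnit_diagonal, Pi.isUnit_iff]
  simp [isUnit_iff_ne_zero]

theorem Matrix.eq_zero_of_forall_not_isUnit_add {n K : Type*} [Fintype n] [DecidableEq n]
    [Field K] {C : Matrix n n K} (h : ∀ X : Matrix n n K, ¬ IsUnit X → ¬ IsUnit (X + C)) :
    C = 0 := by
  obtain ⟨P, Q, d, hP, hQ, rfl⟩ := C.exists_eq_mul_diagonal_mul
  classical
  have h1 : IsUnit (P * diagonal (fun i => if d i = 0 then (1 : K) else 0) * Q) := by
    by_contra hX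
    refine h _ hX ?_
    rw [← add_mul, ← mul_add, diagonal_add, isUnit_mul_diagonal_mul hP hQ]
    intro i
    by_cases hi : d i = 0 <;> simp [hi]
  rw [isUnit_mul_diagonal_mul hP hQ] at h1
  have : d = 0 := funext fun i => by simpa using h1 i
  simp [this]

/-- An affine bijection that preserves invertibility in both directions is linear. -/
theorem Matrix.translation_eq_zero {n K : Type*} [Fintype n] [DecidableEq n] [Field K]
    [Algebra ℝ K]
    (T : Matrix n n K ≃ₗ[ℝ] Matrix n n K) (C : Matrix n n K)
    (h : ∀ X, IsUnit (T X + C) ↔ IsUnit X) : C = 0 := by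
  refine eq_zero_of_forall_not_isUnit_add fun X hX hXC => hX ?_
  have hhalf : ∀ Y : Matrix n n K, IsUnit ((2⁻¹ : ℝ) • Y) ↔ IsUnit Y :=
    fun Y => isUnit_smul_iff (Units.mk0 (2⁻¹ : ℝ) (by norm_num)) Y
  have hT : T ((2⁻¹ : ℝ) • T.symm (X - C)) + C = (2⁻¹ : ℝ) • (X + C) := by
    rw [map_smul, T.apply_symm_apply]
    module
  rw [← hhalf, ← hT, h, hhalf, ← h, T.apply_symm_apply, sub_add_cancel] at hXC
  exact hXC

/-- Matrices of rank at most one are those `A` for which every real pencil `B + t A` with `B`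
invertible has at most one singular member. -/
theorem Matrix.exists_eq_vecMulVec_iff {n : Type*} [Fintype n] [DecidableEq n]
    (A : Matrix n n ℂ) : (∃ x y, A = vecMulVec x y) ↔
      ∀ B : Matrix n n ℂ, IsUnit B → ∀ s t : ℝ, ¬ IsUnit (B + s • A) → ¬ IsUnit (B + t • A) →
        s = t := by
  constructor
  · rintro ⟨x, y, rfl⟩ B hB s t hs ht
    have key : ∀ r : ℝ, ¬ IsUnit (B + r • vecMulVec x y) → 1 + (r : ℂ) * (y ⬝ᵥ B⁻¹ *ᵥ x) = 0 := by
      intro r hr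
      rw [isUnit_iff_isUnit_det] at hr hB
      have : r • vecMulVec x y = replicateCol Unit ((r : ℂ) • x) * replicateRow Unit y := by
        rw [← vecMulVec_eq]; ext; simp [vecMulVec_apply, mul_assoc]
      rw [this, det_add_replicateCol_mul_replicateRow hB, hB.mul_left_iff, isUnit_iff_ne_zero,
        not_not] at hr
      convert! hr using 1
      simp [det_unique, Matrix.mul_apply, dotProduct, mulVec, Finset.mul_sum, Finset.sum_mul]
      rw [Finset.sum_comm]
      refine Finset.sum_congr rfl fun i _ => Finset.sum_congr rfl fun j _ => by ring
    have h1 := key s hs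
    have h2 := key t ht
    have h3 : ((s : ℂ) - t) * (y ⬝ᵥ B⁻¹ *ᵥ x) = 0 := by linear_combination h1 - h2
    rcases mul_eq_zero.1 h3 with h | h
    · exact_mod_cast sub_eq_zero.1 h
    · simp [h] at h1
  · intro h
    obtain ⟨P, Q, d, hP, hQ, rfl⟩ := A.exists_eq_mul_diagonal_mul
    have hd : ∀ i j, d i ≠ 0 → d j ≠ 0 → i = j := by
      intro i j hi hj
      by_contra hij
      let b : n → ℂ := fun k => if d k = 0 then 1 else if k = i then -d k else - (2 * d k)
      have hb : IsUnit (P * diagonal b * Q) := by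
        rw [isUnit_mul_diagonal_mul hP hQ]
        intro k
        simp only [b]
        split_ifs with hk hki
        · exact one_ne_zero
        · exact neg_ne_zero.2 hk
        · exact neg_ne_zero.2 (mul_ne_zero two_ne_zero hk)
      have hr : ∀ r : ℝ, P * diagonal b * Q + r • (P * diagonal d * Q) =
          P * diagonal (fun k => b k + r * d k) * Q := by
        intro r
        have : diagonal (fun k => b k + r * d k) = diagonal b + r • diagonal d := by
          ext k l; by_cases hkl : k = l <;> simp [hkl]
        simp [this, mul_add, add_mul]
      have := h _ hb 1 2
        (by rw [hr, isUnit_mul_diagonal_mul hP hQ]; push Not; exact ⟨i, by simp [b, hi]⟩)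
        (by rw [hr, isUnit_mul_diagonal_mul hP hQ]; push Not
            exact ⟨j, by simp [b, hj, Ne.symm hij]⟩)
      norm_num at this
    by_cases h0 : d = 0
    · exact ⟨0, 0, by simp [h0]⟩
    · obtain ⟨i, hi⟩ := Function.ne_iff.1 h0
      refine ⟨P *ᵥ Pi.single i (d i), Pi.single i 1 ᵥ* Q, ?_⟩
      rw [← vecMulVec_mul, ← mul_vecMulVec]
      congr 2
      ext k l
      by_cases hk : k = i
      · subst hk; by_cases hl : k = l <;> simp [vecMulVec_apply, hl, eq_comm]
      · have : d k = 0 := by_contra fun hk' => hk (hd _ _ hk' hi)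
        simp [vecMulVec_apply, hk, diagonal_apply, this]

theorem Complex.eq_id_or_eq_conj_of_sq_eq_neg_one (r : ℂ →ₗ[ℝ] ℂ) (h1 : r 1 = 1)
    (hI : r Complex.I ^ 2 = -1) : (∀ z, r z = z) ∨ ∀ z, r z = starRingEnd ℂ z := by
  have hr : ∀ z : ℂ, r z = z.re + z.im * r Complex.I := by
    intro z
    conv_lhs => rw [show z = z.re • (1 : ℂ) + z.im • Complex.I by
      simp [Complex.re_add_im]]
    rw [map_add, map_smul, map_smul, h1]
    simp
  have : (r Complex.I - Complex.I) * (r Complex.I + Complex.I) = 0 := by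
    linear_combination hI - Complex.I_sq
  rcases mul_eq_zero.1 this with h | h
  · refine Or.inl fun z => ?_
    rw [hr, sub_eq_zero.1 h, Complex.re_add_im]
  · refine Or.inr fun z => ?_
    rw [hr, eq_neg_of_add_eq_zero_left h, show starRingEnd ℂ z = z.re - z.im * Complex.I by
      apply Complex.ext <;> simp]
    ring

theorem Matrix.vecMulVec_minor {m n R : Type*} [CommSemiring R] {A : Matrix m n R}
    (hA : ∃ x y, A = vecMulVec x y) (i k : m) (j l : n) : A i j * A k l = A i l * A k j := by
  obtain ⟨x, y, rfl⟩ := hA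
  simp only [vecMulVec_apply]
  ring

/-- If `B` and `B + c E_ij` have rank at most one, then `B` is supported in row `i` and
column `j`. -/
theorem Matrix.apply_eq_zero_of_rank_one_add_single {n K : Type*} [DecidableEq n] [Field K]
    {B : Matrix n n K} {i j : n} {c : K} (hc : c ≠ 0) (hB : ∃ x y, B = vecMulVec x y)
    (hBc : ∃ x y, B + single i j c = vecMulVec x y) {a b : n} (ha : a ≠ i) (hb : b ≠ j) :
    B a b = 0 := by
  have h1 := vecMulVec_minor hB i a j b
  have h2 := vecMulVec_minor hBc i a j b
  simp only [add_apply, single_apply, ha.symm, hb.symm, and_false, false_and, and_self, if_true,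
    if_false, add_zero] at h2
  have : c * B a b = 0 := by linear_combination h2 - h1
  exact (mul_eq_zero.1 this).resolve_left hc

theorem Matrix.vecMulVec_single_single {m n R : Type*} [DecidableEq m] [DecidableEq n]
    [MulZeroClass R] (i : m) (j : n) (z w : R) :
    vecMulVec (Pi.single i z) (Pi.single j w) = single i j (z * w) := by
  ext a b
  simp only [vecMulVec_apply, single_apply, Pi.single_apply]
  split_ifs <;> simp_all

section RankOnePreserver

variable {n : Type*} [DecidableEq n]

/-- A real-linear map that sends matrices of rank at most one to such matrices and fixes the
diagonal matrix units. -/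
structure RankOnePreserver (L : Matrix n n ℂ →ₗ[ℝ] Matrix n n ℂ) : Prop where
  injective : Function.Injective L
  rank_one : ∀ x y, ∃ x' y', L (vecMulVec x y) = vecMulVec x' y'
  diag : ∀ i, L (single i i 1) = single i i 1

namespace RankOnePreserver

variable {L : Matrix n n ℂ →ₗ[ℝ] Matrix n n ℂ}

theorem comp_transpose (hL : RankOnePreserver L) :
    RankOnePreserver (L ∘ₗ (transposeLinearEquiv n n ℝ ℂ).toLinearMap) where
  injective := hL.injective.comp (transposeLinearEquiv n n ℝ ℂ).injective
  rank_one x y := by simpa [transpose_vecMulVec] using hL.rank_one y x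
  diag i := by simpa using hL.diag i

theorem map_row (hL : RankOnePreserver L) (i j k : n) (z w : ℂ) :
    ∃ x y, L (single i j z) + L (single i k w) = vecMulVec x y := by
  rw [← map_add]
  convert hL.rank_one (Pi.single i 1) (Pi.single j z + Pi.single k w) using 5
  simp [vecMulVec_add, vecMulVec_single_single]

theorem map_col (hL : RankOnePreserver L) (i j k : n) (z w : ℂ) :
    ∃ x y, L (single j i z) + L (single k i w) = vecMulVec x y := by
  rw [← map_add]
  convert hL.rank_one (Pi.single j z + Pi.single k w) (Pi.single i 1) using 5
  simp [add_vecMulVec, vecMulVec_single_single]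

theorem map_single (hL : RankOnePreserver L) (i j : n) (z : ℂ) :
    ∃ x y, L (single i j z) = vecMulVec x y := by
  simpa using hL.map_row i j j z 0

theorem map_single_apply_eq_zero (hL : RankOnePreserver L) {i j : n} (hij : i ≠ j) (z : ℂ)
    {a b : n} (h1 : ¬ (a = i ∧ b = j)) (h2 : ¬ (a = j ∧ b = i)) : L (single i j z) a b = 0 := by
  have hi := hL.map_row i j i z 1
  have hj := hL.map_col j i j z 1
  rw [hL.diag] at hi hj
  by_cases hai : a = i
  · exact apply_eq_zero_of_rank_one_add_single one_ne_zero (hL.map_single i j z) hj (by grind)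
      (by grind)
  · by_cases hbi : b = i
    · exact apply_eq_zero_of_rank_one_add_single one_ne_zero (hL.map_single i j z) hj (by grind)
        (by grind)
    · exact apply_eq_zero_of_rank_one_add_single one_ne_zero (hL.map_single i j z) hi hai hbi

theorem map_single_dichotomy (hL : RankOnePreserver L) {i j : n} (hij : i ≠ j) (z : ℂ) :
    L (single i j z) = single i j (L (single i j z) i j) ∨
      L (single i j z) = single j i (L (single i j z) j i) := by
  have hm := vecMulVec_minor (hL.map_single i j z) i j j i
  rw [hL.map_single_apply_eq_zero hij z (a := i) (b := i) (by grind) (by grind), zero_mul,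
    mul_eq_zero] at hm
  have key := fun a b => hL.map_single_apply_eq_zero hij z (a := a) (b := b)
  rcases hm with h | h
  · right
    ext a b
    rw [single_apply]
    grind
  · left
    ext a b
    rw [single_apply]
    grind

theorem map_single_ne_zero (hL : RankOnePreserver L) (i j : n) {z : ℂ} (hz : z ≠ 0) :
    L (single i j z) ≠ 0 := by
  rw [Ne, map_eq_zero_iff L hL.injective]
  exact fun h => hz (by simpa using congrFun₂ h i j)

theorem map_single_of_apply_ne_zero (hL : RankOnePreserver L) {i j : n} (hij : i ≠ j)
    (h : L (single i j 1) i j ≠ 0) (z : ℂ) :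
    L (single i j z) = single i j (L (single i j z) i j) := by
  refine (hL.map_single_dichotomy hij z).elim id fun hz => ?_
  by_cases hz0 : L (single i j z) j i = 0
  · rw [hz0, single_zero] at hz
    simp [hz]
  have hone := (hL.map_single_dichotomy hij 1).resolve_right fun h' => h (by
    rw [h', single_apply_of_ne _ _ _ _ _ (by grind)])
  have hzi : L (single i j z) i j = 0 := by rw [hz, single_apply_of_ne _ _ _ _ _ (by grind)]
  have honej : L (single i j 1) j i = 0 := by rw [hone, single_apply_of_ne _ _ _ _ _ (by grind)]
  have hsum := hL.map_single_dichotomy hij (1 + z)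
  rw [single_add, map_add] at hsum
  rcases hsum with h' | h'
  · have := congrFun₂ h' j i
    rw [single_apply_of_ne _ _ _ _ _ (by grind)] at this
    simp [honej, hz0] at this
  · have := congrFun₂ h' i j
    rw [single_apply_of_ne _ _ _ _ _ (by grind)] at this
    simp [hzi, h] at this

theorem exists_map_single_one (hL : RankOnePreserver L) {i j : n} (hij : i ≠ j) :
    ∃ c : ℂ, c ≠ 0 ∧ (L (single i j 1) = single i j c ∨ L (single i j 1) = single j i c) := by
  have h0 := hL.map_single_ne_zero i j one_ne_zero
  rcases hL.map_single_dichotomy hij 1 with h | h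
  · exact ⟨_, fun hc => h0 (by rw [h, hc, single_zero]), Or.inl h⟩
  · exact ⟨_, fun hc => h0 (by rw [h, hc, single_zero]), Or.inr h⟩

theorem apply_ne_zero_row (hL : RankOnePreserver L) {i j k : n} (hij : i ≠ j) (hik : i ≠ k)
    (h : L (single i j 1) i j ≠ 0) : L (single i k 1) i k ≠ 0 := by
  rcases eq_or_ne j k with rfl | hjk
  · exact h
  obtain ⟨c, hc, hc' | hc'⟩ := hL.exists_map_single_one hik
  · simpa [hc'] using hc
  · have := vecMulVec_minor (hL.map_row i j k 1 1) i k j i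
    rw [hL.map_single_of_apply_ne_zero hij h, hc'] at this
    simp [hij, hij.symm, hik, hik.symm, h, hc] at this

theorem apply_ne_zero_col (hL : RankOnePreserver L) {i j k : n} (hij : i ≠ j) (hkj : k ≠ j)
    (h : L (single i j 1) i j ≠ 0) : L (single k j 1) k j ≠ 0 := by
  rcases eq_or_ne i k with rfl | hik
  · exact h
  obtain ⟨c, hc, hc' | hc'⟩ := hL.exists_map_single_one hkj
  · simpa [hc'] using hc
  · have := vecMulVec_minor (hL.map_col j i k 1 1) i j j k
    rw [hL.map_single_of_apply_ne_zero hij h, hc'] at this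
    simp [hij, hij.symm, hkj, hkj.symm, h, hc] at this

theorem apply_ne_zero_symm (hL : RankOnePreserver L) {i j : n} (hij : i ≠ j)
    (h : L (single i j 1) i j ≠ 0) : L (single j i 1) j i ≠ 0 := by
  obtain ⟨c, hc, hc' | hc'⟩ := hL.exists_map_single_one hij.symm
  · simpa [hc'] using hc
  · have hs : vecMulVec (Pi.single i 1 + Pi.single j 1) (Pi.single i 1 + Pi.single j 1) =
        (single i i 1 + single j j 1 + single i j 1 + single j i 1 : Matrix n n ℂ) := by
      simp only [vecMulVec_add, add_vecMulVec, vecMulVec_single_single, mul_one]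
      abel
    have := vecMulVec_minor (hL.rank_one (Pi.single i 1 + Pi.single j 1)
      (Pi.single i 1 + Pi.single j 1)) i j i j
    rw [hs, map_add, map_add, map_add, hL.diag, hL.diag, hL.map_single_of_apply_ne_zero hij h,
      hc'] at this
    simp [hij, hij.symm] at this

theorem apply_ne_zero_of_apply_ne_zero (hL : RankOnePreserver L) {i j : n} (hij : i ≠ j)
    (h : L (single i j 1) i j ≠ 0) (a b : n) : L (single a b 1) a b ≠ 0 := by
  rcases eq_or_ne a b with rfl | hab
  · simp [hL.diag]
  rcases eq_or_ne b i with rfl | hbi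
  · exact hL.apply_ne_zero_col hij.symm hab (hL.apply_ne_zero_symm hij h)
  · exact hL.apply_ne_zero_col hbi.symm hab (hL.apply_ne_zero_row hij hbi.symm h)

theorem map_single_eq (hL : RankOnePreserver L) [Nontrivial n]
    (h : ∀ i j, L (single i j 1) i j ≠ 0) (i j : n) (z : ℂ) :
    L (single i j z) = single i j (L (single i j z) i j) := by
  rcases ne_or_eq i j with hij | rfl
  · exact hL.map_single_of_apply_ne_zero hij (h i j) z
  obtain ⟨j, hj⟩ := exists_ne i
  have hii := hL.map_row i i i z 1
  have hij := hL.map_row i i j z 1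
  have hji := hL.map_col i i j z 1
  rw [hL.diag] at hii
  rw [hL.map_single_of_apply_ne_zero hj.symm (h i j)] at hij
  rw [hL.map_single_of_apply_ne_zero hj (h j i)] at hji
  have key : ∀ a b, ¬ (i = a ∧ i = b) → L (single i i z) a b = 0 := by
    intro a b hab
    by_cases ha : a = i
    · exact apply_eq_zero_of_rank_one_add_single (h j i) (hL.map_single i i z) hji (by grind)
        (by grind)
    by_cases hb : b = i
    · exact apply_eq_zero_of_rank_one_add_single (h i j) (hL.map_single i i z) hij (by grind)
        (by grind)
    · exact apply_eq_zero_of_rank_one_add_single one_ne_zero (hL.map_single i i z) hii ha hb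
  ext a b
  rw [single_apply]
  split_ifs with hab
  · rw [← hab.1, ← hab.2]
  · exact key a b hab

variable [Fintype n]

theorem apply_eq (hL : RankOnePreserver L) [Nontrivial n]
    (h : ∀ i j, L (single i j 1) i j ≠ 0) (A : Matrix n n ℂ) (i j : n) :
    L A i j = L (single i j (A i j)) i j := by
  conv_lhs => rw [matrix_eq_sum_single A]
  simp_rw [map_sum, Matrix.sum_apply]
  rw [Finset.sum_eq_single i, Finset.sum_eq_single j]
  · intro b _ hb
    rw [hL.map_single_eq h, single_apply_of_ne _ _ _ _ _ (by grind)]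
  · simp
  · intro b _ hb
    refine Finset.sum_eq_zero fun c _ => ?_
    rw [hL.map_single_eq h, single_apply_of_ne _ _ _ _ _ (by grind)]
  · simp

theorem entry_minor (hL : RankOnePreserver L) [Nontrivial n]
    (h : ∀ i j, L (single i j 1) i j ≠ 0) (x y : n → ℂ) (i j k l : n) :
    L (single i j (x i * y j)) i j * L (single k l (x k * y l)) k l =
      L (single i l (x i * y l)) i l * L (single k j (x k * y j)) k j := by
  have := vecMulVec_minor (hL.rank_one x y) i k j l
  simpa only [hL.apply_eq h (vecMulVec x y), vecMulVec_apply] using this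

/-- A rank-one preserver that does not transpose the matrix units is, up to a diagonal
conjugation, the identity or the entrywise complex conjugation. -/
theorem exists_diagonal_conj (hL : RankOnePreserver L) [Nontrivial n]
    (h : ∀ i j, L (single i j 1) i j ≠ 0) :
    ∃ D : Matrix n n ℂ, IsUnit D ∧ ((∀ A, L A = D * A * D⁻¹) ∨
      ∀ A : Matrix n n ℂ, L A = D * A.map (starRingEnd ℂ) * D⁻¹) := by
  obtain ⟨o, p, hop⟩ := exists_pair_ne n
  have hdiag : ∀ i, L (single i i 1) i i = 1 := fun i => by simp [hL.diag]
  have hrow : ∀ (i j l : n) (z : ℂ), L (single i j z) i j * L (single i l 1) i l =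
      L (single i l z) i l * L (single i j 1) i j := by
    intro i j l z
    obtain ⟨k, hk⟩ := exists_ne i
    have h1 := hL.entry_minor h (Function.update 1 i z) 1 i j k l
    have h2 := hL.entry_minor h 1 1 i j k l
    simp only [Function.update_self, Function.update_of_ne hk, Pi.one_apply, mul_one] at h1 h2
    refine mul_right_cancel₀ (h k l) ?_
    linear_combination L (single i l 1) i l * h1 - L (single i l z) i l * h2
  have hcol : ∀ (i j k : n) (z : ℂ), L (single i j z) i j * L (single k j 1) k j =
      L (single k j z) k j * L (single i j 1) i j := by
    intro i j k z
    obtain ⟨l, hl⟩ := exists_ne j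
    have h1 := hL.entry_minor h 1 (Function.update 1 j z) i j k l
    have h2 := hL.entry_minor h 1 1 i j k l
    simp only [Function.update_self, Function.update_of_ne hl, Pi.one_apply, one_mul, mul_one]
      at h1 h2
    refine mul_right_cancel₀ (h k l) ?_
    linear_combination L (single k j 1) k j * h1 - L (single k j z) k j * h2
  let r : ℂ →ₗ[ℝ] ℂ :=
    { toFun := fun z => L (single o o z) o o
      map_add' := fun z w => by simp [single_add]
      map_smul' := fun c z => by rw [← smul_single, map_smul]; simp }
  have hr : ∀ z, r z = L (single o o z) o o := fun z => rfl
  have hentry : ∀ i j z, L (single i j z) i j = r z * L (single i j 1) i j := by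
    intro i j z
    have h1 := hrow o o j z
    have h2 := hcol i j o z
    rw [hdiag, mul_one, ← hr] at h1
    refine mul_right_cancel₀ (h o j) ?_
    linear_combination h2 - L (single i j 1) i j * h1
  have hI : r Complex.I ^ 2 = -1 := by
    have h1 := hL.entry_minor h (Function.update 1 o Complex.I) (Function.update 1 o Complex.I)
      o o p p
    have h2 := hL.entry_minor h 1 1 o o p p
    simp only [Function.update_self, Function.update_of_ne hop.symm, Pi.one_apply, mul_one,
      one_mul, hdiag, hentry o p Complex.I, hentry p o Complex.I, Complex.I_mul_I] at h1 h2
    rw [← hr, map_neg, hr 1, hdiag] at h1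
    linear_combination r Complex.I ^ 2 * h2 - h1
  let d : n → ℂ := fun i => L (single i o 1) i o
  have hd : ∀ i, d i ≠ 0 := fun i => h i o
  have ht : ∀ i j, L (single i j 1) i j = d i * (d j)⁻¹ := by
    intro i j
    have h1 := hL.entry_minor h 1 1 i j j o
    simp only [Pi.one_apply, mul_one, hdiag] at h1
    rw [eq_mul_inv_iff_mul_eq₀ (hd j), h1]
  have hDinv : (diagonal d)⁻¹ = diagonal (fun i => (d i)⁻¹) := by
    refine inv_eq_left_inv ?_
    simp [hd]
  have hform : ∀ A i j, L A i j = d i * r (A i j) * (d j)⁻¹ := by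
    intro A i j
    rw [hL.apply_eq h, hentry, ht]
    ring
  refine ⟨diagonal d, by simpa [isUnit_diagonal, Pi.isUnit_iff] using hd, ?_⟩
  rw [hDinv]
  refine (Complex.eq_id_or_eq_conj_of_sq_eq_neg_one r (hdiag o) hI).imp
    (fun hr' A => ?_) (fun hr' A => ?_)
  · ext i j
    simp [hform, hr']
  · ext i j
    simp [hform, hr']

end RankOnePreserver

end RankOnePreserver

/-- The Mazur-Ulam type extension theorem for two norms given as functions on finite-dimensional
spaces. -/
theorem exists_linearEquiv_of_norm_sub_eq {V W : Type*} [AddCommGroup V] [Module ℝ V]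
    [FiniteDimensional ℝ V] [AddCommGroup W] [Module ℝ W] [FiniteDimensional ℝ W]
    (p : AddGroupNorm V) (q : AddGroupNorm W)
    (hp : ∀ (c : ℝ) x, p (c • x) = |c| * p x) (hq : ∀ (c : ℝ) x, q (c • x) = |c| * q x)
    {s : Set V} {t : Set W} (hs : ∀ x, ∀ ε > 0, ∃ y ∈ s, p (x - y) < ε)
    (ht : ∀ x, ∀ ε > 0, ∃ y ∈ t, q (x - y) < ε) (f : V → W)
    (hsurj : Set.SurjOn f s t) (hf : ∀ x ∈ s, ∀ y ∈ s, q (f x - f y) = p (x - y)) :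
    ∃ (T : V ≃ₗ[ℝ] W) (c : W), (∀ x, q (T x) = p x) ∧ ∀ x ∈ s, f x = T x + c := by
  let : NormedAddCommGroup V := p.toNormedAddCommGroup
  let : NormedAddCommGroup W := q.toNormedAddCommGroup
  let : NormedSpace ℝ V := ⟨fun c x => (hp c x).le⟩
  let : NormedSpace ℝ W := ⟨fun c x => (hq c x).le⟩
  have : CompleteSpace V := FiniteDimensional.complete ℝ V
  have : CompleteSpace W := FiniteDimensional.complete ℝ W
  have hs' : Dense s := Metric.dense_iff.2 fun x ε hε => by
    obtain ⟨y, hy, h⟩ := hs x ε hε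
    exact ⟨y, by rw [Metric.mem_ball, dist_comm, dist_eq_norm]; exact h, hy⟩
  have ht' : Dense t := Metric.dense_iff.2 fun x ε hε => by
    obtain ⟨y, hy, h⟩ := ht x ε hε
    exact ⟨y, by rw [Metric.mem_ball, dist_comm, dist_eq_norm]; exact h, hy⟩
  exact exists_linearEquiv_of_isometry_on_dense hs' ht' f hsurj hf

/-- Invertible matrices are dense for every norm. -/
theorem Matrix.exists_isUnit_norm_sub_lt {n : Type*} [Fintype n] [DecidableEq n]
    (p : AddGroupNorm (Matrix n n ℂ)) (hp : ∀ (c : ℂ) x, p (c • x) = ‖c‖ * p x)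
    (A : Matrix n n ℂ) {ε : ℝ} (hε : 0 < ε) : ∃ B, IsUnit B ∧ p (A - B) < ε := by
  have hpos : 0 < p 1 + 1 := by have := apply_nonneg p 1; linarith
  have hinf : ((fun r : ℝ => (r : ℂ)) '' Set.Ioo 0 (ε / (p 1 + 1))).Infinite :=
    (Set.Ioo_infinite (by positivity)).image Complex.ofReal_injective.injOn
  obtain ⟨_, ⟨r, hr, rfl⟩, hu⟩ := (hinf.sdiff A.finite_setOf_not_isUnit_add_smul).nonempty
  refine ⟨A + (r : ℂ) • (1 : Matrix n n ℂ), not_not.1 hu, ?_⟩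
  rw [sub_add_cancel_left, map_neg_eq_map, hp, Complex.norm_of_nonneg hr.1.le]
  have := (lt_div_iff₀ hpos).1 hr.2
  nlinarith [hr.1]

namespace Matrix

variable {n : Type*} [Fintype n] [DecidableEq n]

theorem exists_map_eq_vecMulVec {T : Matrix n n ℂ ≃ₗ[ℝ] Matrix n n ℂ}
    (hT : ∀ X, IsUnit (T X) ↔ IsUnit X) (x y : n → ℂ) :
    ∃ x' y', T (vecMulVec x y) = vecMulVec x' y' := by
  rw [exists_eq_vecMulVec_iff]
  intro B hB s t hs ht
  obtain ⟨B, rfl⟩ := T.surjective B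
  rw [hT] at hB
  rw [← map_smul, ← map_add, hT] at hs ht
  exact (exists_eq_vecMulVec_iff _).1 ⟨x, y, rfl⟩ B hB s t hs ht

/-- A real-linear bijection of `Mₙ(ℂ)`, `n ≥ 2`, preserving invertibility in both directions has
one of the four standard forms. -/
theorem exists_conj_of_preserves_isUnit [Nontrivial n] (T : Matrix n n ℂ ≃ₗ[ℝ] Matrix n n ℂ)
    (hT : ∀ X, IsUnit (T X) ↔ IsUnit X) :
    ∃ U : Matrix n n ℂ, IsUnit U ∧
      ((∀ M, T M = T 1 * (U * M * U⁻¹)) ∨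
       (∀ M, T M = T 1 * (U * Mᵀ * U⁻¹)) ∨
       (∀ M, T M = T 1 * (U * M.map (starRingEnd ℂ) * U⁻¹)) ∨
       (∀ M, T M = T 1 * (U * (M.map (starRingEnd ℂ))ᵀ * U⁻¹))) := by
  have hdiag := fun i : n => exists_map_eq_vecMulVec hT (Pi.single i 1) (Pi.single i 1)
  simp only [vecMulVec_single_single, mul_one] at hdiag
  choose x y hxy using hdiag
  set X : Matrix n n ℂ := of fun a i => x i a with hX
  set Y : Matrix n n ℂ := of fun i b => y i b with hY
  have hXY : T 1 = X * Y := by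
    rw [← sum_single_one, map_sum]
    simp_rw [hxy]
    ext a b
    simp [hX, hY, Matrix.sum_apply, Matrix.mul_apply, vecMulVec_apply]
  have hunit : IsUnit (X * Y) := hXY ▸ (hT 1).2 isUnit_one
  rw [isUnit_iff_isUnit_det, det_mul, IsUnit.mul_iff] at hunit
  obtain ⟨hXu, hYu⟩ := hunit
  have hTdiag : ∀ i, T (single i i 1) = X * single i i 1 * Y := by
    intro i
    have hx : X *ᵥ Pi.single i 1 = x i := by ext a; simp [hX]
    have hy : Pi.single i 1 ᵥ* Y = y i := by ext a; simp [hY]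
    rw [hxy, single_eq_single_vecMulVec_single, mul_vecMulVec, vecMulVec_mul, hx, hy]
  let L : Matrix n n ℂ →ₗ[ℝ] Matrix n n ℂ :=
    LinearMap.mulLeft ℝ X⁻¹ ∘ₗ LinearMap.mulRight ℝ Y⁻¹ ∘ₗ T.toLinearMap
  have hL : ∀ A, L A = X⁻¹ * (T A * Y⁻¹) := fun A => rfl
  have hTL : ∀ A, T A = X * L A * Y := by
    intro A
    rw [hL, mul_nonsing_inv_cancel_left _ _ hXu, nonsing_inv_mul_cancel_right _ _ hYu]
  have hLP : RankOnePreserver L :=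
    { injective := fun A B h => T.injective (by rw [hTL, hTL, h])
      rank_one := fun v w => by
        obtain ⟨v', w', h⟩ := exists_map_eq_vecMulVec hT v w
        exact ⟨_, _, by rw [hL, h, vecMulVec_mul, mul_vecMulVec]⟩
      diag := fun i => by
        rw [hL, hTdiag, mul_nonsing_inv_cancel_right _ _ hYu, nonsing_inv_mul_cancel_left _ _ hXu] }
  have hform : ∀ (D : Matrix n n ℂ) (A B : Matrix n n ℂ), L A = D * B * D⁻¹ →
      T A = T 1 * (Y⁻¹ * D * B * (Y⁻¹ * D)⁻¹) := by
    intro D A B h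
    rw [hTL, h, hXY, Matrix.mul_inv_rev, nonsing_inv_nonsing_inv _ hYu]
    simp only [Matrix.mul_assoc]
    rw [mul_nonsing_inv_cancel_left _ _ hYu]
  have hU : ∀ {D : Matrix n n ℂ}, IsUnit D → IsUnit (Y⁻¹ * D) := fun hD =>
    (((isUnit_iff_isUnit_det _).2 ((isUnit_nonsing_inv_det_iff).2 hYu))).mul hD
  obtain ⟨i, j, hij⟩ := exists_pair_ne n
  by_cases hs : L (single i j 1) i j ≠ 0
  · obtain ⟨D, hD, h⟩ := hLP.exists_diagonal_conj (hLP.apply_ne_zero_of_apply_ne_zero hij hs)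
    refine ⟨Y⁻¹ * D, hU hD, ?_⟩
    rcases h with h | h
    · exact Or.inl fun M => hform D _ _ (h M)
    · exact Or.inr (Or.inr (Or.inl fun M => hform D _ _ (h M)))
  · have hLP' := hLP.comp_transpose
    have hs' : (L ∘ₗ (transposeLinearEquiv n n ℝ ℂ).toLinearMap) (single j i 1) j i ≠ 0 := by
      obtain ⟨c, hc, h | h⟩ := hLP.exists_map_single_one hij
      · simp [h, hc] at hs
      · simpa [h] using hc
    obtain ⟨D, hD, h⟩ :=
      hLP'.exists_diagonal_conj (hLP'.apply_ne_zero_of_apply_ne_zero hij.symm hs')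
    have hcomp : ∀ M, L M = (L ∘ₗ (transposeLinearEquiv n n ℝ ℂ).toLinearMap) Mᵀ := fun M => by
      simp
    refine ⟨Y⁻¹ * D, hU hD, ?_⟩
    rcases h with h | h
    · exact Or.inr (Or.inl fun M => hform D _ _ (by rw [hcomp, h]))
    · exact Or.inr (Or.inr (Or.inr fun M => hform D _ _ (by rw [hcomp, h, transpose_map])))

/-- In size one, a real-linear isometry is a multiple of the identity or of the conjugation. -/
theorem eq_or_eq_conj_of_isometry [Unique n] (p q : AddGroupNorm (Matrix n n ℂ))
    (hp : ∀ (c : ℂ) x, p (c • x) = ‖c‖ * p x) (hq : ∀ (c : ℂ) x, q (c • x) = ‖c‖ * q x)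
    (T : Matrix n n ℂ ≃ₗ[ℝ] Matrix n n ℂ) (hT : ∀ X, q (T X) = p X) :
    (∀ M, T M = T 1 * M) ∨ ∀ M, T M = T 1 * M.map (starRingEnd ℂ) := by
  have hscal : ∀ M : Matrix n n ℂ, M = M default default • (1 : Matrix n n ℂ) := fun M => by
    ext i j
    simp [Subsingleton.elim i default, Subsingleton.elim j default]
  set a : ℂ := T 1 default default with ha
  have hT1 : T 1 = a • (1 : Matrix n n ℂ) := hscal _
  have ha0 : a ≠ 0 := fun h => by
    have : T 1 = 0 := by rw [hT1, h, zero_smul]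
    exact one_ne_zero ((map_eq_zero_iff T T.injective).1 this)
  let r : ℂ →ₗ[ℝ] ℂ :=
    { toFun := fun z => T (z • 1) default default / a
      map_add' := fun z w => by simp [add_smul, add_div]
      map_smul' := fun c z => by rw [smul_assoc, map_smul]; simp [mul_div_assoc] }
  have hTr : ∀ z : ℂ, T (z • 1) = r z • T 1 := by
    intro z
    rw [hT1, smul_smul, hscal (T (z • 1))]
    simp [r, ha0]
  have hr1 : r 1 = 1 := by simp [r, ← ha, ha0]
  have hnorm : ∀ z, ‖r z‖ = ‖z‖ := by
    intro z
    have h1 : p 1 ≠ 0 := (map_ne_zero_iff_ne_zero p).2 one_ne_zero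
    have := hT (z • 1)
    rw [hTr, hq, hT, hp] at this
    exact mul_right_cancel₀ h1 this
  have hsq : ∀ z, Complex.normSq (r z) = Complex.normSq z := fun z => by
    rw [Complex.normSq_eq_norm_sq, hnorm, Complex.normSq_eq_norm_sq]
  have hI : r Complex.I ^ 2 = -1 := by
    have h1 := hsq Complex.I
    have h2 := hsq (1 + Complex.I)
    rw [map_add, hr1] at h2
    simp [Complex.normSq_apply] at h1 h2
    have hre : (r Complex.I).re = 0 := by nlinarith
    apply Complex.ext
    · simp [sq, hre]; nlinarith
    · simp [sq, hre]
  have hM : ∀ M, T M = T 1 * (r (M default default) • (1 : Matrix n n ℂ)) := by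
    intro M
    conv_lhs => rw [hscal M, hTr]
    simp
  refine (Complex.eq_id_or_eq_conj_of_sq_eq_neg_one r hr1 hI).imp (fun h M => ?_) (fun h M => ?_)
  · rw [hM, h, ← hscal]
  · rw [hM, h]
    congr 1
    conv_rhs => rw [hscal (M.map _)]
    rfl

end Matrix

/-- Corollary 5.5: let `‖·‖ = N` and `‖·‖′ = N'` be any two matrix norms
(submultiplicative norms) on `Mₙ(ℂ)` and let `S` be a surjection between open
subgroups `𝔄, 𝔅` of `GLₙ(ℂ)` with `N' (S M - S N₀) = N (M - N₀)` for all
`M, N₀ ∈ 𝔄`.  Then there is an invertible matrix `U` such that on `𝔄` the map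
`S` has one of the forms `S(E)·U M U⁻¹`, `S(E)·U Mᵗ U⁻¹`, `S(E)·U M̄ U⁻¹`,
`S(E)·U M̄ᵗ U⁻¹`; in particular if `S` is unital it is multiplicative or
anti-multiplicative. -/
theorem matrix_isometry_open_subgroup_form
    {n : ℕ} (hn : 0 < n)
    (N N' : Matrix (Fin n) (Fin n) ℂ → ℝ)
    (hN0 : ∀ M, N M = 0 ↔ M = 0) (hN'0 : ∀ M, N' M = 0 ↔ M = 0)
    (hNadd : ∀ M P, N (M + P) ≤ N M + N P)
    (hN'add : ∀ M P, N' (M + P) ≤ N' M + N' P)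
    (hNsmul : ∀ (c : ℂ) (M), N (c • M) = ‖c‖ * N M)
    (hN'smul : ∀ (c : ℂ) (M), N' (c • M) = ‖c‖ * N' M)
    (hNmul : ∀ M P, N (M * P) ≤ N M * N P)
    (hN'mul : ∀ M P, N' (M * P) ≤ N' M * N' P)
    (𝔄 𝔅 : Set (Matrix (Fin n) (Fin n) ℂ))
    (h𝔄unit : ∀ M ∈ 𝔄, IsUnit M) (h𝔄one : (1 : Matrix (Fin n) (Fin n) ℂ) ∈ 𝔄)
    (h𝔄mul : ∀ M ∈ 𝔄, ∀ P ∈ 𝔄, M * P ∈ 𝔄)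
    (h𝔄inv : ∀ M ∈ 𝔄, M⁻¹ ∈ 𝔄) (h𝔄open : IsOpen 𝔄)
    (h𝔅unit : ∀ M ∈ 𝔅, IsUnit M) (h𝔅one : (1 : Matrix (Fin n) (Fin n) ℂ) ∈ 𝔅)
    (h𝔅mul : ∀ M ∈ 𝔅, ∀ P ∈ 𝔅, M * P ∈ 𝔅)
    (h𝔅inv : ∀ M ∈ 𝔅, M⁻¹ ∈ 𝔅) (h𝔅open : IsOpen 𝔅)
    (S : Matrix (Fin n) (Fin n) ℂ → Matrix (Fin n) (Fin n) ℂ)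
    (hmaps : Set.MapsTo S 𝔄 𝔅) (hsurj : Set.SurjOn S 𝔄 𝔅)
    (hiso : ∀ M ∈ 𝔄, ∀ P ∈ 𝔄, N' (S M - S P) = N (M - P)) :
    (∃ U : Matrix (Fin n) (Fin n) ℂ, IsUnit U ∧
      ((∀ M ∈ 𝔄, S M = S 1 * (U * M * U⁻¹)) ∨
       (∀ M ∈ 𝔄, S M = S 1 * (U * Mᵀ * U⁻¹)) ∨
       (∀ M ∈ 𝔄, S M = S 1 * (U * M.map (starRingEnd ℂ) * U⁻¹)) ∨
       (∀ M ∈ 𝔄, S M = S 1 * (U * (M.map (starRingEnd ℂ))ᵀ * U⁻¹)))) ∧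
    (S 1 = 1 →
      (∀ M ∈ 𝔄, ∀ P ∈ 𝔄, S (M * P) = S M * S P) ∨
      (∀ M ∈ 𝔄, ∀ P ∈ 𝔄, S (M * P) = S P * S M)) := by
  have mkNorm : ∀ P : Matrix (Fin n) (Fin n) ℂ → ℝ, (∀ M, P M = 0 ↔ M = 0) →
      (∀ M Q, P (M + Q) ≤ P M + P Q) → (∀ (c : ℂ) M, P (c • M) = ‖c‖ * P M) →
      ∃ p : AddGroupNorm (Matrix (Fin n) (Fin n) ℂ), ∀ M, p M = P M := fun P h0 hadd hsmul =>
    ⟨{ toFun := P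
       map_zero' := (h0 0).2 rfl
       add_le' := hadd
       neg' := fun M => by simpa using hsmul (-1) M
       eq_zero_of_map_eq_zero' := fun M => (h0 M).1 }, fun _ => rfl⟩
  obtain ⟨p, hp⟩ := mkNorm N hN0 hNadd hNsmul
  obtain ⟨q, hq⟩ := mkNorm N' hN'0 hN'add hN'smul
  simp only [← hp, ← hq] at hNsmul hN'smul hiso
  have h𝔄 : ∀ M, M ∈ 𝔄 ↔ IsUnit M := fun M =>
    ⟨h𝔄unit M, mem_of_isOpen_of_isUnit h𝔄unit h𝔄one h𝔄mul h𝔄inv h𝔄open⟩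
  have h𝔅 : ∀ M, M ∈ 𝔅 ↔ IsUnit M := fun M =>
    ⟨h𝔅unit M, mem_of_isOpen_of_isUnit h𝔅unit h𝔅one h𝔅mul h𝔅inv h𝔅open⟩
  have hreal : ∀ (c : ℝ) (M : Matrix (Fin n) (Fin n) ℂ), c • M = (c : ℂ) • M := fun c M => by
    ext; simp
  obtain ⟨T, C, hTnorm, hTS⟩ := exists_linearEquiv_of_norm_sub_eq p q
    (fun c M => by rw [hreal, hNsmul, Complex.norm_real, Real.norm_eq_abs])
    (fun c M => by rw [hreal, hN'smul, Complex.norm_real, Real.norm_eq_abs])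
    (fun A ε hε => by simpa only [h𝔄] using exists_isUnit_norm_sub_lt p hNsmul A hε)
    (fun A ε hε => by simpa only [h𝔅] using exists_isUnit_norm_sub_lt q hN'smul A hε)
    S hsurj hiso
  have hTC : ∀ X, IsUnit (T X + C) ↔ IsUnit X := by
    intro X
    rw [← h𝔅 (T X + C), ← h𝔄 X]
    constructor
    · intro hX
      obtain ⟨Z, hZ, h⟩ := hsurj hX
      rw [hTS Z hZ] at h
      rwa [← T.injective (add_right_cancel h)]
    · intro hX
      rw [← hTS X hX]
      exact hmaps hX
  obtain rfl : C = 0 := translation_eq_zero T C hTC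
  simp only [add_zero] at hTC hTS
  have hform : ∃ U : Matrix (Fin n) (Fin n) ℂ, IsUnit U ∧
      ((∀ M ∈ 𝔄, S M = S 1 * (U * M * U⁻¹)) ∨
       (∀ M ∈ 𝔄, S M = S 1 * (U * Mᵀ * U⁻¹)) ∨
       (∀ M ∈ 𝔄, S M = S 1 * (U * M.map (starRingEnd ℂ) * U⁻¹)) ∨
       (∀ M ∈ 𝔄, S M = S 1 * (U * (M.map (starRingEnd ℂ))ᵀ * U⁻¹))) := by
    rw [hTS 1 h𝔄one]
    rcases (Nat.succ_le_iff.2 hn).eq_or_lt with rfl | hn1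
    · refine ⟨1, isUnit_one, ?_⟩
      rcases eq_or_eq_conj_of_isometry p q hNsmul hN'smul T hTnorm with h | h
      · exact Or.inl fun M hM => by rw [hTS M hM, h M]; simp
      · exact Or.inr (Or.inr (Or.inl fun M hM => by rw [hTS M hM, h M]; simp))
    · have : Nontrivial (Fin n) := Fin.nontrivial_iff_two_le.2 hn1
      obtain ⟨U, hU, h⟩ := exists_conj_of_preserves_isUnit T hTC
      refine ⟨U, hU, h.imp ?_ (Or.imp ?_ (Or.imp ?_ ?_))⟩ <;>
      exact fun h M hM => by rw [hTS M hM, h M]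
  refine ⟨hform, fun hS1 => ?_⟩
  obtain ⟨U, hU, h⟩ := hform
  rw [isUnit_iff_isUnit_det] at hU
  have hconj : ∀ A B : Matrix (Fin n) (Fin n) ℂ,
      U * (A * B) * U⁻¹ = U * A * U⁻¹ * (U * B * U⁻¹) := fun A B => by
    simp only [Matrix.mul_assoc, nonsing_inv_mul_cancel_left _ _ hU]
  simp only [hS1, one_mul] at h
  rcases h with h | h | h | h
  · exact Or.inl fun M hM P hP => by rw [h _ (h𝔄mul M hM P hP), h M hM, h P hP, hconj]
  · exact Or.inr fun M hM P hP => by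
      rw [h _ (h𝔄mul M hM P hP), h M hM, h P hP, transpose_mul, hconj]
  · exact Or.inl fun M hM P hP => by
      rw [h _ (h𝔄mul M hM P hP), h M hM, h P hP, Matrix.map_mul, hconj]
  · exact Or.inr fun M hM P hP => by
      rw [h _ (h𝔄mul M hM P hP), h M hM, h P hP, Matrix.map_mul, transpose_mul, hconj]
end
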